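/- arXiv:2508.13082 — 7 statements merged into one kernel-verified Lean document; each statement's English description precedes it below -/
import Mathlib

section
/- Let Ψ(x, y) denote the number of positive integers n ≤ x all of whose prime factors are at most y. Fix ε > 0. Then there exists a constant C > 0 such that for all sufficiently large x and all y ≥ 2 with u := (log x)/(log y) satisfying 1 ≤ u ≤ (1 − ε)(log x)/(log log x), one has Ψ(x, y) ≤ C x exp(−(1/2) u log u). -/
open Real

/-- `Psi x y` is the number of positive integers `n ≤ x` all of whose prime factors are
at most `y`. -/
noncomputable def Psi (x y : ℝ) : ℕ :=
  letI := Classical.dec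
  ((Finset.Icc 1 ⌊x⌋₊).filter (fun n => ∀ p : ℕ, p.Prime → p ∣ n → (p : ℝ) ≤ y)).card

/-- The completely multiplicative function `n ↦ n ^ (-s)`. -/
noncomputable def rpowNegHom (s : ℝ) : ℕ →* ℝ where
  toFun n := (n : ℝ) ^ (-s)
  map_one' := by simp
  map_mul' m n := by push_cast; exact mul_rpow m.cast_nonneg n.cast_nonneg

@[simp]
lemma rpowNegHom_apply (s : ℝ) (n : ℕ) : rpowNegHom s n = (n : ℝ) ^ (-s) := rfl

lemma sum_primesLE_log_div_le (N : ℕ) :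
    ∑ p ∈ N.primesLE, log p / p ≤ 2 * log N := by
  rcases N.eq_zero_or_pos with rfl | hN
  · simp
  have h1 : ∑ n ∈ Finset.Ioc 0 N, log n ≤ N * log N := by
    calc ∑ n ∈ Finset.Ioc 0 N, log n ≤ ∑ n ∈ Finset.Ioc 0 N, log N := by
          refine Finset.sum_le_sum fun n hn => ?_
          rw [Finset.mem_Ioc] at hn
          exact log_le_log (by exact_mod_cast hn.1) (by exact_mod_cast hn.2)
      _ = N * log N := by simp
  have h2 := ArithmeticFunction.sum_Ioc_mul_zeta_eq_sum ArithmeticFunction.vonMangoldt N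
  rw [ArithmeticFunction.vonMangoldt_mul_zeta] at h2
  simp only [ArithmeticFunction.log_apply] at h2
  have h3 : ∑ p ∈ N.primesLE, log p * (N / (2 * p)) ≤
      ∑ n ∈ Finset.Ioc 0 N, ArithmeticFunction.vonMangoldt n * ((N / n : ℕ) : ℝ) := by
    refine le_trans (Finset.sum_le_sum fun p hp => ?_)
      (Finset.sum_le_sum_of_subset_of_nonneg (s := N.primesLE) ?_ ?_)
    · rw [Nat.mem_primesLE] at hp
      rw [ArithmeticFunction.vonMangoldt_apply_prime hp.2]
      have hp0 : (0 : ℝ) < p := by exact_mod_cast hp.2.pos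
      refine mul_le_mul_of_nonneg_left ?_ (log_nonneg (by exact_mod_cast hp.2.one_le))
      have h4 : 1 ≤ N / p := (Nat.one_le_div_iff hp.2.pos).2 hp.1
      have h5 : N < p * (N / p + 1) := by
        rw [mul_comm]
        exact Nat.lt_mul_of_div_lt (Nat.lt_succ_self _) hp.2.pos
      have h4' : (1 : ℝ) ≤ ((N / p : ℕ) : ℝ) := by exact_mod_cast h4
      have h5' : (N : ℝ) < p * (((N / p : ℕ) : ℝ) + 1) := by exact_mod_cast h5
      rw [div_le_iff₀ (by positivity)]
      nlinarith
    · intro p hp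
      rw [Nat.mem_primesLE] at hp
      exact Finset.mem_Ioc.2 ⟨hp.2.pos, hp.1⟩
    · intro i _ _
      exact mul_nonneg ArithmeticFunction.vonMangoldt_nonneg (Nat.cast_nonneg _)
  have h6 : ∑ p ∈ N.primesLE, log p * ((N : ℝ) / (2 * p)) =
      N / 2 * ∑ p ∈ N.primesLE, log p / p := by
    rw [Finset.mul_sum]
    refine Finset.sum_congr rfl fun p _ => ?_
    ring
  have hN' : (0 : ℝ) < N := by exact_mod_cast hN
  rw [h6, ← h2] at h3
  have h7 := h3.trans h1
  refine le_of_mul_le_mul_left (a := (N : ℝ) / 2) ?_ (by positivity)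
  linarith

lemma tsum_rpow_neg_le {s : ℝ} (hs : 1 < s) :
    ∑' n : ℕ, (n : ℝ) ^ (-s) ≤ 1 + 1 / (s - 1) := by
  have hs' : 0 < s - 1 := by linarith
  refine Real.tsum_le_of_sum_range_le (fun n => by positivity) fun n => ?_
  have key : ∀ m : ℕ, ∑ i ∈ Finset.range m, (1 + ((i + 1 : ℕ) : ℝ)) ^ (-s) ≤ 1 / (s - 1) := by
    intro m
    have h := AntitoneOn.sum_le_integral (f := fun x : ℝ => x ^ (-s)) (x₀ := 1) (a := m) ?_
    · refine h.trans ?_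
      rw [integral_rpow]
      · have : (0 : ℝ) ≤ (1 + m) ^ (-s + 1) := by positivity
        rw [one_rpow, show -s + 1 = -(s - 1) by ring, div_neg, ← neg_div]
        refine div_le_div_of_nonneg_right ?_ hs'.le
        rw [show -s + 1 = -(s - 1) by ring] at this
        linarith
      · right
        refine ⟨by linarith, ?_⟩
        rw [Set.uIcc_of_le (by simp)]
        simp
    · intro a ha b hb hab
      exact rpow_le_rpow_of_nonpos (by linarith [ha.1]) hab (by linarith)
  rcases n with _ | _ | m
  · simp; positivity
  · simp [zero_rpow (show -s ≠ 0 by linarith)]; positivity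
  · rw [Finset.sum_range_succ', Finset.sum_range_succ']
    have := key m
    have h0 : ((0 : ℕ) : ℝ) ^ (-s) = 0 := by
      rw [Nat.cast_zero, zero_rpow (by linarith)]
    rw [h0]
    simp only [zero_add, Nat.cast_one, one_rpow, add_zero]
    have h2 : ∑ k ∈ Finset.range m, ((k + 1 + 1 : ℕ) : ℝ) ^ (-s) =
      ∑ i ∈ Finset.range m, (1 + ((i + 1 : ℕ) : ℝ)) ^ (-s) := by
      refine Finset.sum_congr rfl fun k _ => ?_
      congr 1; push_cast; ring
    linarith

lemma prod_primesLE_one_sub_rpow_neg_inv_le {s : ℝ} (hs : 1 < s) (N : ℕ) :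
    ∏ p ∈ N.primesLE, (1 - (p : ℝ) ^ (-s))⁻¹ ≤ 1 + 1 / (s - 1) := by
  have hsum : Summable (fun n : ℕ => (n : ℝ) ^ (-s)) := summable_nat_rpow.2 (by linarith)
  have h := EulerProduct.prod_primesBelow_geometric_eq_tsum_smoothNumbers
    (f := rpowNegHom s) hsum (N + 1)
  simp only [rpowNegHom_apply] at h
  rw [Nat.primesLE, h]
  refine le_trans ?_ (tsum_rpow_neg_le hs)
  exact hsum.tsum_subtype_le _ _ (fun n => by positivity)

/-- Convexity of the exponential gives the comparison with the chord on `[0, log y]`. -/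
lemma rpow_sub_one_le_chord {v p y : ℝ} (hp : 1 ≤ p) (hpy : p ≤ y) (hy : 1 < y) :
    p ^ v - 1 ≤ log p / log y * y ^ v := by
  have hly : 0 < log y := log_pos hy
  have hlp : 0 ≤ log p := log_nonneg hp
  have ht1 : log p / log y ≤ 1 := by
    rw [div_le_one hly]; exact log_le_log (by linarith) hpy
  have ht0 : 0 ≤ log p / log y := by positivity
  have := convexOn_exp.2 (Set.mem_univ 0) (Set.mem_univ (log y * v))
    (sub_nonneg.2 ht1) ht0 (by ring)
  simp only [smul_eq_mul, mul_zero, zero_add, exp_zero, mul_one] at this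
  rw [rpow_def_of_pos (by linarith), rpow_def_of_pos (by linarith)]
  have e : log p / log y * (log y * v) = log p * v := by field_simp
  rw [e] at this
  linarith

lemma exists_prod_primesLE_le : ∃ K : ℝ, 0 ≤ K ∧ ∀ y σ : ℝ, 2 ≤ y → 1 / 4 ≤ σ → σ ≤ 1 →
    ∏ p ∈ ⌊y⌋₊.primesLE, (1 - (p : ℝ) ^ (-σ))⁻¹ ≤ (1 + log y) * exp (K * y ^ (1 - σ)) := by
  have h2 : (2 : ℝ) ^ (-(1 / 4) : ℝ) < 1 := rpow_lt_one_of_one_lt_of_neg (by norm_num) (by norm_num)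
  set A : ℝ := (1 - (2 : ℝ) ^ (-(1 / 4) : ℝ))⁻¹ with hA
  have hA0 : 0 < A := inv_pos.2 (by linarith)
  refine ⟨A * (2 * exp 1), by positivity, fun y σ hy hσ hσ1 => ?_⟩
  have hly : 0 < log y := log_pos (by linarith)
  set s : ℝ := 1 + 1 / log y with hs
  have hs1 : 1 < s := by
    have : 0 < 1 / log y := by positivity
    linarith
  have hys : y ^ (s - σ) = exp 1 * y ^ (1 - σ) := by
    rw [show s - σ = 1 / log y + (1 - σ) by rw [hs]; ring, rpow_add (by linarith)]
    congr 1
    rw [rpow_def_of_pos (by linarith)]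
    congr 1
    field_simp
  have hfac : ∀ p ∈ ⌊y⌋₊.primesLE, (1 - (p : ℝ) ^ (-σ))⁻¹ ≤
      (1 - (p : ℝ) ^ (-s))⁻¹ * exp (A * (log p / p / log y * (exp 1 * y ^ (1 - σ)))) := by
    intro p hp
    rw [Nat.mem_primesLE] at hp
    have hp2 : (2 : ℝ) ≤ p := by exact_mod_cast hp.2.two_le
    have hpy : (p : ℝ) ≤ y := (Nat.le_floor_iff (by linarith)).1 hp.1
    set a : ℝ := (p : ℝ) ^ (-σ) with ha
    set b : ℝ := (p : ℝ) ^ (-s) with hb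
    have ha2 : a ≤ (2 : ℝ) ^ (-(1 / 4) : ℝ) :=
      (rpow_le_rpow_of_nonpos (by norm_num) hp2 (by linarith)).trans
        (rpow_le_rpow_of_exponent_le (by norm_num) (by linarith))
    have hb0 : 0 < b := by positivity
    have hb1 : b < 1 := rpow_lt_one_of_one_lt_of_neg (by linarith) (by linarith)
    have ha1 : 0 < 1 - a := by linarith
    have hinv : (1 - a)⁻¹ ≤ A := inv_anti₀ (by linarith) (by linarith)
    have hbp : b ≤ 1 / p := by
      rw [one_div, ← rpow_neg_one]
      exact rpow_le_rpow_of_exponent_le (by linarith) (by linarith)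
    have hab : a - b ≤ log p / p / log y * (exp 1 * y ^ (1 - σ)) := by
      have hch := rpow_sub_one_le_chord (v := s - σ) (p := p) (y := y)
        (by linarith) hpy (by linarith)
      have e1 : a - b = b * ((p : ℝ) ^ (s - σ) - 1) := by
        rw [mul_sub, mul_one, hb, ← rpow_add (by linarith), ha]
        congr 2; ring
      have hlp : 0 ≤ log (p : ℝ) := log_nonneg (by linarith)
      rw [e1, ← hys]
      calc b * ((p : ℝ) ^ (s - σ) - 1) ≤ b * (log p / log y * y ^ (s - σ)) :=
            mul_le_mul_of_nonneg_left hch hb0.le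
        _ ≤ 1 / p * (log p / log y * y ^ (s - σ)) :=
            mul_le_mul_of_nonneg_right hbp (by positivity)
        _ = _ := by ring
    have hB : 0 ≤ log (p : ℝ) / p / log y * (exp 1 * y ^ (1 - σ)) := by
      have hlp : 0 ≤ log (p : ℝ) := log_nonneg (by linarith)
      positivity
    have h1 : (1 - b) * (1 - a)⁻¹ ≤ exp (A * (log p / p / log y * (exp 1 * y ^ (1 - σ)))) := by
      calc (1 - b) * (1 - a)⁻¹ = (1 - a)⁻¹ * (a - b) + 1 := by field_simp; ring
        _ ≤ A * (log p / p / log y * (exp 1 * y ^ (1 - σ))) + 1 := by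
            have : (1 - a)⁻¹ * (a - b) ≤ (1 - a)⁻¹ * (log p / p / log y * (exp 1 * y ^ (1 - σ))) :=
              mul_le_mul_of_nonneg_left hab (inv_pos.2 ha1).le
            linarith [mul_le_mul_of_nonneg_right hinv hB]
        _ ≤ _ := add_one_le_exp _
    rw [inv_mul_eq_div, le_div_iff₀ (by linarith)]
    linarith
  calc ∏ p ∈ ⌊y⌋₊.primesLE, (1 - (p : ℝ) ^ (-σ))⁻¹
      ≤ ∏ p ∈ ⌊y⌋₊.primesLE, ((1 - (p : ℝ) ^ (-s))⁻¹ *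
          exp (A * (log p / p / log y * (exp 1 * y ^ (1 - σ))))) := by
        refine Finset.prod_le_prod (fun p hp => ?_) hfac
        rw [Nat.mem_primesLE] at hp
        have hp2 : (1 : ℝ) ≤ p := by exact_mod_cast hp.2.one_le
        exact inv_nonneg.2 (sub_nonneg.2 (rpow_le_one_of_one_le_of_nonpos hp2 (by linarith)))
    _ = (∏ p ∈ ⌊y⌋₊.primesLE, (1 - (p : ℝ) ^ (-s))⁻¹) *
          exp (A * ((∑ p ∈ ⌊y⌋₊.primesLE, log p / p) / log y * (exp 1 * y ^ (1 - σ)))) := by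
        rw [Finset.prod_mul_distrib, ← exp_sum, Finset.sum_div, Finset.sum_mul, Finset.mul_sum]
    _ ≤ (1 + log y) * exp (A * (2 * exp 1) * y ^ (1 - σ)) := by
        have hP := prod_primesLE_one_sub_rpow_neg_inv_le hs1 ⌊y⌋₊
        rw [show 1 + 1 / (s - 1) = 1 + log y by rw [hs]; simp] at hP
        refine mul_le_mul hP (exp_le_exp.2 ?_) (exp_pos _).le (by linarith)
        have hS : (∑ p ∈ ⌊y⌋₊.primesLE, log p / p) / log y ≤ 2 := by
          rw [div_le_iff₀ hly]
          refine (sum_primesLE_log_div_le _).trans ?_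
          have : 0 < ⌊y⌋₊ := Nat.floor_pos.2 (by linarith)
          exact mul_le_mul_of_nonneg_left
            (log_le_log (by exact_mod_cast this) (Nat.floor_le (by linarith))) (by norm_num)
        rw [mul_assoc A]
        refine mul_le_mul_of_nonneg_left ?_ hA0.le
        rw [mul_assoc 2]
        exact mul_le_mul_of_nonneg_right hS (by positivity)

lemma sum_vonMangoldt_smoothNumbersUpTo_le_primeCounting (Z N : ℕ) :
    ∑ d ∈ Nat.smoothNumbersUpTo Z (N + 1), ArithmeticFunction.vonMangoldt d ≤
      Nat.primeCounting N * log Z := by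
  set M : ℕ := ∏ p ∈ N.primesLE, p ^ Nat.log p Z with hM
  have hM0 : M ≠ 0 := Finset.prod_ne_zero_iff.2 fun p hp =>
    pow_ne_zero _ (Nat.mem_primesLE.1 hp).2.ne_zero
  calc ∑ d ∈ Nat.smoothNumbersUpTo Z (N + 1), ArithmeticFunction.vonMangoldt d
      ≤ ∑ d ∈ M.divisors, ArithmeticFunction.vonMangoldt d := by
        rw [← Finset.sum_filter_ne_zero]
        refine Finset.sum_le_sum_of_subset_of_nonneg (fun d hd => ?_)
          fun i _ _ => ArithmeticFunction.vonMangoldt_nonneg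
        obtain ⟨hd, hd0⟩ := Finset.mem_filter.1 hd
        rw [Nat.mem_smoothNumbersUpTo, Nat.mem_smoothNumbers'] at hd
        rw [ArithmeticFunction.vonMangoldt_ne_zero_iff, isPrimePow_nat_iff] at hd0
        obtain ⟨p, k, hp, hk, rfl⟩ := hd0
        have hpN : p ∈ N.primesLE :=
          Nat.mem_primesLE.2 ⟨Nat.lt_succ_iff.1 (hd.2 p hp (dvd_pow_self p hk.ne')), hp⟩
        refine Nat.mem_divisors.2 ⟨?_, hM0⟩
        refine dvd_trans (pow_dvd_pow p ?_)
          (Finset.dvd_prod_of_mem (fun p => p ^ Nat.log p Z) hpN)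
        exact Nat.le_log_of_pow_le hp.one_lt hd.1
    _ = log M := ArithmeticFunction.vonMangoldt_sum
    _ = ∑ p ∈ N.primesLE, log ((p : ℝ) ^ Nat.log p Z) := by
        rw [hM, Nat.cast_prod, log_prod]
        · simp
        · intro p hp
          have := (Nat.mem_primesLE.1 hp).2.ne_zero
          positivity
    _ ≤ ∑ p ∈ N.primesLE, log Z := by
        refine Finset.sum_le_sum fun p hp => ?_
        have hp := (Nat.mem_primesLE.1 hp).2
        rcases Z.eq_zero_or_pos with rfl | hZ
        · simp
        · have : 0 < p ^ Nat.log p Z := pow_pos hp.pos _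
          exact log_le_log (by exact_mod_cast this)
            (by exact_mod_cast Nat.pow_log_le_self p hZ.ne')
    _ = Nat.primeCounting N * log Z := by
        rw [Finset.sum_const, nsmul_eq_mul, Nat.primesLE_card_eq_primeCounting]

lemma primeCounting_floor_le {y : ℝ} (hy : 2 ≤ y) :
    (Nat.primeCounting ⌊y⌋₊ : ℝ) ≤ 6 * (y / log y) := by
  have h := Chebyshev.pi_le_log4_mul_div (x := y) (by linarith)
  have hly : 0 < log y := log_pos (by linarith)
  have h4 : log 4 ≤ 2 := by
    rw [show (4 : ℝ) = 2 ^ 2 by norm_num, log_pow]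
    have := log_two_lt_d9
    push_cast
    linarith
  have hs : log √y = log y / 2 := log_sqrt (by linarith)
  have hs0 : 0 < √y := sqrt_pos.2 (by linarith)
  have hl : log y ≤ 2 * √y := by
    have := log_le_self hs0.le
    linarith
  have h1 : √y ≤ 2 * (y / log y) := by
    rw [← mul_div_assoc, le_div_iff₀ hly]
    nlinarith [mul_self_sqrt (show 0 ≤ y by linarith)]
  have h2 : log 4 * y / log √y ≤ 4 * (y / log y) := by
    rw [hs, show log 4 * y / (log y / 2) = (2 * log 4) * (y / log y) by field_simp]
    have : 0 < y / log y := by positivity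
    nlinarith
  linarith

lemma sum_vonMangoldt_smoothNumbersUpTo_le {y σ z : ℝ} (hy : 2 ≤ y) (hσ : 1 / 4 ≤ σ) (hσ1 : σ ≤ 1)
    (hz : 1 ≤ z) :
    ∑ d ∈ Nat.smoothNumbersUpTo ⌊z⌋₊ (⌊y⌋₊ + 1), ArithmeticFunction.vonMangoldt d ≤
      36 * (z ^ σ * y ^ (1 - σ)) := by
  have hly : 0 < log y := log_pos (by linarith)
  have hlz : 0 ≤ log z := log_nonneg hz
  rcases le_total z y with hzy | hyz
  · have h1 : ∑ d ∈ Nat.smoothNumbersUpTo ⌊z⌋₊ (⌊y⌋₊ + 1), ArithmeticFunction.vonMangoldt d ≤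
        Chebyshev.psi z := by
      rw [Chebyshev.psi]
      refine Finset.sum_le_sum_of_subset_of_nonneg (fun d hd => ?_)
        fun i _ _ => ArithmeticFunction.vonMangoldt_nonneg
      rw [Nat.mem_smoothNumbersUpTo] at hd
      exact Finset.mem_Ioc.2 ⟨Nat.pos_of_ne_zero (Nat.ne_zero_of_mem_smoothNumbers hd.2), hd.1⟩
    have h2 := Chebyshev.psi_le_const_mul_self (x := z) (by linarith)
    have h4 : log 4 ≤ 2 := by
      rw [show (4 : ℝ) = 2 ^ 2 by norm_num, log_pow]
      have := log_two_lt_d9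
      push_cast
      linarith
    have h3 : z ≤ z ^ σ * y ^ (1 - σ) := by
      calc z = z ^ σ * z ^ (1 - σ) := by rw [← rpow_add (by linarith)]; simp
        _ ≤ _ := by gcongr
    nlinarith
  · have h1 := sum_vonMangoldt_smoothNumbersUpTo_le_primeCounting ⌊z⌋₊ ⌊y⌋₊
    have h2 : log (⌊z⌋₊ : ℝ) ≤ log z :=
      log_le_log (by exact_mod_cast Nat.floor_pos.2 hz) (Nat.floor_le (by linarith))
    have h3 := primeCounting_floor_le hy
    set w : ℝ := z / y with hw
    have hw1 : 1 ≤ w := (one_le_div (by linarith)).2 hyz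
    have hlw : 0 ≤ log w := log_nonneg hw1
    have hzw : log z = log y + log w := by
      rw [hw, log_div (by linarith) (by linarith)]; ring
    have hwσ : 1 + log w / 4 ≤ w ^ σ := by
      rw [rpow_def_of_pos (by linarith)]
      nlinarith [add_one_le_exp (log w * σ)]
    have hly2 : 2 / 3 ≤ log y := by
      have : log 2 ≤ log y := log_le_log (by norm_num) hy
      linarith [log_two_gt_d9]
    have h5 : log z / log y ≤ 6 * w ^ σ := by
      rw [div_le_iff₀ hly]
      nlinarith
    have h6 : z ^ σ * y ^ (1 - σ) = y * w ^ σ := by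
      have : z = w * y := by rw [hw]; field_simp
      rw [this, mul_rpow (by linarith) (by linarith), mul_assoc, ← rpow_add (by linarith)]
      simp [mul_comm]
    calc _ ≤ (Nat.primeCounting ⌊y⌋₊ : ℝ) * log ⌊z⌋₊ := h1
      _ ≤ (6 * (y / log y)) * log z := by gcongr
      _ = 6 * y * (log z / log y) := by ring
      _ ≤ 6 * y * (6 * w ^ σ) := by gcongr
      _ = _ := by rw [h6]; ring

lemma sum_log_smoothNumbersUpTo_eq (X k : ℕ) :
    ∑ n ∈ Nat.smoothNumbersUpTo X k, log n = ∑ m ∈ Nat.smoothNumbersUpTo X k,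
      ∑ d ∈ Nat.smoothNumbersUpTo (X / m) k, ArithmeticFunction.vonMangoldt d := by
  calc ∑ n ∈ Nat.smoothNumbersUpTo X k, log n
      = ∑ n ∈ Nat.smoothNumbersUpTo X k, ∑ q ∈ n.divisorsAntidiagonal,
          ArithmeticFunction.vonMangoldt q.2 := by
        refine Finset.sum_congr rfl fun n _ => ?_
        rw [← ArithmeticFunction.vonMangoldt_sum,
          Nat.sum_divisorsAntidiagonal' (f := fun _ d => ArithmeticFunction.vonMangoldt d)]
    _ = ∑ a ∈ (Nat.smoothNumbersUpTo X k).sigma fun n => n.divisorsAntidiagonal,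
          ArithmeticFunction.vonMangoldt a.2.2 := by rw [Finset.sum_sigma]
    _ = ∑ b ∈ (Nat.smoothNumbersUpTo X k).sigma fun m => Nat.smoothNumbersUpTo (X / m) k,
          ArithmeticFunction.vonMangoldt b.2 := by
        refine Finset.sum_bij' (fun a _ => ⟨a.2.1, a.2.2⟩)
          (fun b _ => ⟨b.1 * b.2, (b.1, b.2)⟩) ?_ ?_ ?_ ?_ ?_
        · rintro ⟨n, m, d⟩ h
          simp only [Finset.mem_sigma, Nat.mem_smoothNumbersUpTo, Nat.mem_divisorsAntidiagonal]
            at h ⊢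
          obtain ⟨⟨hn, hs⟩, rfl, h0⟩ := h
          have hm : 0 < m := Nat.pos_of_ne_zero (left_ne_zero_of_mul h0)
          have hd : 0 < d := Nat.pos_of_ne_zero (right_ne_zero_of_mul h0)
          refine ⟨⟨(Nat.le_mul_of_pos_right m hd).trans hn, ?_⟩, ?_, ?_⟩
          · exact Nat.mem_smoothNumbers_of_dvd hs (dvd_mul_right _ _)
          · rw [Nat.le_div_iff_mul_le hm, mul_comm]; exact hn
          · exact Nat.mem_smoothNumbers_of_dvd hs (dvd_mul_left _ _)
        · rintro ⟨m, d⟩ h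
          simp only [Finset.mem_sigma, Nat.mem_smoothNumbersUpTo, Nat.mem_divisorsAntidiagonal]
            at h ⊢
          obtain ⟨⟨hm, hms⟩, hd, hds⟩ := h
          have hs := Nat.mul_mem_smoothNumbers hms hds
          have hm0 : 0 < m := Nat.pos_of_ne_zero (Nat.ne_zero_of_mem_smoothNumbers hms)
          rw [Nat.le_div_iff_mul_le hm0, mul_comm] at hd
          exact ⟨⟨hd, hs⟩, trivial, Nat.ne_zero_of_mem_smoothNumbers hs⟩
        · rintro ⟨n, m, d⟩ h
          simp only [Finset.mem_sigma, Nat.mem_divisorsAntidiagonal] at h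
          obtain ⟨_, rfl, _⟩ := h
          rfl
        · rintro ⟨m, d⟩ _
          rfl
        · rintro ⟨n, m, d⟩ _
          rfl
    _ = _ := by rw [Finset.sum_sigma]

lemma sum_rpow_neg_smoothNumbersUpTo_le {σ : ℝ} (hσ : 0 < σ) (X N : ℕ) :
    ∑ m ∈ Nat.smoothNumbersUpTo X (N + 1), (m : ℝ) ^ (-σ) ≤
      ∏ p ∈ N.primesLE, (1 - (p : ℝ) ^ (-σ))⁻¹ := by
  have h := (EulerProduct.summable_and_hasSum_smoothNumbers_prod_primesBelow_geometric
    (f := rpowNegHom σ) (fun {p} hp => ?_) (N + 1)).2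
  · have h' := (hasSum_subtype_iff_indicator (f := fun n : ℕ => (n : ℝ) ^ (-σ))).1 h
    refine le_trans (le_of_eq ?_) (sum_le_hasSum (Nat.smoothNumbersUpTo X (N + 1)) ?_ h')
    · refine Finset.sum_congr rfl fun m hm => ?_
      rw [Set.indicator_of_mem (Nat.mem_smoothNumbersUpTo.1 hm).2]
    · intro i _
      exact Set.indicator_nonneg (fun n _ => by positivity) i
  · have hp1 : (1 : ℝ) < p := by exact_mod_cast hp.one_lt
    rw [rpowNegHom_apply, norm_of_nonneg (by positivity)]
    exact rpow_lt_one_of_one_lt_of_neg hp1 (by linarith)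

lemma Psi_eq_card_smoothNumbersUpTo {x y : ℝ} (hy : 0 ≤ y) :
    Psi x y = (Nat.smoothNumbersUpTo ⌊x⌋₊ (⌊y⌋₊ + 1)).card := by
  classical
  rw [Psi]
  congr 1
  ext n
  rw [Finset.mem_filter, Finset.mem_Icc, Nat.mem_smoothNumbersUpTo, Nat.mem_smoothNumbers']
  have e : ∀ p : ℕ, (p : ℝ) ≤ y ↔ p < ⌊y⌋₊ + 1 := fun p => by
    rw [Nat.lt_succ_iff, Nat.le_floor_iff hy]
  constructor
  · rintro ⟨⟨_, h2⟩, h3⟩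
    exact ⟨h2, fun p hp hpn => (e p).1 (h3 p hp hpn)⟩
  · rintro ⟨h1, h2⟩
    have := Nat.ne_zero_of_mem_smoothNumbers (Nat.mem_smoothNumbers'.2 h2)
    exact ⟨⟨Nat.pos_of_ne_zero this, h1⟩, fun p hp hpn => (e p).2 (h2 p hp hpn)⟩

/-- Splitting at `√x`, the larger smooth numbers are counted with weight `log n`. -/
lemma Psi_mul_log_le {x y : ℝ} (hx : 1 ≤ x) (hy : 0 ≤ y) :
    Psi x y * log x ≤ √x * log x +
      2 * ∑ n ∈ Nat.smoothNumbersUpTo ⌊x⌋₊ (⌊y⌋₊ + 1), log n := by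
  rw [Psi_eq_card_smoothNumbersUpTo hy]
  set A := Nat.smoothNumbersUpTo ⌊x⌋₊ (⌊y⌋₊ + 1)
  have hlx : 0 ≤ log x := log_nonneg hx
  have hA : ∀ n ∈ A, 0 < n := fun n hn =>
    Nat.pos_of_ne_zero (Nat.ne_zero_of_mem_smoothNumbers (Nat.mem_smoothNumbersUpTo.1 hn).2)
  have h1 : ∑ n ∈ A, log x ≤
      ∑ n ∈ A, ((if n ≤ ⌊√x⌋₊ then log x else 0) + 2 * log n) := by
    refine Finset.sum_le_sum fun n hn => ?_
    have hn0 : (1 : ℝ) ≤ n := by exact_mod_cast hA n hn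
    have hln : 0 ≤ log (n : ℝ) := log_nonneg hn0
    split_ifs with h
    · linarith
    · have : √x < n := by
        by_contra! hc
        exact h (Nat.le_floor hc)
      have hl := log_le_log (sqrt_pos.2 (by linarith)) this.le
      rw [log_sqrt (by linarith)] at hl
      linarith
  rw [Finset.sum_const, nsmul_eq_mul, Finset.sum_add_distrib, ← Finset.mul_sum,
    ← Finset.sum_filter, Finset.sum_const, nsmul_eq_mul] at h1
  refine h1.trans (add_le_add_left (mul_le_mul_of_nonneg_right ?_ hlx) _)
  have hcard : (A.filter (· ≤ ⌊√x⌋₊)).card ≤ ⌊√x⌋₊ := by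
    calc _ ≤ (Finset.Icc 1 ⌊√x⌋₊).card := Finset.card_le_card fun n hn => by
          rw [Finset.mem_filter] at hn
          exact Finset.mem_Icc.2 ⟨hA n hn.1, hn.2⟩
      _ = _ := by simp
  exact (Nat.cast_le.2 hcard).trans (Nat.floor_le (sqrt_nonneg x))

lemma exists_Psi_mul_log_le : ∃ K : ℝ, 0 ≤ K ∧ ∀ x y σ : ℝ, 1 ≤ x → 2 ≤ y → 1 / 4 ≤ σ → σ ≤ 1 →
    Psi x y * log x ≤ √x * log x +
      72 * (x ^ σ * y ^ (1 - σ)) * ((1 + log y) * exp (K * y ^ (1 - σ))) := by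
  obtain ⟨K, hK, h⟩ := exists_prod_primesLE_le
  refine ⟨K, hK, fun x y σ hx hy hσ hσ1 => ?_⟩
  refine (Psi_mul_log_le hx (by linarith)).trans (add_le_add_right ?_ _)
  have h1 := sum_log_smoothNumbersUpTo_eq ⌊x⌋₊ (⌊y⌋₊ + 1)
  have h2 := (sum_rpow_neg_smoothNumbersUpTo_le (σ := σ) (by linarith) ⌊x⌋₊ ⌊y⌋₊).trans
    (h y σ hy hσ hσ1)
  have h3 : ∑ m ∈ Nat.smoothNumbersUpTo ⌊x⌋₊ (⌊y⌋₊ + 1),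
      ∑ d ∈ Nat.smoothNumbersUpTo (⌊x⌋₊ / m) (⌊y⌋₊ + 1), ArithmeticFunction.vonMangoldt d ≤
      36 * (x ^ σ * y ^ (1 - σ)) *
        ∑ m ∈ Nat.smoothNumbersUpTo ⌊x⌋₊ (⌊y⌋₊ + 1), (m : ℝ) ^ (-σ) := by
    rw [Finset.mul_sum]
    refine Finset.sum_le_sum fun m hm => ?_
    rw [Nat.mem_smoothNumbersUpTo] at hm
    have hm0 : (0 : ℝ) < m := by
      exact_mod_cast Nat.pos_of_ne_zero (Nat.ne_zero_of_mem_smoothNumbers hm.2)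
    have hmx : (m : ℝ) ≤ x := (Nat.le_floor_iff (by linarith)).1 hm.1
    rw [← Nat.floor_div_natCast]
    refine (sum_vonMangoldt_smoothNumbersUpTo_le hy hσ hσ1 ((one_le_div hm0).2 hmx)).trans
      (le_of_eq ?_)
    rw [div_rpow (by linarith) hm0.le, rpow_neg hm0.le]
    ring
  have h4 : 0 ≤ 36 * (x ^ σ * y ^ (1 - σ)) := by positivity
  linarith [mul_le_mul_of_nonneg_left h2 h4]

lemma exists_log_add_rpow_le (K : ℝ) : ∃ C : ℝ, 0 ≤ C ∧ ∀ u : ℝ, 1 ≤ u →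
    3 / 4 * log u + K * u ^ (3 / 4 : ℝ) ≤ 1 / 4 * (u * log u) + C := by
  set M : ℝ := 3 + 4 * |K| with hM
  have hM0 : 0 ≤ M := by positivity
  refine ⟨3 / 4 * M + |K| * exp M, by positivity, fun u hu => ?_⟩
  have hlu : 0 ≤ log u := log_nonneg hu
  have hpow : u ^ (3 / 4 : ℝ) ≤ u := by
    simpa using rpow_le_rpow_of_exponent_le hu (show (3 / 4 : ℝ) ≤ 1 by norm_num)
  have hKu : K * u ^ (3 / 4 : ℝ) ≤ |K| * u :=
    (mul_le_mul_of_nonneg_right (le_abs_self K) (by positivity)).trans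
      (mul_le_mul_of_nonneg_left hpow (abs_nonneg K))
  have hexp : 0 ≤ |K| * exp M := by positivity
  rcases le_total M (log u) with h | h
  · have := mul_le_mul_of_nonneg_left h (show 0 ≤ u by linarith)
    have := log_le_self (show 0 ≤ u by linarith)
    rw [hM] at *
    linarith
  · have h1 : u ≤ exp M := (log_le_iff_le_exp (by linarith)).1 h
    have h2 := mul_le_mul_of_nonneg_left h1 (abs_nonneg K)
    have h3 : 0 ≤ u * log u := by positivity
    linarith

theorem stmt10 (ε : ℝ) (hε : 0 < ε) :
    ∃ C : ℝ, 0 < C ∧ ∃ x₀ : ℝ, ∀ x ≥ x₀, ∀ y : ℝ, 2 ≤ y →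
      1 ≤ Real.log x / Real.log y →
      Real.log x / Real.log y ≤ (1 - ε) * (Real.log x / Real.log (Real.log x)) →
      (Psi x y : ℝ) ≤ C * x *
        Real.exp (-(1 / 2) * (Real.log x / Real.log y) * Real.log (Real.log x / Real.log y)) := by
  obtain ⟨K, hK, hPsi⟩ := exists_Psi_mul_log_le
  obtain ⟨C, hC, hbound⟩ := exists_log_add_rpow_le K
  refine ⟨1 + 216 * exp C, by positivity, exp (exp 1), fun x hx y hy hu hu' => ?_⟩
  have hx0 : 0 < x := (exp_pos _).trans_le hx
  have hL : exp 1 ≤ log x := (le_log_iff_exp_le hx0).2 hx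
  have hL0 : 0 < log x := (exp_pos _).trans_le hL
  have hLL : 1 ≤ log (log x) := (le_log_iff_exp_le hL0).2 hL
  have hx1 : 1 ≤ x := by
    by_contra! hc
    linarith [log_nonpos hx0.le hc.le]
  have hly : 0 < log y := log_pos (by linarith)
  have hly2 : 2 / 3 ≤ log y := by
    have : log 2 ≤ log y := log_le_log (by norm_num) hy
    linarith [log_two_gt_d9]
  set u : ℝ := log x / log y with hudef
  have hu0 : 0 < u := by linarith
  have hLu : log x = u * log y := by rw [hudef]; field_simp
  have hu1 : u ≤ log x / log (log x) := by
    refine hu'.trans ?_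
    have : 0 ≤ log x / log (log x) := by positivity
    nlinarith
  have huL : u * log (log x) ≤ log x := by rwa [le_div_iff₀ (by linarith)] at hu1
  have hLLy : log (log x) ≤ log y :=
    le_of_mul_le_mul_left (huL.trans_eq hLu) hu0
  have hlu : log u ≤ log (log x) := by
    refine log_le_log hu0 ?_
    nlinarith
  have hlu0 : 0 ≤ log u := log_nonneg hu
  set σ : ℝ := 1 - 3 / 4 * (log u / log y) with hσdef
  have hr0 : 0 ≤ log u / log y := by positivity
  have hr1 : log u / log y ≤ 1 := (div_le_one hly).2 (hlu.trans hLLy)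
  have hyσ : y ^ (1 - σ) = u ^ (3 / 4 : ℝ) := by
    rw [rpow_def_of_pos (by linarith), rpow_def_of_pos hu0, hσdef]
    congr 1
    field_simp
    ring
  have hxσ : x ^ σ = x * exp (-(3 / 4) * (u * log u)) := by
    rw [rpow_def_of_pos hx0]
    nth_rewrite 2 [← exp_log hx0]
    rw [← exp_add, hσdef, hLu]
    congr 1
    field_simp
    ring
  have hP := hPsi x y σ hx1 hy (by linarith) (by linarith)
  rw [hyσ, hxσ] at hP
  set E : ℝ := exp (-(1 / 2) * u * log u) with hE
  have hsqrt : √x ≤ x * E := by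
    rw [sqrt_eq_rpow, rpow_def_of_pos hx0]
    nth_rewrite 2 [← exp_log hx0]
    rw [hE, ← exp_add]
    refine exp_le_exp.2 ?_
    have : u * log u ≤ log x := (mul_le_mul_of_nonneg_left hlu hu0.le).trans huL
    linarith
  have hmain : exp (-(3 / 4) * (u * log u)) * u ^ (3 / 4 : ℝ) * exp (K * u ^ (3 / 4 : ℝ)) ≤
      exp C * E := by
    have e : u ^ (3 / 4 : ℝ) = exp (3 / 4 * log u) := by
      rw [rpow_def_of_pos hu0, mul_comm]
    nth_rewrite 1 [e]
    rw [hE, ← exp_add, ← exp_add, ← exp_add]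
    refine exp_le_exp.2 ?_
    linarith [hbound u hu]
  have hlog : 1 + log y ≤ 3 * log x := by
    have : log y ≤ log x := by rw [hLu]; nlinarith
    linarith
  have hfin : Psi x y * log x ≤ (1 + 216 * exp C) * x * E * log x := by
    calc Psi x y * log x ≤ _ := hP
      _ = √x * log x + 72 * x * (1 + log y) *
          (exp (-(3 / 4) * (u * log u)) * u ^ (3 / 4 : ℝ) * exp (K * u ^ (3 / 4 : ℝ))) := by ring
      _ ≤ x * E * log x + 72 * x * (3 * log x) * (exp C * E) := by gcongr
      _ = _ := by ring
  exact le_of_mul_le_mul_right hfin hL0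
end

section
/- Fix δ ∈ (0, 1) and ε > 0. Then there exist a constant C > 0 and x₀ such that for all x ≥ x₀, ∑ 3^{ω(d)}/d ≤ C x^{−δ/2 + ε}, where the sum runs over all integers d with x^δ < d ≤ x that are (log x)²-smooth (all prime factors of d are at most (log x)²). -/
open Real

/-- Partial sums of `n ^ (b - 1)` are at most `M ^ b / b`. -/
lemma sum_Icc_rpow_sub_one_le {b : ℝ} (hb0 : 0 < b) (hb1 : b ≤ 1) (M : ℕ) :
    ∑ n ∈ Finset.Icc 1 M, (n : ℝ) ^ (b - 1) ≤ (M : ℝ) ^ b / b := by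
  induction M with
  | zero => simp [hb0.ne']
  | succ M ih =>
    rw [Finset.sum_Icc_succ_top (by omega)]
    set N : ℝ := ((M + 1 : ℕ) : ℝ) with hN
    have hMN : (M : ℝ) = N - 1 := by rw [hN]; push_cast; ring
    have hN1 : 1 ≤ N := by rw [hN]; exact_mod_cast Nat.succ_le_succ (Nat.zero_le M)
    have hN0 : 0 < N := by linarith
    have hinv : N⁻¹ ≤ 1 := inv_le_one_of_one_le₀ hN1
    have hbern : (1 + -N⁻¹) ^ b ≤ 1 + b * -N⁻¹ :=
      rpow_one_add_le_one_add_mul_self (by linarith) hb0.le hb1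
    have hM : (M : ℝ) ^ b = N ^ b * (1 + -N⁻¹) ^ b := by
      rw [← mul_rpow hN0.le (by linarith), hMN]
      congr 1
      field_simp
      ring
    have hstep : (M : ℝ) ^ b ≤ N ^ b - b * N ^ (b - 1) := by
      rw [hM, rpow_sub_one hN0.ne']
      calc N ^ b * (1 + -N⁻¹) ^ b ≤ N ^ b * (1 + b * -N⁻¹) := by gcongr
        _ = _ := by ring
    calc _ ≤ (M : ℝ) ^ b / b + N ^ (b - 1) := by gcongr
      _ ≤ (N ^ b - b * N ^ (b - 1)) / b + N ^ (b - 1) := by gcongr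
      _ = N ^ b / b := by field_simp; ring

lemma prime_rpow_sub_one_le {b : ℝ} (hb : b ≤ 1 / 2) {p : ℕ} (hp : p.Prime) :
    (p : ℝ) ^ (b - 1) ≤ 3 / 4 := by
  have hp2 : (2 : ℝ) ≤ p := by exact_mod_cast hp.two_le
  have hsq : ((p : ℝ) ^ (b - 1)) ^ 2 ≤ 1 / 2 := by
    rw [← rpow_natCast, ← rpow_mul (by positivity)]
    calc (p : ℝ) ^ ((b - 1) * (2 : ℕ)) ≤ (p : ℝ) ^ (-1 : ℝ) := by
          apply rpow_le_rpow_of_exponent_le (by linarith)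
          push_cast
          linarith
      _ = 1 / p := by rw [rpow_neg_one, one_div]
      _ ≤ 1 / 2 := by gcongr
  nlinarith

/-- The multiplicative weight `3 ^ ω(d) * d ^ (b - 1)` of Rankin's trick. -/
noncomputable def rankinWeight (b : ℝ) (d : ℕ) : ℝ :=
  (3 : ℝ) ^ d.primeFactors.card * (d : ℝ) ^ (b - 1)

lemma rankinWeight_nonneg (b : ℝ) (d : ℕ) : 0 ≤ rankinWeight b d := by
  unfold rankinWeight
  positivity

lemma rankinWeight_one (b : ℝ) : rankinWeight b 1 = 1 := by
  simp [rankinWeight]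

lemma rankinWeight_mul (b : ℝ) {m n : ℕ} (h : m.Coprime n) :
    rankinWeight b (m * n) = rankinWeight b m * rankinWeight b n := by
  unfold rankinWeight
  rw [h.primeFactors_mul, Finset.card_union_of_disjoint h.disjoint_primeFactors, pow_add,
    Nat.cast_mul, mul_rpow (by positivity) (by positivity)]
  ring

lemma hasSum_rankinWeight_prime_pow {b : ℝ} (hb : b ≤ 1 / 2) {p : ℕ} (hp : p.Prime) :
    HasSum (fun k : ℕ => rankinWeight b (p ^ k)) (3 * (1 - (p : ℝ) ^ (b - 1))⁻¹ - 2) := by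
  have hr := prime_rpow_sub_one_le hb hp
  have hgeom := (hasSum_geometric_of_lt_one (r := (p : ℝ) ^ (b - 1)) (by positivity)
    (by linarith)).mul_left 3
  have hsub := hgeom.sub (hasSum_ite_eq 0 (2 : ℝ))
  refine (funext fun k => ?_ : (fun k : ℕ => rankinWeight b (p ^ k)) = _) ▸ hsub
  rcases eq_or_ne k 0 with rfl | hk
  · simp [rankinWeight_one]
    norm_num
  · have hpow : ((p : ℝ) ^ k) ^ (b - 1) = ((p : ℝ) ^ (b - 1)) ^ k := by
      rw [← rpow_natCast, ← rpow_natCast, ← rpow_mul (by positivity), ← rpow_mul (by positivity),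
        mul_comm]
    simp [rankinWeight, Nat.primeFactors_prime_pow hk hp, hk, hpow]

lemma tsum_rankinWeight_prime_pow_le {b : ℝ} (hb : b ≤ 1 / 2) {p : ℕ} (hp : p.Prime) :
    ∑' k : ℕ, rankinWeight b (p ^ k) ≤ rexp (12 * (p : ℝ) ^ (b - 1)) := by
  rw [(hasSum_rankinWeight_prime_pow hb hp).tsum_eq]
  have hr := prime_rpow_sub_one_le hb hp
  have hr0 : 0 ≤ (p : ℝ) ^ (b - 1) := by positivity
  refine le_trans ?_ (add_one_le_exp _)
  set r := (p : ℝ) ^ (b - 1)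
  have hinv : (1 - r)⁻¹ ≤ 1 + 4 * r := by
    rw [inv_le_iff_one_le_mul₀ (by linarith)]
    nlinarith
  linarith

/-- Sums of `rankinWeight` over `M`-smooth numbers are bounded by an Euler product. -/
lemma sum_rankinWeight_smooth_le {b : ℝ} (hb0 : 0 < b) (hb : b ≤ 1 / 2) (M : ℕ) (s : Finset ℕ)
    (hs : ∀ d ∈ s, d ∈ Nat.smoothNumbers (M + 1)) :
    ∑ d ∈ s, rankinWeight b d ≤ rexp (12 * ((M : ℝ) ^ b / b)) := by
  have hsum := (EulerProduct.summable_and_hasSum_smoothNumbers_prod_primesBelow_tsum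
    (rankinWeight_one b) (rankinWeight_mul b)
    (fun {p} hp => (hasSum_rankinWeight_prime_pow hb hp).summable.norm) (M + 1)).2
  have hle := sum_le_hasSum (s.subtype (· ∈ Nat.smoothNumbers (M + 1)))
    (fun d _ => rankinWeight_nonneg b d) hsum
  rw [Finset.sum_subtype_of_mem _ hs] at hle
  calc _ ≤ _ := hle
    _ ≤ ∏ p ∈ (M + 1).primesBelow, rexp (12 * (p : ℝ) ^ (b - 1)) := by
      refine Finset.prod_le_prod (fun p _ => tsum_nonneg fun k => rankinWeight_nonneg b _) ?_
      exact fun p hp => tsum_rankinWeight_prime_pow_le hb (Nat.prime_of_mem_primesBelow hp)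
    _ = rexp (12 * ∑ p ∈ (M + 1).primesBelow, (p : ℝ) ^ (b - 1)) := by
      rw [Finset.mul_sum, exp_sum]
    _ ≤ rexp (12 * ∑ n ∈ Finset.Icc 1 M, (n : ℝ) ^ (b - 1)) := by
      gcongr
      intro p hp
      have h1 := (Nat.prime_of_mem_primesBelow hp).pos
      have h2 := Nat.lt_of_mem_primesBelow hp
      simp only [Finset.mem_Icc]
      omega
    _ ≤ _ := by
      gcongr
      exact sum_Icc_rpow_sub_one_le hb0 (by linarith) M

lemma three_pow_div_le_mul_rankinWeight {b z : ℝ} (hb : 0 < b) (hz : 0 < z) {d : ℕ}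
    (hd : z < d) :
    (3 : ℝ) ^ d.primeFactors.card / (d : ℝ) ≤ z ^ (-b) * rankinWeight b d := by
  have hd0 : (0 : ℝ) < d := hz.trans hd
  have hmono : (d : ℝ) ^ (-b) ≤ z ^ (-b) :=
    rpow_le_rpow_of_nonpos hz hd.le (by linarith)
  have hsplit : (d : ℝ)⁻¹ = (d : ℝ) ^ (-b) * (d : ℝ) ^ (b - 1) := by
    rw [← rpow_add hd0, ← rpow_neg_one]
    congr 1
    ring
  rw [rankinWeight, div_eq_mul_inv, hsplit]
  calc _ = (d : ℝ) ^ (-b) * ((3 : ℝ) ^ d.primeFactors.card * (d : ℝ) ^ (b - 1)) := by ring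
    _ ≤ _ := by gcongr

lemma eventually_mul_log_sq_rpow_le {b c : ℝ} (hb : b < 1 / 2) (hc : 0 < c) (K : ℝ) :
    ∀ᶠ x : ℝ in Filter.atTop, K * (Real.log x ^ 2) ^ b ≤ c * Real.log x := by
  have hlim : Filter.Tendsto (fun t : ℝ => K * t ^ (-(1 - 2 * b))) Filter.atTop (nhds 0) := by
    simpa using (tendsto_rpow_neg_atTop (show 0 < 1 - 2 * b by linarith)).const_mul K
  filter_upwards [tendsto_log_atTop.eventually (hlim.eventually_le_const hc),
    tendsto_log_atTop.eventually_gt_atTop 0] with x hx h0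
  calc K * (Real.log x ^ 2) ^ b = K * Real.log x ^ (-(1 - 2 * b)) * Real.log x := by
        rw [← rpow_natCast, ← rpow_mul h0.le, mul_assoc, ← rpow_add_one h0.ne']
        congr 2
        push_cast
        ring
    _ ≤ c * Real.log x := by gcongr

theorem stmt12 (δ ε : ℝ) (hδ0 : 0 < δ) (hδ1 : δ < 1) (hε : 0 < ε) :
    ∃ C : ℝ, 0 < C ∧ ∃ x₀ : ℝ, ∀ x ≥ x₀,
      letI := Classical.dec
      ∑ d ∈ (Finset.Icc 1 ⌊x⌋₊).filter
          (fun d : ℕ => x ^ δ < (d : ℝ) ∧ ∀ p : ℕ, p.Prime → p ∣ d → (p : ℝ) ≤ (Real.log x) ^ 2),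
        (3 : ℝ) ^ d.primeFactors.card / (d : ℝ)
      ≤ C * x ^ (-δ / 2 + ε) := by
  obtain ⟨η, hη0, hηε, hη4⟩ : ∃ η : ℝ, 0 < η ∧ η ≤ ε / 2 ∧ η ≤ 1 / 4 :=
    ⟨min (ε / 2) (1 / 4), by positivity, min_le_left _ _, min_le_right _ _⟩
  set b : ℝ := 1 / 2 - η with hb
  have hb0 : 0 < b := by linarith
  obtain ⟨x₁, hx₁⟩ := Filter.eventually_atTop.1
    (eventually_mul_log_sq_rpow_le (b := b) (by linarith) (half_pos hε) (12 / b))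
  refine ⟨1, one_pos, max x₁ 1, fun x hx => ?_⟩
  have hx1 : 1 ≤ x := (le_max_right _ _).trans hx
  have hx0 : 0 < x := by linarith
  have hlog := hx₁ x ((le_max_left _ _).trans hx)
  set M := ⌊Real.log x ^ 2⌋₊
  have hM : (M : ℝ) ≤ Real.log x ^ 2 := Nat.floor_le (by positivity)
  let := Classical.dec
  refine (Finset.sum_le_sum fun d hd => three_pow_div_le_mul_rankinWeight hb0
    (rpow_pos_of_pos hx0 δ) (Finset.mem_filter.1 hd).2.1).trans ?_
  calc _ ≤ (x ^ δ) ^ (-b) * rexp (12 * ((M : ℝ) ^ b / b)) := by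
        rw [← Finset.mul_sum]
        gcongr
        refine sum_rankinWeight_smooth_le hb0 (by linarith) M _ fun d hd => ?_
        rw [Nat.mem_smoothNumbers']
        intro p hp hpd
        exact Nat.lt_succ_of_le (Nat.le_floor ((Finset.mem_filter.1 hd).2.2 p hp hpd))
    _ ≤ (x ^ δ) ^ (-b) * rexp (Real.log x * (ε / 2)) := by
        refine mul_le_mul_of_nonneg_left (exp_le_exp.2 ?_) (by positivity)
        calc 12 * ((M : ℝ) ^ b / b) = 12 / b * (M : ℝ) ^ b := by ring
          _ ≤ 12 / b * (Real.log x ^ 2) ^ b := by gcongr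
          _ ≤ _ := by linarith
    _ = x ^ (δ * -b + ε / 2) := by
        rw [← rpow_def_of_pos hx0, ← rpow_mul hx0.le, ← rpow_add hx0]
    _ ≤ 1 * x ^ (-δ / 2 + ε) := by
        rw [one_mul]
        apply rpow_le_rpow_of_exponent_le hx1
        rw [hb]
        nlinarith
end

section
/- Fix δ ∈ (0, 1). Then there exist constants c > 0, C > 0 and x₀ such that for all x ≥ x₀ and every positive integer t with x^{1/t} ≥ (log x)², one has ∑ 3^{ω(d)}/d ≤ C (log x)^3 exp(−c t log t), where the sum runs over all integers d with x^δ < d ≤ x that are x^{1/t}-smooth (all prime factors of d are at most x^{1/t}). -/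
open Real

theorem sum_primesBelow_log_div_le (n : ℕ) (hn : 0 < n) :
    ∑ p ∈ Nat.primesBelow (n + 1), log p / p ≤ 2 * log n := by
  have hfact : ∑ p ∈ Nat.primesBelow (n + 1), log p * ((n / p : ℕ) : ℝ) ≤ n * log n := by
    calc ∑ p ∈ Nat.primesBelow (n + 1), log p * ((n / p : ℕ) : ℝ)
        = ∑ p ∈ Nat.primesBelow (n + 1), ∑ k ∈ Finset.Ioc 0 n, if p ∣ k then log p else 0 := by
          refine Finset.sum_congr rfl fun p _ => ?_
          rw [← Finset.sum_filter, Finset.sum_const, Nat.Ioc_filter_dvd_card_eq_div, nsmul_eq_mul,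
            mul_comm]
      _ = ∑ k ∈ Finset.Ioc 0 n, ∑ p ∈ Nat.primesBelow (n + 1), if p ∣ k then log p else 0 :=
          Finset.sum_comm
      _ ≤ ∑ k ∈ Finset.Ioc 0 n, log n := by
          refine Finset.sum_le_sum fun k hk => ?_
          obtain ⟨hk0, hkn⟩ := Finset.mem_Ioc.1 hk
          have hset : (Nat.primesBelow (n + 1)).filter (· ∣ k) = k.primeFactors := by
            ext p
            simp only [Finset.mem_filter, Nat.mem_primesBelow, Nat.mem_primeFactors]
            refine ⟨fun h => ⟨h.1.2, h.2, hk0.ne'⟩, fun h => ⟨⟨?_, h.1⟩, h.2.1⟩⟩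
            have := Nat.le_of_dvd hk0 h.2.1
            lia
          rw [← Finset.sum_filter, hset, ← Real.log_prod
            (fun p hp => by exact_mod_cast (Nat.prime_of_mem_primeFactors hp).ne_zero)]
          refine Real.log_le_log ?_ ?_
          · exact Finset.prod_pos fun p hp => by
              exact_mod_cast (Nat.prime_of_mem_primeFactors hp).pos
          · rw [← Nat.cast_prod]
            exact_mod_cast (Nat.le_of_dvd hk0 (Nat.prod_primeFactors_dvd k)).trans hkn
      _ = n * log n := by simp
  have hn' : (0 : ℝ) < n := by exact_mod_cast hn
  have hhalf : n * ∑ p ∈ Nat.primesBelow (n + 1), log p / p ≤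
      2 * ∑ p ∈ Nat.primesBelow (n + 1), log p * ((n / p : ℕ) : ℝ) := by
    rw [Finset.mul_sum, Finset.mul_sum]
    refine Finset.sum_le_sum fun p hp => ?_
    obtain ⟨hpn, hp⟩ := Nat.mem_primesBelow.1 hp
    have hp0 : (0 : ℝ) < p := by exact_mod_cast hp.pos
    have hdiv : n ≤ 2 * (n / p) * p := by
      have h1 : 1 ≤ n / p := (Nat.one_le_div_iff hp.pos).2 (by lia)
      have h2 := Nat.div_add_mod n p
      have h3 := Nat.mod_lt n hp.pos
      nlinarith
    have hdiv' : (n : ℝ) ≤ 2 * ((n / p : ℕ) : ℝ) * p := by exact_mod_cast hdiv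
    have hlog : 0 ≤ log p := Real.log_natCast_nonneg p
    calc (n : ℝ) * (log p / p) = log p * (n / p) := by ring
      _ ≤ log p * (2 * ((n / p : ℕ) : ℝ)) := by
          gcongr
          rwa [div_le_iff₀ hp0]
      _ = _ := by ring
  refine le_of_mul_le_mul_left ?_ hn'
  linarith

theorem prod_primesBelow_one_sub_rpow_inv_le_tsum (N : ℕ) {s : ℝ} (hs : 1 < s) :
    ∏ p ∈ Nat.primesBelow N, (1 - (p : ℝ) ^ (-s))⁻¹ ≤ ∑' n : ℕ, 1 / (n : ℝ) ^ s := by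
  have hsum : Summable fun n : ℕ => 1 / (n : ℝ) ^ s := Real.summable_one_div_nat_rpow.2 hs
  obtain ⟨f, hf⟩ : ∃ f : ℕ →*₀ ℝ, ∀ n : ℕ, f n = (n : ℝ) ^ (-s) :=
    ⟨{ toFun := fun n => (n : ℝ) ^ (-s)
       map_zero' := by simp [Real.zero_rpow (by linarith : -s ≠ 0)]
       map_one' := by simp
       map_mul' := fun m n => by
         simp [Real.mul_rpow (Nat.cast_nonneg m) (Nat.cast_nonneg n)] }, fun _ => rfl⟩
  have hf' : ∀ n : ℕ, 1 / (n : ℝ) ^ s = f n := fun n => by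
    rw [hf, Real.rpow_neg (Nat.cast_nonneg n), one_div]
  have hfs : Summable f := hsum.congr hf'
  have hprod : ∏ p ∈ Nat.primesBelow N, (1 - f p)⁻¹ = ∑' m : N.smoothNumbers, f m := by
    refine EulerProduct.prod_primesBelow_geometric_eq_tsum_smoothNumbers (F := ℝ) (f := f) ?_ N
    exact hfs
  have hle := hfs.tsum_subtype_le f N.smoothNumbers fun n => by rw [hf]; positivity
  rw [← hprod, ← tsum_congr hf'] at hle
  simpa only [hf] using hle

theorem natCast_rpow_neg_le_three_quarters {p : ℕ} (hp : 2 ≤ p) {σ : ℝ} (hσ : 3 / 4 ≤ σ) :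
    (p : ℝ) ^ (-σ) ≤ 3 / 4 := by
  have hp' : (2 : ℝ) ≤ p := by exact_mod_cast hp
  calc (p : ℝ) ^ (-σ) ≤ (p : ℝ) ^ (-(1 / 2) : ℝ) :=
        Real.rpow_le_rpow_of_exponent_le (by linarith) (by linarith)
    _ ≤ (2 : ℝ) ^ (-(1 / 2) : ℝ) :=
        Real.rpow_le_rpow_of_nonpos (by norm_num) hp' (by norm_num)
    _ ≤ 3 / 4 := by
        rw [Real.rpow_neg (by norm_num), ← Real.sqrt_eq_rpow]
        refine inv_le_of_inv_le₀ (by norm_num) (Real.le_sqrt_of_sq_le (by norm_num))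

theorem sum_three_pow_card_primeFactors_mul_rpow_le {N : ℕ} {σ : ℝ} (hσ : 0 < σ) {F : Finset ℕ}
    (hF : ∀ d ∈ F, d ∈ Nat.smoothNumbers N) :
    ∑ d ∈ F, (3 : ℝ) ^ d.primeFactors.card * (d : ℝ) ^ (-σ) ≤
      (∏ p ∈ Nat.primesBelow N, (1 - (p : ℝ) ^ (-σ))⁻¹) ^ 3 := by
  let f : ℕ → ℝ := fun d => (3 : ℝ) ^ d.primeFactors.card * (d : ℝ) ^ (-σ)
  have hf0 : ∀ d, 0 ≤ f d := fun d => by positivity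
  have hf1 : f 1 = 1 := by simp [f]
  have hmul : ∀ {m n : ℕ}, m.Coprime n → f (m * n) = f m * f n := by
    intro m n hmn
    simp only [f]
    rw [hmn.primeFactors_mul, Finset.card_union_of_disjoint hmn.disjoint_primeFactors, pow_add,
      Nat.cast_mul, Real.mul_rpow (Nat.cast_nonneg m) (Nat.cast_nonneg n)]
    ring
  have hu0 : ∀ {p : ℕ}, p.Prime → 0 < (p : ℝ) ^ (-σ) := fun hp =>
    Real.rpow_pos_of_pos (by exact_mod_cast hp.pos) _
  have hu1 : ∀ {p : ℕ}, p.Prime → (p : ℝ) ^ (-σ) < 1 := fun hp =>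
    Real.rpow_lt_one_of_one_lt_of_neg (by exact_mod_cast hp.one_lt) (by linarith)
  have hpow : ∀ {p : ℕ}, p.Prime → ∀ n, f (p ^ (n + 1)) =
      3 * (p : ℝ) ^ (-σ) * ((p : ℝ) ^ (-σ)) ^ n := by
    intro p hp n
    simp only [f]
    rw [Nat.primeFactors_prime_pow n.succ_ne_zero hp, Finset.card_singleton, Nat.cast_pow,
      ← Real.rpow_pow_comm (Nat.cast_nonneg p)]
    ring
  have hsum : ∀ {p : ℕ}, p.Prime → Summable fun n : ℕ => f (p ^ n) := by
    intro p hp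
    rw [← summable_nat_add_iff 1]
    simp_rw [hpow hp]
    exact (summable_geometric_of_lt_one (hu0 hp).le (hu1 hp)).mul_left _
  obtain ⟨hS, hH⟩ := EulerProduct.summable_and_hasSum_smoothNumbers_prod_primesBelow_tsum hf1 hmul
    (fun hp => (hsum hp).norm) N
  have hle : ∑ d ∈ F, f d ≤ ∏ p ∈ Nat.primesBelow N, ∑' n : ℕ, f (p ^ n) := by
    rw [← hH.tsum_eq, ← Finset.sum_coe_sort]
    let e : F ↪ Nat.smoothNumbers N :=
      ⟨fun d => ⟨d, hF d d.2⟩, fun a b h => Subtype.ext (by simpa using h)⟩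
    have h := hH.summable.sum_le_tsum (Finset.univ.map e) fun d _ => hf0 d
    rw [Finset.sum_map] at h
    exact h
  refine hle.trans ?_
  rw [← Finset.prod_pow]
  refine Finset.prod_le_prod (fun p _ => tsum_nonneg fun n => hf0 _) fun p hp => ?_
  have hp := (Nat.mem_primesBelow.1 hp).2
  rw [(hsum hp).tsum_eq_zero_add]
  simp_rw [hpow hp]
  rw [tsum_mul_left, tsum_geometric_of_lt_one (hu0 hp).le (hu1 hp), pow_zero, hf1]
  have h0 := hu0 hp
  have h1 := hu1 hp
  generalize (p : ℝ) ^ (-σ) = u at h0 h1 ⊢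
  have hv : 0 < 1 - u := by linarith
  rw [inv_pow, ← mul_le_mul_iff_left₀ (pow_pos hv 3), inv_mul_cancel₀ (pow_pos hv 3).ne']
  have : (1 + 3 * u * (1 - u)⁻¹) * (1 - u) ^ 3 = (1 - u) ^ 3 + 3 * u * (1 - u) ^ 2 := by
    field_simp
  rw [this]
  nlinarith [pow_pos h0 2, pow_pos h0 3]

theorem prod_primesBelow_one_sub_rpow_inv_le {y η κ : ℝ} (hy : 2 ≤ y) (hη : 0 ≤ η)
    (hη' : η ≤ 1 / 4) (hκ : 0 < κ) :
    ∏ p ∈ Nat.primesBelow (⌊y⌋₊ + 1), (1 - (p : ℝ) ^ (-(1 - η)))⁻¹ ≤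
      (∑' n : ℕ, 1 / (n : ℝ) ^ (1 + κ)) * exp (8 * (κ + η) * y ^ η * log y) := by
  have hlogsum : ∑ p ∈ Nat.primesBelow (⌊y⌋₊ + 1), log p / p ≤ 2 * log y := by
    have hfl : 0 < ⌊y⌋₊ := Nat.floor_pos.2 (by linarith)
    refine (sum_primesBelow_log_div_le _ hfl).trans ?_
    gcongr
    exact Nat.floor_le (by linarith)
  have hterm : ∀ p ∈ Nat.primesBelow (⌊y⌋₊ + 1), (1 - (p : ℝ) ^ (-(1 - η)))⁻¹ ≤
      (1 - (p : ℝ) ^ (-(1 + κ)))⁻¹ * exp (4 * (κ + η) * y ^ η * (log p / p)) := by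
    intro p hp
    obtain ⟨hpy, hp⟩ := Nat.mem_primesBelow.1 hp
    have hp0 : (0 : ℝ) < p := by exact_mod_cast hp.pos
    have hp1 : (1 : ℝ) ≤ p := by exact_mod_cast hp.one_lt.le
    have hpy' : (p : ℝ) ≤ y := (Nat.le_floor_iff (by linarith)).1 (Nat.lt_succ_iff.1 hpy)
    have hu : (p : ℝ) ^ (-(1 - η)) ≤ 3 / 4 :=
      natCast_rpow_neg_le_three_quarters hp.two_le (by linarith)
    have hvu : (p : ℝ) ^ (-(1 + κ)) = (p : ℝ) ^ (-(1 - η)) * exp (-((κ + η) * log p)) := by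
      rw [Real.rpow_def_of_pos hp0, Real.rpow_def_of_pos hp0, ← Real.exp_add]
      ring_nf
    have hu' : (p : ℝ) ^ (-(1 - η)) ≤ y ^ η / p := by
      rw [show -(1 - η) = η - 1 by ring, Real.rpow_sub_one hp0.ne']
      gcongr
    have hu0 : 0 < (p : ℝ) ^ (-(1 - η)) := Real.rpow_pos_of_pos hp0 _
    have hlog : 0 ≤ log p := Real.log_natCast_nonneg p
    have hw : 0 ≤ (κ + η) * log p := by positivity
    have hdiff : (p : ℝ) ^ (-(1 - η)) - (p : ℝ) ^ (-(1 + κ)) ≤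
        (κ + η) * y ^ η * (log p / p) := by
      have := Real.add_one_le_exp (-((κ + η) * log p))
      calc (p : ℝ) ^ (-(1 - η)) - (p : ℝ) ^ (-(1 + κ))
          = (p : ℝ) ^ (-(1 - η)) * (1 - exp (-((κ + η) * log p))) := by rw [hvu]; ring
        _ ≤ (p : ℝ) ^ (-(1 - η)) * ((κ + η) * log p) := by gcongr; linarith
        _ ≤ (y ^ η / p) * ((κ + η) * log p) := by gcongr
        _ = _ := by ring
    have hvle : (p : ℝ) ^ (-(1 + κ)) ≤ (p : ℝ) ^ (-(1 - η)) := by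
      rw [hvu]
      exact mul_le_of_le_one_right hu0.le (Real.exp_le_one_iff.2 (by linarith))
    generalize (p : ℝ) ^ (-(1 - η)) = u at *
    generalize (p : ℝ) ^ (-(1 + κ)) = v at *
    have hexp : 1 + 4 * (u - v) ≤ exp (4 * (κ + η) * y ^ η * (log p / p)) := by
      refine le_trans ?_ (Real.add_one_le_exp _)
      linarith
    have hv : 0 < 1 - v := by linarith
    have hu1 : 0 < 1 - u := by linarith
    rw [inv_mul_eq_div, le_div_iff₀ hv, inv_mul_le_iff₀ hu1]
    calc 1 - v ≤ (1 - u) * (1 + 4 * (u - v)) := by nlinarith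
      _ ≤ _ := by gcongr
  calc ∏ p ∈ Nat.primesBelow (⌊y⌋₊ + 1), (1 - (p : ℝ) ^ (-(1 - η)))⁻¹
      ≤ ∏ p ∈ Nat.primesBelow (⌊y⌋₊ + 1),
          (1 - (p : ℝ) ^ (-(1 + κ)))⁻¹ * exp (4 * (κ + η) * y ^ η * (log p / p)) := by
        refine Finset.prod_le_prod (fun p hp => ?_) hterm
        have := natCast_rpow_neg_le_three_quarters (Nat.mem_primesBelow.1 hp).2.two_le
          (by linarith : 3 / 4 ≤ 1 - η)
        exact inv_nonneg.2 (by linarith)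
    _ = (∏ p ∈ Nat.primesBelow (⌊y⌋₊ + 1), (1 - (p : ℝ) ^ (-(1 + κ)))⁻¹) *
          exp (4 * (κ + η) * y ^ η * ∑ p ∈ Nat.primesBelow (⌊y⌋₊ + 1), log p / p) := by
        rw [Finset.prod_mul_distrib, ← Real.exp_sum, Finset.mul_sum]
    _ ≤ (∑' n : ℕ, 1 / (n : ℝ) ^ (1 + κ)) * exp (4 * (κ + η) * y ^ η * (2 * log y)) := by
        gcongr
        exact prod_primesBelow_one_sub_rpow_inv_le_tsum _ (by linarith)
    _ = _ := by ring_nf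

theorem sum_three_pow_card_primeFactors_div_le {X y η κ : ℝ} (hX : 0 < X) (hy : 2 ≤ y)
    (hη : 0 ≤ η) (hη' : η ≤ 1 / 4) (hκ : 0 < κ) {F : Finset ℕ}
    (hF : ∀ d ∈ F, X < d ∧ ∀ p : ℕ, p.Prime → p ∣ d → (p : ℝ) ≤ y) :
    ∑ d ∈ F, (3 : ℝ) ^ d.primeFactors.card / (d : ℝ) ≤
      X ^ (-η) *
        ((∑' n : ℕ, 1 / (n : ℝ) ^ (1 + κ)) * exp (8 * (κ + η) * y ^ η * log y)) ^ 3 := by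
  have hprod : 0 ≤ ∏ p ∈ Nat.primesBelow (⌊y⌋₊ + 1), (1 - (p : ℝ) ^ (-(1 - η)))⁻¹ :=
    Finset.prod_nonneg fun p hp => by
      have := natCast_rpow_neg_le_three_quarters (Nat.mem_primesBelow.1 hp).2.two_le
        (by linarith : 3 / 4 ≤ 1 - η)
      exact inv_nonneg.2 (by linarith)
  calc ∑ d ∈ F, (3 : ℝ) ^ d.primeFactors.card / (d : ℝ)
      ≤ ∑ d ∈ F, X ^ (-η) * ((3 : ℝ) ^ d.primeFactors.card * (d : ℝ) ^ (-(1 - η))) := by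
        refine Finset.sum_le_sum fun d hd => ?_
        have hXd := (hF d hd).1
        have hd0 : (0 : ℝ) < d := hX.trans hXd
        have h1 : (d : ℝ) ^ (-η) ≤ X ^ (-η) :=
          Real.rpow_le_rpow_of_nonpos hX hXd.le (by linarith)
        calc (3 : ℝ) ^ d.primeFactors.card / (d : ℝ)
            = (d : ℝ) ^ (-η) * ((3 : ℝ) ^ d.primeFactors.card * (d : ℝ) ^ (-(1 - η))) := by
              rw [mul_left_comm, ← Real.rpow_add hd0, show -η + -(1 - η) = -1 by ring,
                Real.rpow_neg_one, div_eq_mul_inv]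
          _ ≤ _ := by gcongr
    _ = X ^ (-η) * ∑ d ∈ F, (3 : ℝ) ^ d.primeFactors.card * (d : ℝ) ^ (-(1 - η)) := by
        rw [Finset.mul_sum]
    _ ≤ X ^ (-η) * (∏ p ∈ Nat.primesBelow (⌊y⌋₊ + 1), (1 - (p : ℝ) ^ (-(1 - η)))⁻¹) ^ 3 := by
        gcongr
        refine sum_three_pow_card_primeFactors_mul_rpow_le (by linarith) fun d hd => ?_
        obtain ⟨hXd, hsm⟩ := hF d hd
        refine ⟨fun h => ?_, fun p hp => ?_⟩
        · rw [h, Nat.cast_zero] at hXd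
          linarith
        · have hp' := Nat.prime_of_mem_primeFactorsList hp
          exact Nat.lt_succ_of_le (Nat.le_floor (hsm p hp' (Nat.dvd_of_mem_primeFactorsList hp)))
    _ ≤ _ := by
        gcongr
        exact prod_primesBelow_one_sub_rpow_inv_le hy hη hη' hκ

theorem exists_forall_sqrt_mul_log_le {δ : ℝ} (hδ : 0 < δ) :
    ∃ B : ℝ, ∀ t : ℝ, 1 ≤ t → 24 * (1 + log t / 2) * √t - δ / 4 * t * log t ≤ B := by
  set T : ℝ := (144 / δ) ^ 2 + 3 with hT
  have hT3 : 3 ≤ T := by rw [hT]; linarith [sq_nonneg (144 / δ)]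
  refine ⟨24 * (1 + T / 2) * T, fun t ht => ?_⟩
  have hlog : 0 ≤ log t := Real.log_nonneg ht
  rcases le_total T t with h | h
  · have hlog1 : 1 ≤ log t := by
      rw [Real.le_log_iff_exp_le (by linarith)]
      linarith [Real.exp_one_lt_d9]
    have hsqrt : 144 / δ ≤ √t := Real.le_sqrt_of_sq_le (by linarith)
    have h36 : 36 ≤ δ / 4 * √t := by
      rw [div_le_iff₀ hδ] at hsqrt
      linarith
    have hsq : √t * √t = t := Real.mul_self_sqrt (by linarith)
    have hs0 : 0 ≤ √t := Real.sqrt_nonneg t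
    have : 24 * (1 + log t / 2) * √t ≤ δ / 4 * t * log t := by
      calc 24 * (1 + log t / 2) * √t ≤ 36 * log t * √t :=
          mul_le_mul_of_nonneg_right (by linarith) hs0
        _ ≤ (δ / 4 * √t) * log t * √t := by gcongr
        _ = δ / 4 * (√t * √t) * log t := by ring
        _ = _ := by rw [hsq]
    have : 0 ≤ 24 * (1 + T / 2) * T := by positivity
    linarith
  · have h1 : log t ≤ T := (Real.log_le_self (by linarith)).trans h
    have h2 : √t ≤ T := by
      refine le_trans ?_ h
      rw [Real.sqrt_le_left (by linarith)]
      nlinarith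
    have h3 : 0 ≤ δ / 4 * t * log t := by positivity
    have h4 : 24 * (1 + log t / 2) * √t ≤ 24 * (1 + T / 2) * T := by gcongr
    linarith

theorem stmt13 (δ : ℝ) (hδ0 : 0 < δ) (hδ1 : δ < 1) :
    ∃ c : ℝ, 0 < c ∧ ∃ C : ℝ, 0 < C ∧ ∃ x₀ : ℝ, ∀ x ≥ x₀, ∀ t : ℕ, 0 < t →
      (Real.log x) ^ 2 ≤ x ^ (1 / (t : ℝ)) →
      letI := Classical.dec
      ∑ d ∈ (Finset.Icc 1 ⌊x⌋₊).filter
          (fun d : ℕ => x ^ δ < (d : ℝ) ∧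
            ∀ p : ℕ, p.Prime → p ∣ d → (p : ℝ) ≤ x ^ (1 / (t : ℝ))),
        (3 : ℝ) ^ d.primeFactors.card / (d : ℝ)
      ≤ C * (Real.log x) ^ 3 * Real.exp (-c * t * Real.log t) := by
  obtain ⟨B, hB⟩ := exists_forall_sqrt_mul_log_le hδ0
  obtain ⟨ε, hε, hzeta⟩ : ∃ ε > 0, ∀ κ : ℝ, 0 < κ → κ < ε →
      κ * ∑' n : ℕ, 1 / (n : ℝ) ^ (1 + κ) ≤ 2 := by
    have h := tendsto_sub_mul_tsum_nat_rpow.eventually_le_const (by norm_num : (1 : ℝ) < 2)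
    obtain ⟨u, hu, h⟩ := mem_nhdsGT_iff_exists_Ioo_subset.1 h
    refine ⟨u - 1, sub_pos.2 hu, fun κ h0 h1 => ?_⟩
    simpa using h (⟨by linarith, by linarith⟩ : 1 + κ ∈ Set.Ioo 1 u)
  refine ⟨δ / 4, by linarith, 8 * exp B, by positivity, exp (exp (1 + 1 / ε)), ?_⟩
  intro x hx t ht hxt
  have hE1 : 1 < exp (1 + 1 / ε) := Real.one_lt_exp_iff.2 (by positivity)
  have hx0 : 0 < x := (Real.exp_pos _).trans_le hx
  have hL : exp (1 + 1 / ε) ≤ log x := (Real.le_log_iff_exp_le hx0).2 hx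
  have hL1 : 1 < log x := hE1.trans_le hL
  have ht0 : (0 : ℝ) < t := by exact_mod_cast ht
  have ht1 : (1 : ℝ) ≤ t := by exact_mod_cast ht
  set y : ℝ := x ^ (1 / (t : ℝ)) with hy
  have hy0 : 0 < y := Real.rpow_pos_of_pos hx0 _
  have hlogy : log y = log x / t := by rw [hy, Real.log_rpow hx0]; ring
  have hll : 1 + 1 / ε ≤ log (log x) := (Real.le_log_iff_exp_le (by linarith)).2 hL
  have hly2 : 2 * log (log x) ≤ log y := by
    have := Real.log_le_log (by positivity) hxt
    rwa [Real.log_pow, Nat.cast_ofNat] at this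
  have hε' : 0 < 1 / ε := by positivity
  have hly1 : 1 + 1 / ε ≤ log y := by linarith
  have hlypos : 0 < log y := by linarith
  have hy2 : 2 ≤ y := by
    have := (Real.le_log_iff_exp_le hy0).1 (by linarith : 1 ≤ log y)
    linarith [Real.exp_one_gt_d9]
  have hty : t * log y = log x := by rw [hlogy]; field_simp
  have htL : (t : ℝ) ≤ log x := by nlinarith
  have hlyx : log y ≤ log x := by nlinarith
  have hlogt0 : 0 ≤ log (t : ℝ) := Real.log_nonneg ht1
  have hlogt : log (t : ℝ) ≤ log (log x) := Real.log_le_log ht0 htL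
  set η : ℝ := log t / (2 * log y) with hη
  have hη0 : 0 ≤ η := by positivity
  have hη1 : η ≤ 1 / 4 := by
    rw [hη, div_le_iff₀ (by positivity)]
    linarith
  have hηly : η * log y = log t / 2 := by rw [hη]; field_simp
  have hyη : y ^ η = √t := by
    rw [Real.rpow_def_of_pos hy0, mul_comm, hηly, Real.sqrt_eq_rpow, Real.rpow_def_of_pos ht0]
    ring_nf
  have hκε : 1 / log y < ε := by
    rw [one_div_lt hlypos hε]
    linarith
  have hκ : ∑' n : ℕ, 1 / (n : ℝ) ^ (1 + 1 / log y) ≤ 2 * log x := by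
    have := hzeta (1 / log y) (by positivity) hκε
    rw [one_div_mul_eq_div, div_le_iff₀ hlypos] at this
    linarith
  refine (sum_three_pow_card_primeFactors_div_le (Real.rpow_pos_of_pos hx0 δ) hy2 hη0 hη1
    (by positivity : 0 < 1 / log y) fun d hd => ((@Finset.mem_filter _ _ (_) _ _).1 hd).2).trans ?_
  have hexp : 8 * (1 / log y + η) * y ^ η * log y = 8 * (1 + log t / 2) * √t := by
    rw [hyη, ← hηly]
    field_simp
  have hX : (x ^ δ) ^ (-η) = exp (-(δ / 2 * t * log t)) := by
    rw [← Real.rpow_mul hx0.le, Real.rpow_def_of_pos hx0, ← hty]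
    congr 1
    linear_combination -(t * δ) * hηly
  rw [hexp, hX]
  calc exp (-(δ / 2 * t * log t)) *
        ((∑' n : ℕ, 1 / (n : ℝ) ^ (1 + 1 / log y)) * exp (8 * (1 + log t / 2) * √t)) ^ 3
      ≤ exp (-(δ / 2 * t * log t)) * (2 * log x * exp (8 * (1 + log t / 2) * √t)) ^ 3 := by
        gcongr
    _ = 8 * log x ^ 3 * exp (-(δ / 2 * t * log t) + 24 * (1 + log t / 2) * √t) := by
        rw [mul_pow, ← Real.exp_nat_mul, Real.exp_add]
        push_cast
        ring_nf
    _ ≤ 8 * log x ^ 3 * exp (B + -(δ / 4) * t * log t) := by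
        refine mul_le_mul_of_nonneg_left (Real.exp_le_exp.2 ?_) (by positivity)
        linarith [hB t ht1]
    _ = _ := by
        rw [Real.exp_add]
        ring
end

section
/- Let h be a positive integer and x a real number with h ≤ x/2. Then ∑_{u ≤ x+h} ∑_{v ≤ x} ∑_{x−h < w ≤ x} #{n : 1 ≤ n ≤ x, u | n + h, v | n, w | n − h} ≤ h · d(h) · d(2h), where u, v, w range over positive integers in the indicated ranges. -/
/-- `numDiv n` is the number of positive divisors of `n`. -/
def numDiv (n : ℕ) : ℕ := n.divisors.card

/-- If `2 * h ≤ x`, `0 < n ≤ x` and `x - h < w`, then `w ∣ n - h` forces `n = h`. -/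
theorem eq_of_dvd_sub_of_sub_lt {h n w : ℕ} {x : ℝ} (hx : (h : ℝ) ≤ x / 2) (hn : 0 < n)
    (hnx : (n : ℝ) ≤ x) (hw : x - h < w) (hdvd : (w : ℤ) ∣ (n : ℤ) - h) : n = h := by
  have hnw : n < w + h := by
    have : (n : ℝ) < w + h := by linarith
    exact_mod_cast this
  have hhw : h < w + n := by
    have : (h : ℝ) < w := by linarith
    have : h < w := by exact_mod_cast this
    omega
  have := Int.eq_zero_of_abs_lt_dvd hdvd (by rw [abs_lt]; omega)
  omega

/-- If `2 * h ≤ x` and `x - h < w`, then a positive integer `n ≤ x` with `u ∣ n + h`, `v ∣ n` and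
`w ∣ n - h` exists only if `u ∣ 2 * h` and `v ∣ h`, and it is then unique. -/
theorem card_le_ite_dvd_mul_ite_dvd {h u v w : ℕ} {x : ℝ} (hx : (h : ℝ) ≤ x / 2) (hw : x - h < w)
    (s : Finset ℕ) (hs : ∀ n ∈ s, 0 < n ∧ (n : ℝ) ≤ x ∧
      (u : ℤ) ∣ (n : ℤ) + h ∧ v ∣ n ∧ (w : ℤ) ∣ (n : ℤ) - h) :
    s.card ≤ (if u ∣ 2 * h then 1 else 0) * (if v ∣ h then 1 else 0) := by
  have eq_h : ∀ n ∈ s, n = h ∧ u ∣ 2 * h ∧ v ∣ h := by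
    intro n hn
    obtain ⟨hn0, hnx, hu, hv, hdvd⟩ := hs n hn
    obtain rfl := eq_of_dvd_sub_of_sub_lt hx hn0 hnx hw hdvd
    exact ⟨rfl, by rw [two_mul]; exact_mod_cast hu, hv⟩
  by_cases huv : u ∣ 2 * h ∧ v ∣ h
  · rw [if_pos huv.1, if_pos huv.2]
    exact Finset.card_le_one.2 fun a ha b hb => (eq_h a ha).1.trans (eq_h b hb).1.symm
  · rw [Finset.card_eq_zero.2 (Finset.eq_empty_of_forall_notMem fun n hn => huv (eq_h n hn).2)]
    exact Nat.zero_le _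

/-- At most `h` positive integers lie in the interval `(x - h, x]`. -/
theorem card_le_of_forall_sub_lt {h : ℕ} {x : ℝ} (hx : 0 ≤ x) (s : Finset ℕ)
    (hs : ∀ w ∈ s, x - h < w ∧ 0 < w ∧ w ≤ ⌊x⌋₊) : s.card ≤ h := by
  have h_sub : s ⊆ Finset.Ioc (⌊x⌋₊ - h) ⌊x⌋₊ := by
    intro w hw
    obtain ⟨hlt, hpos, hle⟩ := hs w hw
    have : ⌊x⌋₊ < w + h := (Nat.floor_lt hx).2 (by push_cast; linarith)
    rw [Finset.mem_Ioc]
    omega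
  calc s.card ≤ (Finset.Ioc (⌊x⌋₊ - h) ⌊x⌋₊).card := Finset.card_le_card h_sub
    _ ≤ h := by rw [Nat.card_Ioc]; omega

/-- The number of divisors of `m` in any finite set is at most `numDiv m`. -/
theorem sum_ite_dvd_le_numDiv {m : ℕ} (hm : m ≠ 0) (s : Finset ℕ) :
    ∑ u ∈ s, (if u ∣ m then 1 else 0) ≤ numDiv m := by
  rw [Finset.sum_boole, Nat.cast_id]
  refine Finset.card_le_card fun u hu => ?_
  exact Nat.mem_divisors.2 ⟨(Finset.mem_filter.1 hu).2, hm⟩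

theorem stmt14 (h : ℕ) (hh : 0 < h) (x : ℝ) (hx : (h : ℝ) ≤ x / 2) :
    letI := Classical.dec
    ∑ u ∈ Finset.Icc 1 ⌊x + h⌋₊, ∑ v ∈ Finset.Icc 1 ⌊x⌋₊,
      ∑ w ∈ (Finset.Icc 1 ⌊x⌋₊).filter (fun w : ℕ => x - h < (w : ℝ)),
        ((Finset.Icc 1 ⌊x⌋₊).filter (fun n : ℕ =>
          (u : ℤ) ∣ (n : ℤ) + h ∧ v ∣ n ∧ (w : ℤ) ∣ (n : ℤ) - h)).card
      ≤ h * numDiv h * numDiv (2 * h) := by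
  have hx0 : 0 ≤ x := by have : (0 : ℝ) ≤ h := h.cast_nonneg; linarith
  calc _ ≤ ∑ u ∈ Finset.Icc 1 ⌊x + h⌋₊, ∑ v ∈ Finset.Icc 1 ⌊x⌋₊,
        h * ((if u ∣ 2 * h then 1 else 0) * (if v ∣ h then 1 else 0)) := by
        refine Finset.sum_le_sum fun u _ => Finset.sum_le_sum fun v _ => ?_
        refine (Finset.sum_le_card_nsmul _ _
          ((if u ∣ 2 * h then 1 else 0) * (if v ∣ h then 1 else 0)) fun w hw => ?_).trans ?_
        · refine card_le_ite_dvd_mul_ite_dvd hx (Finset.mem_filter.1 hw).2 _ fun n hn => ?_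
          obtain ⟨hn, hdvd⟩ := (@Finset.mem_filter _ _ (_) _ _).1 hn
          obtain ⟨hn1, hnx⟩ := Finset.mem_Icc.1 hn
          exact ⟨hn1, (Nat.le_floor_iff hx0).1 hnx, hdvd⟩
        rw [smul_eq_mul]
        refine Nat.mul_le_mul_right _ (card_le_of_forall_sub_lt hx0 _ fun w hw => ?_)
        obtain ⟨hw, hlt⟩ := Finset.mem_filter.1 hw
        exact ⟨hlt, Finset.mem_Icc.1 hw⟩
    _ = h * ((∑ u ∈ Finset.Icc 1 ⌊x + h⌋₊, if u ∣ 2 * h then 1 else 0) *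
        ∑ v ∈ Finset.Icc 1 ⌊x⌋₊, if v ∣ h then 1 else 0) := by
        rw [Finset.sum_mul_sum, Finset.mul_sum]
        simp only [Finset.mul_sum]
    _ ≤ h * (numDiv (2 * h) * numDiv h) := by
        gcongr
        · exact sum_ite_dvd_le_numDiv (by omega) _
        · exact sum_ite_dvd_le_numDiv hh.ne' _
    _ = h * numDiv h * numDiv (2 * h) := by ring
end

section
/- Let h be a positive integer and let g(u, v, w) = 1 if the system of congruences n ≡ −h (mod u), n ≡ 0 (mod v), n ≡ h (mod w) has an integer solution, and g(u, v, w) = 0 otherwise. Then as x → ∞, ∑_{u ≤ x} ∑_{v ≤ x} ∑_{w ≤ x} g(u, v, w)/lcm(u, v, w) = Δ(h) · ∏_p (1 − 1/p)² (1 + 2/p) · (log x)³ + O_h((log x)²), where the product runs over all primes and Δ(h) is the nonzero constant Δ(h) = ∏_{p | 2h} (1 − 1/p)(1 + 2/p)^{-1} · (∑_{ν₁, ν₂, ν₃ ≥ 0} g(p^{ν₁}, p^{ν₂}, p^{ν₃})/lcm(p^{ν₁}, p^{ν₂}, p^{ν₃})), the inner series being convergent for each prime p dividing 2h. -/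
open Real Finset

/-- For a fixed positive integer `h`, `gInd h u v w` equals `1` if the system of congruences
`n ≡ -h (mod u)`, `n ≡ 0 (mod v)`, `n ≡ h (mod w)` has an integer solution,
and `0` otherwise. -/
noncomputable def gInd (h u v w : ℕ) : ℝ :=
  letI := Classical.dec
  if ∃ n : ℤ, n ≡ -(h : ℤ) [ZMOD (u : ℤ)] ∧ n ≡ 0 [ZMOD (v : ℤ)] ∧ n ≡ (h : ℤ) [ZMOD (w : ℤ)]
    then 1 else 0

/-- The local factor `s_p = ∑_{ν₁,ν₂,ν₃ ≥ 0} g(p^{ν₁}, p^{ν₂}, p^{ν₃}) / lcm(p^{ν₁}, p^{ν₂}, p^{ν₃})`. -/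
noncomputable def localFactor (h p : ℕ) : ℝ :=
  ∑' ν : ℕ × ℕ × ℕ,
    gInd h (p ^ ν.1) (p ^ ν.2.1) (p ^ ν.2.2) /
      (Nat.lcm (Nat.lcm (p ^ ν.1) (p ^ ν.2.1)) (p ^ ν.2.2) : ℝ)

/-- The constant `Δ(h) = ∏_{p ∣ 2h} (1 - 1/p)(1 + 2/p)⁻¹ s_p`. -/
noncomputable def Delta (h : ℕ) : ℝ :=
  ∏ p ∈ (2 * h).primeFactors, (1 - 1 / (p : ℝ)) * (1 + 2 / (p : ℝ))⁻¹ * localFactor h p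

lemma gcd_lcm_eq_lcm_gcd {u v w : ℕ} (hu : u ≠ 0) (hv : v ≠ 0) (hw : w ≠ 0) :
    (u.lcm v).gcd w = (u.gcd w).lcm (v.gcd w) := by
  refine Nat.eq_of_factorization_eq (Nat.gcd_ne_zero_right hw)
    (Nat.lcm_ne_zero (Nat.gcd_ne_zero_right hw) (Nat.gcd_ne_zero_right hw)) fun p => ?_
  rw [Nat.factorization_gcd (Nat.lcm_ne_zero hu hv) hw, Nat.factorization_lcm hu hv,
    Nat.factorization_lcm (Nat.gcd_ne_zero_right hw) (Nat.gcd_ne_zero_right hw),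
    Nat.factorization_gcd hu hw, Nat.factorization_gcd hv hw]
  simp only [Finsupp.inf_apply, Finsupp.sup_apply]
  exact inf_sup_right _ _ _

lemma lcm_lcm_mul_gcds {u v w : ℕ} (hu : u ≠ 0) (hv : v ≠ 0) (hw : w ≠ 0) :
    (u.lcm v).lcm w * (u.gcd v * v.gcd w * u.gcd w) =
      u * v * w * (u.gcd w).gcd (v.gcd w) := by
  have h1 := Nat.gcd_mul_lcm (u.lcm v) w
  have h2 := Nat.gcd_mul_lcm u v
  have h3 := Nat.gcd_mul_lcm (u.gcd w) (v.gcd w)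
  rw [gcd_lcm_eq_lcm_gcd hu hv hw] at h1
  have h4 : (u.gcd w).lcm (v.gcd w) ≠ 0 :=
    Nat.lcm_ne_zero (Nat.gcd_ne_zero_right hw) (Nat.gcd_ne_zero_right hw)
  refine Nat.eq_of_mul_eq_mul_left (Nat.pos_of_ne_zero h4) ?_
  calc _ = ((u.gcd w).lcm (v.gcd w) * (u.lcm v).lcm w) * (u.gcd v * (u.gcd w * v.gcd w)) := by ring
    _ = (u.gcd v * u.lcm v) * w * ((u.gcd w).gcd (v.gcd w) * (u.gcd w).lcm (v.gcd w)) := by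
      rw [h1, h3]; ring
    _ = _ := by rw [h2]; ring

lemma exists_modEq_iff_gcd_dvd (a b : ℤ) (u v : ℕ) :
    (∃ n : ℤ, n ≡ a [ZMOD u] ∧ n ≡ b [ZMOD v]) ↔ ((u.gcd v : ℕ) : ℤ) ∣ b - a := by
  constructor
  · rintro ⟨n, h1, h2⟩
    have h3 : ((u.gcd v : ℕ) : ℤ) ∣ a - n :=
      (Int.natCast_dvd_natCast.2 (Nat.gcd_dvd_left u v)).trans h1.dvd
    have h4 : ((u.gcd v : ℕ) : ℤ) ∣ b - n :=
      (Int.natCast_dvd_natCast.2 (Nat.gcd_dvd_right u v)).trans h2.dvd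
    simpa using dvd_sub h4 h3
  · rintro ⟨k, hk⟩
    have hb := Nat.gcd_eq_gcd_ab u v
    refine ⟨a + u * (u.gcdA v * k), ?_, ?_⟩
    · exact (Int.modEq_iff_dvd.2 ⟨-(u.gcdA v * k), by ring⟩)
    · refine Int.modEq_iff_dvd.2 ⟨u.gcdB v * k, ?_⟩
      rw [hb] at hk
      linear_combination hk

lemma exists_system_iff (h : ℕ) {u v w : ℕ} (hu : u ≠ 0) (hv : v ≠ 0) (hw : w ≠ 0) :
    (∃ n : ℤ, n ≡ -(h : ℤ) [ZMOD (u : ℤ)] ∧ n ≡ 0 [ZMOD (v : ℤ)] ∧ n ≡ (h : ℤ) [ZMOD (w : ℤ)]) ↔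
      u.gcd v ∣ h ∧ v.gcd w ∣ h ∧ u.gcd w ∣ 2 * h := by
  constructor
  · rintro ⟨n, h1, h2, h3⟩
    refine ⟨?_, ?_, ?_⟩
    · have := (exists_modEq_iff_gcd_dvd _ _ u v).1 ⟨n, h1, h2⟩
      rw [← Int.natCast_dvd_natCast]; simpa using this
    · have := (exists_modEq_iff_gcd_dvd _ _ v w).1 ⟨n, h2, h3⟩
      rw [← Int.natCast_dvd_natCast]; simpa using this
    · have := (exists_modEq_iff_gcd_dvd _ _ u w).1 ⟨n, h1, h3⟩
      rw [← Int.natCast_dvd_natCast]; push_cast; rw [two_mul]; simpa using this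
  · rintro ⟨h1, h2, h3⟩
    rw [← Int.natCast_dvd_natCast] at h1 h2 h3
    obtain ⟨m, hm1, hm2⟩ := (exists_modEq_iff_gcd_dvd (-(h : ℤ)) 0 u v).2 (by simpa using h1)
    have key : (((u.lcm v).gcd w : ℕ) : ℤ) ∣ (h : ℤ) - m := by
      rw [gcd_lcm_eq_lcm_gcd hu hv hw]
      rw [Int.natCast_dvd]
      refine Nat.lcm_dvd ?_ ?_ <;> rw [← Int.natCast_dvd]
      · have : ((u.gcd w : ℕ) : ℤ) ∣ -h - m :=
          (Int.natCast_dvd_natCast.2 (Nat.gcd_dvd_left u w)).trans hm1.dvd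
        have h5 := dvd_add this h3
        have e : (h : ℤ) - m = -h - m + ((2 * h : ℕ) : ℤ) := by push_cast; ring
        rwa [e]
      · have : ((v.gcd w : ℕ) : ℤ) ∣ 0 - m :=
          (Int.natCast_dvd_natCast.2 (Nat.gcd_dvd_left v w)).trans hm2.dvd
        have h5 := dvd_add this h2
        have e : (h : ℤ) - m = 0 - m + h := by ring
        rwa [e]
    obtain ⟨n, hn1, hn2⟩ := (exists_modEq_iff_gcd_dvd m h (u.lcm v) w).2 key
    refine ⟨n, (hn1.of_dvd ?_).trans hm1, (hn1.of_dvd ?_).trans hm2, hn2⟩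
    · exact Int.natCast_dvd_natCast.2 (Nat.dvd_lcm_left u v)
    · exact Int.natCast_dvd_natCast.2 (Nat.dvd_lcm_right u v)

/-- The summand `g(u, v, w) / lcm(u, v, w)`. -/
noncomputable def lcmWeight (h : ℕ) (t : ℕ × ℕ × ℕ) : ℝ :=
  gInd h t.1 t.2.1 t.2.2 / (Nat.lcm (Nat.lcm t.1 t.2.1) t.2.2 : ℝ)

/-- The value of `u v w g(u, v, w) / lcm(u, v, w)` as a function of the pairwise gcds
`A = (u, v)`, `B = (v, w)`, `C = (u, w)`. -/
noncomputable def gcdKernel (h A B C : ℕ) : ℝ :=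
  if A ∣ h ∧ B ∣ h ∧ C ∣ 2 * h then (A * B * C : ℝ) / (C.gcd B : ℝ) else 0

lemma gInd_eq (h : ℕ) {u v w : ℕ} (hu : u ≠ 0) (hv : v ≠ 0) (hw : w ≠ 0) :
    gInd h u v w = if u.gcd v ∣ h ∧ v.gcd w ∣ h ∧ u.gcd w ∣ 2 * h then 1 else 0 := by
  unfold gInd
  simp only [exists_system_iff h hu hv hw]

lemma lcmWeight_eq (h : ℕ) {u v w : ℕ} (hu : u ≠ 0) (hv : v ≠ 0) (hw : w ≠ 0) :
    lcmWeight h (u, v, w) =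
      gcdKernel h (u.gcd v) (v.gcd w) (u.gcd w) * ((u : ℝ)⁻¹ * (v : ℝ)⁻¹ * (w : ℝ)⁻¹) := by
  unfold lcmWeight gcdKernel
  simp only [gInd_eq h hu hv hw]
  split_ifs
  · have h1 := lcm_lcm_mul_gcds hu hv hw
    have h2 : (u.lcm v).lcm w ≠ 0 := Nat.lcm_ne_zero (Nat.lcm_ne_zero hu hv) hw
    have h3 : (u.gcd w).gcd (v.gcd w) ≠ 0 := Nat.gcd_ne_zero_left (Nat.gcd_ne_zero_right hw)
    have h1' : (((u.lcm v).lcm w : ℕ) : ℝ) * ((u.gcd v : ℝ) * (v.gcd w : ℝ) * (u.gcd w : ℝ)) =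
      u * v * w * ((u.gcd w).gcd (v.gcd w) : ℕ) := by exact_mod_cast h1
    field_simp
    linear_combination -h1'
  · simp

lemma gcdKernel_nonneg (h A B C : ℕ) : 0 ≤ gcdKernel h A B C := by
  unfold gcdKernel; split_ifs <;> positivity

lemma gcdKernel_le {h : ℕ} (hh : 0 < h) (A B C : ℕ) : gcdKernel h A B C ≤ (2 * h : ℝ) ^ 3 := by
  unfold gcdKernel
  split_ifs with H
  · obtain ⟨hA, hB, hC⟩ := H
    have hA' : (A : ℝ) ≤ 2 * h := by
      have := Nat.le_of_dvd hh hA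
      exact_mod_cast (by omega : A ≤ 2 * h)
    have hB' : (B : ℝ) ≤ 2 * h := by
      have := Nat.le_of_dvd hh hB
      exact_mod_cast (by omega : B ≤ 2 * h)
    have hC' : (C : ℝ) ≤ 2 * h := by
      exact_mod_cast Nat.le_of_dvd (by omega) hC
    have hg : (1 : ℝ) ≤ (C.gcd B : ℝ) := by
      have : B ≠ 0 := by rintro rfl; simp at hB; omega
      exact_mod_cast Nat.pos_of_ne_zero (Nat.gcd_ne_zero_right this)
    refine (div_le_self (by positivity) hg).trans ?_
    calc (A * B * C : ℝ) ≤ (2 * h) * (2 * h) * (2 * h) := by gcongr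
      _ = _ := by ring
  · positivity

lemma lcmWeight_nonneg (h : ℕ) (t : ℕ × ℕ × ℕ) : 0 ≤ lcmWeight h t := by
  unfold lcmWeight gInd
  have : (0 : ℝ) ≤ ((t.1.lcm t.2.1).lcm t.2.2 : ℕ) := Nat.cast_nonneg _
  refine div_nonneg ?_ this
  split_ifs <;> norm_num

lemma gcd_mul_mul_of_coprime {a b c d : ℕ} (had : a.Coprime d) (hbc : b.Coprime c)
    (hcd : c.Coprime d) : (a * b).gcd (c * d) = a.gcd c * b.gcd d := by
  rw [Nat.Coprime.gcd_mul _ hcd, Nat.Coprime.gcd_mul_right_cancel _ hbc,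
    Nat.Coprime.gcd_mul_left_cancel _ had]

lemma coprime_mul_dvd_iff {a b n : ℕ} (hab : a.Coprime b) : a * b ∣ n ↔ a ∣ n ∧ b ∣ n :=
  ⟨fun H => ⟨(dvd_mul_right a b).trans H, (dvd_mul_left b a).trans H⟩,
    fun H => hab.mul_dvd_of_dvd_of_dvd H.1 H.2⟩

lemma gcdKernel_mul (h : ℕ) {A B C A' B' C' : ℕ} (hA : A.Coprime A') (hB : B.Coprime B')
    (hC : C.Coprime C') (hCB : C.Coprime B') (hBC : C'.Coprime B) :
    gcdKernel h (A * A') (B * B') (C * C') = gcdKernel h A B C * gcdKernel h A' B' C' := by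
  unfold gcdKernel
  simp only [coprime_mul_dvd_iff hA, coprime_mul_dvd_iff hB, coprime_mul_dvd_iff hC,
    gcd_mul_mul_of_coprime hCB hBC hB]
  push_cast
  split_ifs <;> first | tauto | simp | skip
  ring

lemma lcmWeight_mul (h : ℕ) {u v w u' v' w' : ℕ} (hu : u ≠ 0) (hv : v ≠ 0) (hw : w ≠ 0)
    (hu' : u' ≠ 0) (hv' : v' ≠ 0) (hw' : w' ≠ 0)
    (hc : (u * v * w).Coprime (u' * v' * w')) :
    lcmWeight h (u * u', v * v', w * w') = lcmWeight h (u, v, w) * lcmWeight h (u', v', w') := by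
  rw [lcmWeight_eq h hu hv hw, lcmWeight_eq h hu' hv' hw', lcmWeight_eq h (by positivity)
    (by positivity) (by positivity)]
  simp only [Nat.coprime_mul_iff_left, Nat.coprime_mul_iff_right] at hc
  obtain ⟨⟨⟨⟨h1, h2⟩, h3⟩, ⟨h4, h5⟩, h6⟩, ⟨h7, h8⟩, h9⟩ := hc
  rw [gcd_mul_mul_of_coprime h4 h2.symm h5, gcd_mul_mul_of_coprime h8 h6.symm h9,
    gcd_mul_mul_of_coprime h7 h3.symm h9, gcdKernel_mul]
  · push_cast
    rw [mul_inv, mul_inv, mul_inv]; ring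
  · exact (h1.of_dvd (Nat.gcd_dvd_left _ _) (Nat.gcd_dvd_left _ _))
  · exact (h5.of_dvd (Nat.gcd_dvd_left _ _) (Nat.gcd_dvd_left _ _))
  · exact (h1.of_dvd (Nat.gcd_dvd_left _ _) (Nat.gcd_dvd_left _ _))
  · exact (h4.of_dvd (Nat.gcd_dvd_left _ _) (Nat.gcd_dvd_left _ _))
  · exact (h2.of_dvd (Nat.gcd_dvd_left _ _) (Nat.gcd_dvd_left _ _)).symm

/-- `μ(a / d)` if `d ∣ a`, and `0` otherwise. -/
noncomputable def shiftedMoebius (d a : ℕ) : ℝ :=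
  if d ∣ a then (ArithmeticFunction.moebius (a / d) : ℝ) else 0

lemma shiftedMoebius_zero (d : ℕ) : shiftedMoebius d 0 = 0 := by simp [shiftedMoebius]

lemma abs_shiftedMoebius_le (d a : ℕ) : |shiftedMoebius d a| ≤ 1 := by
  unfold shiftedMoebius
  split_ifs
  · exact_mod_cast ArithmeticFunction.abs_moebius_le_one
  · simp

lemma sum_moebius_divisors {n : ℕ} :
    ∑ i ∈ n.divisors, (ArithmeticFunction.moebius i : ℝ) = if n = 1 then 1 else 0 := by
  have h := congrArg (fun f : ArithmeticFunction ℤ => f n) ArithmeticFunction.moebius_mul_coe_zeta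
  simp only [ArithmeticFunction.coe_mul_zeta_apply, ArithmeticFunction.one_apply] at h
  exact_mod_cast h

lemma sum_shiftedMoebius {d A : ℕ} (hd : d ≠ 0) (hA : A ≠ 0) :
    ∑ a ∈ A.divisors, shiftedMoebius d a = if d = A then 1 else 0 := by
  unfold shiftedMoebius
  rw [← Finset.sum_filter]
  by_cases hdA : d ∣ A
  · obtain ⟨k, rfl⟩ := hdA
    have hk : k ≠ 0 := right_ne_zero_of_mul hA
    have : (d * k).divisors.filter (d ∣ ·) = k.divisors.image (d * ·) := by
      ext a
      simp only [Finset.mem_filter, Nat.mem_divisors, Finset.mem_image]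
      constructor
      · rintro ⟨⟨h1, -⟩, j, rfl⟩
        exact ⟨j, ⟨Nat.dvd_of_mul_dvd_mul_left (Nat.pos_of_ne_zero hd) h1, hk⟩, rfl⟩
      · rintro ⟨j, ⟨h1, -⟩, rfl⟩
        exact ⟨⟨Nat.mul_dvd_mul_left d h1, hA⟩, dvd_mul_right _ _⟩
    rw [this, Finset.sum_image fun x _ y _ hxy => Nat.eq_of_mul_eq_mul_left (Nat.pos_of_ne_zero hd) hxy]
    simp only [Nat.mul_div_cancel_left _ (Nat.pos_of_ne_zero hd), sum_moebius_divisors]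
    congr 1
    simp [hd]
  · rw [if_neg (by rintro rfl; exact hdA dvd_rfl), Finset.sum_eq_zero]
    intro a ha
    simp only [Finset.mem_filter, Nat.mem_divisors] at ha
    exact absurd (ha.2.trans ha.1.1) hdA

/-- The Möbius transform of `gcdKernel` in its three variables. -/
noncomputable def kernelTransform (h a b c : ℕ) : ℝ :=
  ∑ d ∈ (2 * h).divisors, ∑ e ∈ (2 * h).divisors, ∑ f ∈ (2 * h).divisors,
    gcdKernel h d e f * (shiftedMoebius d a * shiftedMoebius e b * shiftedMoebius f c)

lemma gcdKernel_eq_zero {h A B C : ℕ} (hh : 0 < h)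
    (H : A ∉ (2 * h).divisors ∨ B ∉ (2 * h).divisors ∨ C ∉ (2 * h).divisors) :
    gcdKernel h A B C = 0 := by
  unfold gcdKernel
  rw [if_neg]
  rintro ⟨h1, h2, h3⟩
  simp only [Nat.mem_divisors] at H
  have := h1.mul_left 2
  have := h2.mul_left 2
  have : 2 * h ≠ 0 := by omega
  tauto

lemma sum_kernelTransform {h A B C : ℕ} (hh : 0 < h) (hA : A ≠ 0) (hB : B ≠ 0) (hC : C ≠ 0) :
    ∑ a ∈ A.divisors, ∑ b ∈ B.divisors, ∑ c ∈ C.divisors, kernelTransform h a b c =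
      gcdKernel h A B C := by
  have key : ∑ a ∈ A.divisors, ∑ b ∈ B.divisors, ∑ c ∈ C.divisors, kernelTransform h a b c =
      ∑ d ∈ (2 * h).divisors, ∑ e ∈ (2 * h).divisors, ∑ f ∈ (2 * h).divisors,
        gcdKernel h d e f * ((∑ a ∈ A.divisors, shiftedMoebius d a) *
          (∑ b ∈ B.divisors, shiftedMoebius e b) * ∑ c ∈ C.divisors, shiftedMoebius f c) := by
    have expand : ∀ d e f : ℕ, gcdKernel h d e f * ((∑ a ∈ A.divisors, shiftedMoebius d a) *
          (∑ b ∈ B.divisors, shiftedMoebius e b) * ∑ c ∈ C.divisors, shiftedMoebius f c) =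
        ∑ x ∈ A.divisors ×ˢ (B.divisors ×ˢ C.divisors), gcdKernel h d e f *
          (shiftedMoebius d x.1 * shiftedMoebius e x.2.1 * shiftedMoebius f x.2.2) := by
      intro d e f
      simp only [Finset.sum_product, ← Finset.mul_sum, ← Finset.sum_mul]
    simp only [expand]
    calc _ = ∑ x ∈ A.divisors ×ˢ (B.divisors ×ˢ C.divisors),
          ∑ y ∈ (2 * h).divisors ×ˢ ((2 * h).divisors ×ˢ (2 * h).divisors),
          gcdKernel h y.1 y.2.1 y.2.2 *
          (shiftedMoebius y.1 x.1 * shiftedMoebius y.2.1 x.2.1 * shiftedMoebius y.2.2 x.2.2) := by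
          simp only [kernelTransform, Finset.sum_product]
      _ = _ := by
          rw [Finset.sum_comm, Finset.sum_product]
          simp only [Finset.sum_product (2 * h).divisors]
  rw [key]
  have h0 : ∀ d ∈ (2 * h).divisors, d ≠ 0 := fun d hd => (Nat.pos_of_mem_divisors hd).ne'
  have : ∀ d ∈ (2 * h).divisors, ∀ e ∈ (2 * h).divisors, ∀ f ∈ (2 * h).divisors,
      gcdKernel h d e f * ((∑ a ∈ A.divisors, shiftedMoebius d a) *
          (∑ b ∈ B.divisors, shiftedMoebius e b) * ∑ c ∈ C.divisors, shiftedMoebius f c) =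
      if f = C then if e = B then if d = A then gcdKernel h d e f else 0 else 0 else 0 := by
    intro d hd e he f hf
    rw [sum_shiftedMoebius (h0 d hd) hA, sum_shiftedMoebius (h0 e he) hB,
      sum_shiftedMoebius (h0 f hf) hC]
    split_ifs <;> simp
  rw [Finset.sum_congr rfl fun d hd => Finset.sum_congr rfl fun e he =>
    Finset.sum_congr rfl fun f hf => this d hd e he f hf]
  simp only [Finset.sum_ite_eq']
  by_cases h1 : C ∈ (2 * h).divisors
  · by_cases h2 : B ∈ (2 * h).divisors
    · by_cases h3 : A ∈ (2 * h).divisors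
      · simp [h1, h2, h3, Finset.sum_ite_eq']
      · simp [h3, gcdKernel_eq_zero hh (.inl h3)]
    · simp [h2, gcdKernel_eq_zero hh (.inr (.inl h2))]
  · simp [h1, gcdKernel_eq_zero hh (.inr (.inr h1))]

lemma exists_abs_kernelTransform_le {h : ℕ} (hh : 0 < h) :
    ∃ M : ℝ, 0 < M ∧ ∀ a b c, |kernelTransform h a b c| ≤ M := by
  refine ⟨∑ d ∈ (2 * h).divisors, ∑ e ∈ (2 * h).divisors, ∑ f ∈ (2 * h).divisors, (2 * h : ℝ) ^ 3,
    ?_, fun a b c => ?_⟩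
  · have : (2 * h).divisors.Nonempty := ⟨1, by simp; omega⟩
    have : (0 : ℝ) < h := by exact_mod_cast hh
    refine Finset.sum_pos (fun _ _ => Finset.sum_pos (fun _ _ => Finset.sum_pos (fun _ _ => ?_) ?_) ?_) ?_
    · positivity
    all_goals assumption
  · unfold kernelTransform
    refine (Finset.abs_sum_le_sum_abs _ _).trans (Finset.sum_le_sum fun d _ => ?_)
    refine (Finset.abs_sum_le_sum_abs _ _).trans (Finset.sum_le_sum fun e _ => ?_)
    refine (Finset.abs_sum_le_sum_abs _ _).trans (Finset.sum_le_sum fun f _ => ?_)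
    rw [abs_mul, abs_mul, abs_mul, abs_of_nonneg (gcdKernel_nonneg _ _ _ _)]
    have h1 := abs_shiftedMoebius_le d a
    have h2 := abs_shiftedMoebius_le e b
    have h3 := abs_shiftedMoebius_le f c
    have h4 := gcdKernel_le hh d e f
    calc _ ≤ (2 * h : ℝ) ^ 3 * (1 * 1 * 1) := by gcongr
      _ = _ := by ring

/-- The product of the pairwise lcms of the entries of a triple. -/
def lcmProd (t : ℕ × ℕ × ℕ) : ℕ := t.1.lcm t.2.2 * t.1.lcm t.2.1 * t.2.1.lcm t.2.2

lemma summable_lcm_rpow {s : ℝ} (hs : 1 < s) :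
    Summable fun t : ℕ × ℕ => ((t.1.lcm t.2 : ℕ) : ℝ) ^ (-s) := by
  have h1 : Summable fun n : ℕ => (n : ℝ) ^ (-s) := Real.summable_nat_rpow.2 (by linarith)
  have h0 : ∀ n : ℕ, 0 ≤ (n : ℝ) ^ (-s) := fun n => by positivity
  have h2 : Summable fun t : ℕ × ℕ × ℕ => (t.1 : ℝ) ^ (-s) * ((t.2.1 : ℝ) ^ (-s) * (t.2.2 : ℝ) ^ (-s)) :=
    h1.mul_of_nonneg (h1.mul_of_nonneg h1 h0 h0) h0 fun t => mul_nonneg (h0 _) (h0 _)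
  have hinj : Function.Injective fun t : ℕ × ℕ => (t.1.gcd t.2, t.1 / t.1.gcd t.2, t.2 / t.1.gcd t.2) := by
    rintro ⟨a, b⟩ ⟨c, d⟩ H
    simp only [Prod.mk.injEq] at H ⊢
    obtain ⟨h3, h4, h5⟩ := H
    refine ⟨?_, ?_⟩
    · rw [← Nat.mul_div_cancel' (Nat.gcd_dvd_left a b), h4, h3, Nat.mul_div_cancel' (Nat.gcd_dvd_left c d)]
    · rw [← Nat.mul_div_cancel' (Nat.gcd_dvd_right a b), h5, h3, Nat.mul_div_cancel' (Nat.gcd_dvd_right c d)]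
  refine (h2.comp_injective hinj).congr fun t => ?_
  obtain ⟨a, b⟩ := t
  simp only [Function.comp]
  rw [← Real.mul_rpow (by positivity) (by positivity), ← Real.mul_rpow (by positivity) (by positivity)]
  congr 1
  norm_cast
  rw [Nat.lcm, ← mul_assoc, Nat.mul_div_cancel' (Nat.gcd_dvd_left a b),
    Nat.mul_div_assoc _ (Nat.gcd_dvd_right a b)]

lemma pow_three_le_lcmProd_sq (a b c : ℕ) : (a.lcm b * c) ^ 3 ≤ lcmProd (a, b, c) ^ 2 := by
  rcases Nat.eq_zero_or_pos a with rfl | ha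
  · simp
  rcases Nat.eq_zero_or_pos b with rfl | hb
  · simp
  rcases Nat.eq_zero_or_pos c with rfl | hc
  · simp
  have hab := Nat.lcm_pos ha hb
  have hac := Nat.lcm_pos ha hc
  have hbc := Nat.lcm_pos hb hc
  have hN : 0 < (a.lcm c).lcm (b.lcm c) := Nat.lcm_pos hac hbc
  have h1 : c ≤ (a.lcm c).gcd (b.lcm c) := Nat.le_of_dvd (Nat.gcd_pos_of_pos_left _ hac)
    (Nat.dvd_gcd (Nat.dvd_lcm_right _ _) (Nat.dvd_lcm_right _ _))
  have h2 : a.lcm b ≤ (a.lcm c).lcm (b.lcm c) := Nat.le_of_dvd hN (Nat.lcm_dvd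
    ((Nat.dvd_lcm_left _ _).trans (Nat.dvd_lcm_left _ _))
    ((Nat.dvd_lcm_left _ _).trans (Nat.dvd_lcm_right _ _)))
  have h3 : c ≤ (a.lcm c).lcm (b.lcm c) := Nat.le_of_dvd hN
    ((Nat.dvd_lcm_right _ _).trans (Nat.dvd_lcm_left _ _))
  have h4 := Nat.gcd_mul_lcm (a.lcm c) (b.lcm c)
  unfold lcmProd
  simp only
  generalize (a.lcm c).lcm (b.lcm c) = N at *
  generalize (a.lcm c).gcd (b.lcm c) = g at *
  calc (a.lcm b * c) ^ 3 = a.lcm b ^ 2 * (c * c) * (a.lcm b * c) := by ring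
    _ ≤ a.lcm b ^ 2 * (g * g) * (N * N) := by gcongr
    _ = a.lcm b ^ 2 * (g * N) ^ 2 := by ring
    _ = _ := by rw [h4]; ring

lemma summable_log_lcmProd :
    Summable fun t : ℕ × ℕ × ℕ => (3 + Real.log (lcmProd t)) / (lcmProd t : ℝ) := by
  have h1 : Summable fun n : ℕ => (n : ℝ) ^ (-(5 / 4) : ℝ) := Real.summable_nat_rpow.2 (by norm_num)
  have h2 := (summable_lcm_rpow (s := 5 / 4) (by norm_num)).mul_of_nonneg h1
    (fun n => by positivity) (fun n => by positivity)
  have h3 := (((Equiv.prodAssoc ℕ ℕ ℕ).symm.summable_iff).2 h2).mul_left 9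
  refine Summable.of_nonneg_of_le (fun t => ?_) (fun t => ?_) h3
  · have := Real.log_natCast_nonneg (lcmProd t)
    positivity
  · obtain ⟨a, b, c⟩ := t
    have key := pow_three_le_lcmProd_sq a b c
    generalize hP : lcmProd (a, b, c) = P at *
    simp only [Function.comp, Equiv.prodAssoc_symm_apply]
    rw [← Real.mul_rpow (by positivity) (by positivity), ← Nat.cast_mul]
    rcases Nat.eq_zero_or_pos P with rfl | hPpos
    · simp; positivity
    have hQ : 0 < a.lcm b * c := by
      rw [← hP] at hPpos
      unfold lcmProd at hPpos
      refine Nat.pos_of_ne_zero fun h0 => ?_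
      rcases mul_eq_zero.1 h0 with h0 | rfl
      · simp [h0] at hPpos
      · simp at hPpos
    generalize a.lcm b * c = Q at *
    have hP1 : (1 : ℝ) ≤ P := by exact_mod_cast hPpos
    have hP0 : (0 : ℝ) < P := by linarith
    have hQ0 : (0 : ℝ) < Q := by exact_mod_cast hQ
    have hlog : Real.log P ≤ (P : ℝ) ^ (1 / 6 : ℝ) / (1 / 6) :=
      Real.log_le_rpow_div hP0.le (by norm_num)
    have hone : 1 ≤ (P : ℝ) ^ (1 / 6 : ℝ) := Real.one_le_rpow hP1 (by norm_num)
    have e1 : (P : ℝ) ^ (1 / 6 : ℝ) / P = (P : ℝ) ^ (-(5 / 6) : ℝ) := by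
      rw [← Real.rpow_sub_one hP0.ne']; norm_num
    have e2 : (P : ℝ) ^ (-(5 / 6) : ℝ) = ((P : ℝ) ^ 2) ^ (-(5 / 12) : ℝ) := by
      rw [← Real.rpow_natCast, ← Real.rpow_mul hP0.le]; norm_num
    have e3 : (Q : ℝ) ^ (-(5 / 4) : ℝ) = ((Q : ℝ) ^ 3) ^ (-(5 / 12) : ℝ) := by
      rw [← Real.rpow_natCast, ← Real.rpow_mul hQ0.le]; norm_num
    have e4 : ((P : ℝ) ^ 2) ^ (-(5 / 12) : ℝ) ≤ ((Q : ℝ) ^ 3) ^ (-(5 / 12) : ℝ) :=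
      Real.rpow_le_rpow_of_nonpos (by positivity) (by exact_mod_cast key) (by norm_num)
    calc (3 + Real.log P) / P ≤ (9 * (P : ℝ) ^ (1 / 6 : ℝ)) / P := by gcongr; linarith
      _ = 9 * (P : ℝ) ^ (-(5 / 6) : ℝ) := by rw [mul_div_assoc, e1]
      _ ≤ 9 * (Q : ℝ) ^ (-(5 / 4) : ℝ) := by rw [e2, e3]; linarith

lemma summable_inv_lcmProd : Summable fun t : ℕ × ℕ × ℕ => (lcmProd t : ℝ)⁻¹ := by
  refine Summable.of_nonneg_of_le (fun t => by positivity) (fun t => ?_) summable_log_lcmProd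
  have := Real.log_natCast_nonneg (lcmProd t)
  rw [div_eq_mul_inv]
  exact le_mul_of_one_le_left (by positivity) (by linarith)

lemma hasSum_mul_mul {α β γ : Type*} {f : α → ℝ} {g : β → ℝ} {k : γ → ℝ} {A B C : ℝ}
    (hf : HasSum f A) (hg : HasSum g B) (hk : HasSum k C)
    (hf0 : 0 ≤ f) (hg0 : 0 ≤ g) (hk0 : 0 ≤ k) :
    HasSum (fun t : α × β × γ => f t.1 * g t.2.1 * k t.2.2) (A * B * C) := by
  have h1 := hg.mul hk (hg.summable.mul_of_nonneg hk.summable hg0 hk0)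
  have h2 := hf.mul h1 (hf.summable.mul_of_nonneg h1.summable hf0
    fun t => mul_nonneg (hg0 _) (hk0 _))
  simpa only [mul_assoc] using h2

lemma kernelTransform_eq_zero (h : ℕ) {a b c : ℕ} (H : a = 0 ∨ b = 0 ∨ c = 0) :
    kernelTransform h a b c = 0 := by
  unfold kernelTransform
  rcases H with rfl | rfl | rfl <;> simp [shiftedMoebius_zero]

/-- The total weight of the multiples of `d`. -/
noncomputable def multipleSum (ω : ℕ → ℝ) (d : ℕ) : ℝ := ∑' u, if d ∣ u then ω u else 0

/-- `lcmWeight` with the factors `1 / u`, `1 / v`, `1 / w` replaced by a general weight `ω`. -/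
theorem tsum_gcdKernel_mul_eq {h : ℕ} (hh : 0 < h) {ω : ℕ → ℝ} (hω : ∀ n, 0 ≤ ω n)
    (hω0 : ω 0 = 0) (hsum : Summable ω) {K : ℝ} (hK : ∀ d, d ≠ 0 → multipleSum ω d ≤ K / d) :
    ∑' t : ℕ × ℕ × ℕ, gcdKernel h (t.1.gcd t.2.1) (t.2.1.gcd t.2.2) (t.1.gcd t.2.2) *
        (ω t.1 * ω t.2.1 * ω t.2.2) =
      ∑' s : ℕ × ℕ × ℕ, kernelTransform h s.1 s.2.1 s.2.2 *
        (multipleSum ω (s.1.lcm s.2.2) * multipleSum ω (s.1.lcm s.2.1) *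
          multipleSum ω (s.2.1.lcm s.2.2)) := by
  obtain ⟨M, hM0, hM⟩ := exists_abs_kernelTransform_le hh
  set ωd : ℕ → ℕ → ℝ := fun d u => if d ∣ u then ω u else 0 with hωd
  have hωd0 : ∀ d, 0 ≤ ωd d := fun d u => by
    simp only [hωd, Pi.zero_apply]; split_ifs; exacts [hω u, le_rfl]
  have hωds : ∀ d, HasSum (ωd d) (multipleSum ω d) := fun d => by
    refine (Summable.of_nonneg_of_le (hωd0 d) (fun u => ?_) hsum).hasSum
    simp only [hωd]; split_ifs; exacts [le_rfl, hω u]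
  have hW0 : ∀ d, 0 ≤ multipleSum ω d := fun d => (hωds d).nonneg (hωd0 d)
  set F : (ℕ × ℕ × ℕ) → (ℕ × ℕ × ℕ) → ℝ := fun s t => kernelTransform h s.1 s.2.1 s.2.2 *
    (ωd (s.1.lcm s.2.2) t.1 * ωd (s.1.lcm s.2.1) t.2.1 * ωd (s.2.1.lcm s.2.2) t.2.2) with hF
  have hinner : ∀ s : ℕ × ℕ × ℕ, HasSum (fun t : ℕ × ℕ × ℕ => ωd (s.1.lcm s.2.2) t.1 *
      ωd (s.1.lcm s.2.1) t.2.1 * ωd (s.2.1.lcm s.2.2) t.2.2)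
      (multipleSum ω (s.1.lcm s.2.2) * multipleSum ω (s.1.lcm s.2.1) *
          multipleSum ω (s.2.1.lcm s.2.2)) := fun s =>
    hasSum_mul_mul (hωds _) (hωds _) (hωds _) (hωd0 _) (hωd0 _) (hωd0 _)
  have habs : ∀ s t, |F s t| = |kernelTransform h s.1 s.2.1 s.2.2| * (ωd (s.1.lcm s.2.2) t.1 *
      ωd (s.1.lcm s.2.1) t.2.1 * ωd (s.2.1.lcm s.2.2) t.2.2) := fun s t => by
    rw [hF, abs_mul]
    refine congrArg _ (abs_of_nonneg ?_)
    exact mul_nonneg (mul_nonneg (hωd0 _ _) (hωd0 _ _)) (hωd0 _ _)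
  have hFs : Summable (Function.uncurry F) := by
    refine Summable.of_abs ?_
    rw [summable_prod_of_nonneg fun _ => abs_nonneg _]
    refine ⟨fun s => ?_, ?_⟩
    · simp only [Function.uncurry, habs]
      exact (hinner s).summable.mul_left _
    · refine Summable.of_nonneg_of_le (fun s => tsum_nonneg fun t => abs_nonneg _) (fun s => ?_)
        (summable_inv_lcmProd.mul_left (M * K ^ 3))
      simp only [Function.uncurry, habs]
      rw [tsum_mul_left, (hinner s).tsum_eq]
      obtain ⟨a, b, c⟩ := s
      simp only
      by_cases H : a = 0 ∨ b = 0 ∨ c = 0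
      · rw [kernelTransform_eq_zero h H]
        have : lcmProd (a, b, c) = 0 := by
          unfold lcmProd; rcases H with rfl | rfl | rfl <;> simp
        simp [this]
      · push Not at H
        have h1 := hK _ (Nat.lcm_ne_zero H.1 H.2.2)
        have h2 := hK _ (Nat.lcm_ne_zero H.1 H.2.1)
        have h3 := hK _ (Nat.lcm_ne_zero H.2.1 H.2.2)
        have h4 := (hW0 _).trans h1
        have h5 := (hW0 _).trans h2
        calc _ ≤ M * (K / (a.lcm c : ℕ) * (K / (a.lcm b : ℕ)) * (K / (b.lcm c : ℕ))) := by
              gcongr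
              · exact mul_nonneg (mul_nonneg (hW0 _) (hW0 _)) (hW0 _)
              · exact hM _ _ _
              · exact hW0 _
              · exact hW0 _
          _ = _ := by
            simp only [lcmProd]; push_cast; rw [mul_inv, mul_inv]; ring
  calc _ = ∑' t, ∑' s, F s t := by
        refine tsum_congr fun t => ?_
        obtain ⟨u, v, w⟩ := t
        simp only
        by_cases H : u = 0 ∨ v = 0 ∨ w = 0
        · have : ∀ s, F s (u, v, w) = 0 := fun s => by
            rcases H with rfl | rfl | rfl <;> simp [hF, hωd, hω0]
          simp only [this, tsum_zero]
          rcases H with rfl | rfl | rfl <;> simp [hω0]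
        push Not at H
        obtain ⟨hu, hv, hw⟩ := H
        have hA : u.gcd v ≠ 0 := Nat.gcd_ne_zero_left hu
        have hB : v.gcd w ≠ 0 := Nat.gcd_ne_zero_left hv
        have hC : u.gcd w ≠ 0 := Nat.gcd_ne_zero_left hu
        rw [tsum_eq_sum (s := (u.gcd v).divisors ×ˢ ((v.gcd w).divisors ×ˢ (u.gcd w).divisors))]
        · rw [← sum_kernelTransform hh hA hB hC]
          simp only [Finset.sum_product, Finset.sum_mul]
          refine Finset.sum_congr rfl fun a ha => Finset.sum_congr rfl fun b hb =>
            Finset.sum_congr rfl fun c hc => ?_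
          simp only [Nat.mem_divisors, Nat.dvd_gcd_iff] at ha hb hc
          simp only [hF, hωd]
          rw [if_pos (Nat.lcm_dvd ha.1.1 hc.1.1), if_pos (Nat.lcm_dvd ha.1.2 hb.1.1),
            if_pos (Nat.lcm_dvd hb.1.2 hc.1.2)]
        · rintro ⟨a, b, c⟩ hs
          simp only [hF, hωd]
          simp only [Finset.mem_product, Nat.mem_divisors, Nat.dvd_gcd_iff, ne_eq, hA, hB, hC,
            not_false_eq_true, and_true] at hs
          by_cases h1 : a.lcm c ∣ u
          · by_cases h2 : a.lcm b ∣ v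
            · by_cases h3 : b.lcm c ∣ w
              · rw [Nat.lcm_dvd_iff] at h1 h2 h3; tauto
              · simp [h3]
            · simp [h2]
          · simp [h1]
    _ = ∑' s, ∑' t, F s t := hFs.tsum_comm
    _ = _ := by
        refine tsum_congr fun s => ?_
        simp only [hF]
        rw [tsum_mul_left, (hinner s).tsum_eq]

lemma lcmWeight_one (h : ℕ) : lcmWeight h (1, 1, 1) = 1 := by
  rw [lcmWeight_eq h one_ne_zero one_ne_zero one_ne_zero]
  simp [gcdKernel]

lemma hasSum_of_forall_eq {ι : Type*} {f g : ι → ℝ} {a : ℝ} (hg : HasSum g a)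
    (H : ∀ x, f x = g x) : HasSum f a := by
  rw [funext H]
  exact hg

lemma summable_lcmWeight_prime_pow {h p : ℕ} (hh : 0 < h) (hp : p.Prime) :
    Summable fun ν : ℕ × ℕ × ℕ => lcmWeight h (p ^ ν.1, p ^ ν.2.1, p ^ ν.2.2) := by
  have hp1 : (1 : ℝ) < p := by exact_mod_cast hp.one_lt
  have h1 := hasSum_geometric_of_lt_one (r := (p : ℝ)⁻¹) (by positivity) (inv_lt_one_of_one_lt₀ hp1)
  have h0 : (0 : ℕ → ℝ) ≤ fun n => (p : ℝ)⁻¹ ^ n := fun n => by simp only [Pi.zero_apply]; positivity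
  refine Summable.of_nonneg_of_le (fun ν => lcmWeight_nonneg _ _) (fun ν => ?_)
    ((hasSum_mul_mul h1 h1 h1 h0 h0 h0).summable.mul_left ((2 * h : ℝ) ^ 3))
  have hpow : ∀ n, p ^ n ≠ 0 := fun n => pow_ne_zero _ hp.ne_zero
  rw [lcmWeight_eq h (hpow _) (hpow _) (hpow _)]
  push_cast
  rw [← inv_pow, ← inv_pow, ← inv_pow]
  gcongr
  exact gcdKernel_le hh _ _ _

lemma hasSum_lcmWeight_factoredNumbers {h : ℕ} (hh : 0 < h) {s : Finset ℕ}
    (hs : ∀ p ∈ s, p.Prime) :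
    HasSum (fun t : Nat.factoredNumbers s × Nat.factoredNumbers s × Nat.factoredNumbers s =>
      lcmWeight h (t.1, t.2.1, t.2.2)) (∏ p ∈ s, localFactor h p) := by
  induction s using Finset.induction with
  | empty =>
    rw [Finset.prod_empty]
    have hu : Unique (Nat.factoredNumbers ∅) := by
      rw [Nat.factoredNumbers_empty]; exact Set.uniqueSingleton 1
    have h1 : ∀ x : Nat.factoredNumbers ∅, (x : ℕ) = 1 := fun x => by
      simpa [Nat.factoredNumbers_empty] using x.2
    simp only [h1, lcmWeight_one]
    have : Unique (Nat.factoredNumbers ∅ × Nat.factoredNumbers ∅ × Nat.factoredNumbers ∅) :=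
      { default := (hu.default, hu.default, hu.default)
        uniq := fun x => Subsingleton.elim _ _ }
    exact hasSum_unique _
  | insert p s hps ih =>
    have hp : p.Prime := hs p (Finset.mem_insert_self _ _)
    have ih := ih fun q hq => hs q (Finset.mem_insert_of_mem hq)
    rw [Finset.prod_insert hps]
    have hl : HasSum (fun ν : ℕ × ℕ × ℕ => lcmWeight h (p ^ ν.1, p ^ ν.2.1, p ^ ν.2.2))
        (localFactor h p) := by
      convert (summable_lcmWeight_prime_pow hh hp).hasSum using 1
      simp [localFactor, lcmWeight]
    have hprod := hl.mul ih (hl.summable.mul_of_nonneg ih.summable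
      (fun _ => lcmWeight_nonneg _ _) (fun _ => lcmWeight_nonneg _ _))
    let E := Nat.equivProdNatFactoredNumbers hp hps
    let shuffle : (ℕ × ℕ × ℕ) × (Nat.factoredNumbers s × Nat.factoredNumbers s × Nat.factoredNumbers s)
        ≃ (ℕ × Nat.factoredNumbers s) × (ℕ × Nat.factoredNumbers s) × (ℕ × Nat.factoredNumbers s) :=
      { toFun := fun x => ((x.1.1, x.2.1), (x.1.2.1, x.2.2.1), (x.1.2.2, x.2.2.2))
        invFun := fun y => ((y.1.1, y.2.1.1, y.2.2.1), (y.1.2, y.2.1.2, y.2.2.2))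
        left_inv := fun _ => rfl
        right_inv := fun _ => rfl }
    rw [← (shuffle.trans (E.prodCongr (E.prodCongr E))).hasSum_iff]
    refine hasSum_of_forall_eq hprod fun x => ?_
    obtain ⟨⟨e, f, g⟩, u, v, w⟩ := x
    simp only [Function.comp, Equiv.trans_apply, Equiv.prodCongr_apply, Prod.map, shuffle, E,
      Equiv.coe_fn_mk]
    have hpow : ∀ n, p ^ n ≠ 0 := fun n => pow_ne_zero _ hp.ne_zero
    have hc : ∀ n : Nat.factoredNumbers s, p.Coprime n := fun n => hp.factoredNumbers_coprime hps n.2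
    refine lcmWeight_mul h (hpow _) (hpow _) (hpow _) u.2.1 v.2.1 w.2.1 ?_
    rw [← pow_add, ← pow_add]
    exact ((((hc u).mul_right (hc v)).mul_right (hc w))).pow_left _

open Classical in
/-- The weight `1 / u` on the `s`-factored numbers `u`. -/
noncomputable def factoredWeight (s : Finset ℕ) (u : ℕ) : ℝ :=
  if u ∈ Nat.factoredNumbers s then (u : ℝ)⁻¹ else 0

lemma hasSum_factoredWeight {s : Finset ℕ} (hs : ∀ p ∈ s, p.Prime) :
    HasSum (factoredWeight s) (∏ p ∈ s, (1 - (p : ℝ)⁻¹)⁻¹) := by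
  let f : ℕ →* ℝ :=
    { toFun := fun n => (n : ℝ)⁻¹
      map_one' := by simp
      map_mul' := fun m n => by push_cast; rw [mul_inv] }
  have h1 := (EulerProduct.summable_and_hasSum_factoredNumbers_prod_filter_prime_geometric (f := f)
    (fun {p} hp => by
      have hp1 : (1 : ℝ) < p := by exact_mod_cast hp.one_lt
      change ‖(p : ℝ)⁻¹‖ < 1
      rw [Real.norm_of_nonneg (by positivity)]
      exact inv_lt_one_of_one_lt₀ hp1) s).2
  rw [Finset.filter_true_of_mem hs] at h1
  rw [← Subtype.val_injective.hasSum_iff (g := (Subtype.val : Nat.factoredNumbers s → ℕ))]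
  · refine hasSum_of_forall_eq h1 fun x => ?_
    simp only [Function.comp, factoredWeight, if_pos x.2]
    rfl
  · intro x hx
    unfold factoredWeight
    rw [if_neg]
    simpa using hx

lemma multipleSum_factoredWeight {s : Finset ℕ} (hs : ∀ p ∈ s, p.Prime) {d : ℕ} (hd : d ≠ 0) :
    multipleSum (factoredWeight s) d = (∏ p ∈ s, (1 - (p : ℝ)⁻¹)⁻¹) * factoredWeight s d := by
  unfold multipleSum
  have hinj : Function.Injective (d * ·) := fun x y hxy =>
    Nat.eq_of_mul_eq_mul_left (Nat.pos_of_ne_zero hd) hxy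
  rw [← hinj.tsum_eq]
  · simp only [dvd_mul_right, if_true]
    rw [← (hasSum_factoredWeight hs).tsum_eq, ← tsum_mul_right]
    refine tsum_congr fun k => ?_
    unfold factoredWeight
    by_cases h1 : d ∈ Nat.factoredNumbers s
    · by_cases h2 : k ∈ Nat.factoredNumbers s
      · rw [if_pos (Nat.mul_mem_factoredNumbers h1 h2), if_pos h1, if_pos h2]
        push_cast; rw [mul_inv, mul_comm]
      · rw [if_neg fun h3 => h2 (Nat.mem_factoredNumbers_of_dvd h3 (dvd_mul_left _ _)), if_neg h2, zero_mul]
    · rw [if_neg fun h3 => h1 (Nat.mem_factoredNumbers_of_dvd h3 (dvd_mul_right _ _)), if_neg h1, mul_zero]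
  · intro u hu
    rw [Function.mem_support] at hu
    obtain ⟨k, rfl⟩ : d ∣ u := by by_contra h; simp [h] at hu
    exact ⟨k, rfl⟩

lemma factoredWeight_nonneg (s : Finset ℕ) (u : ℕ) : 0 ≤ factoredWeight s u := by
  unfold factoredWeight; split_ifs <;> positivity

lemma factoredWeight_le (s : Finset ℕ) (u : ℕ) : factoredWeight s u ≤ (u : ℝ)⁻¹ := by
  unfold factoredWeight; split_ifs; exacts [le_rfl, by positivity]

lemma factoredWeight_zero (s : Finset ℕ) : factoredWeight s 0 = 0 := by
  unfold factoredWeight; split_ifs <;> simp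

lemma one_sub_inv_pos {p : ℕ} (hp : p.Prime) : 0 < 1 - (p : ℝ)⁻¹ := by
  have hp1 : (1 : ℝ) < p := by exact_mod_cast hp.one_lt
  exact sub_pos.2 (inv_lt_one_of_one_lt₀ hp1)

/-- The finite Euler product of the normalised local factors. -/
theorem prod_localFactor_eq_tsum {h : ℕ} (hh : 0 < h) {s : Finset ℕ} (hs : ∀ p ∈ s, p.Prime) :
    ∏ p ∈ s, ((1 - (p : ℝ)⁻¹) ^ 3 * localFactor h p) =
      ∑' t : ℕ × ℕ × ℕ, kernelTransform h t.1 t.2.1 t.2.2 * (factoredWeight s (t.1.lcm t.2.2) *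
        factoredWeight s (t.1.lcm t.2.1) * factoredWeight s (t.2.1.lcm t.2.2)) := by
  set Z := ∏ p ∈ s, (1 - (p : ℝ)⁻¹)⁻¹ with hZ
  have hZ0 : 0 < Z := Finset.prod_pos fun p hp => inv_pos.2 (one_sub_inv_pos (hs p hp))
  have hmain := tsum_gcdKernel_mul_eq hh (factoredWeight_nonneg s) (factoredWeight_zero s)
    (hasSum_factoredWeight hs).summable (K := Z) fun d hd => by
      rw [multipleSum_factoredWeight hs hd, div_eq_mul_inv]
      exact mul_le_mul_of_nonneg_left (factoredWeight_le s d) hZ0.le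
  have hl : ∑' t : ℕ × ℕ × ℕ, gcdKernel h (t.1.gcd t.2.1) (t.2.1.gcd t.2.2) (t.1.gcd t.2.2) *
      (factoredWeight s t.1 * factoredWeight s t.2.1 * factoredWeight s t.2.2) =
      ∏ p ∈ s, localFactor h p := by
    refine HasSum.tsum_eq ?_
    have hinj : Function.Injective fun t : Nat.factoredNumbers s × Nat.factoredNumbers s ×
        Nat.factoredNumbers s => ((t.1 : ℕ), (t.2.1 : ℕ), (t.2.2 : ℕ)) := by
      rintro ⟨a, b, c⟩ ⟨d, e, f⟩ H
      simp only [Prod.mk.injEq, Subtype.val_inj] at H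
      simp [H]
    rw [← hinj.hasSum_iff]
    · convert hasSum_lcmWeight_factoredNumbers hh hs using 2 with t
      obtain ⟨⟨u, hu⟩, ⟨v, hv⟩, ⟨w, hw⟩⟩ := t
      simp only [Function.comp, factoredWeight, if_pos hu, if_pos hv, if_pos hw]
      rw [lcmWeight_eq h hu.1 hv.1 hw.1]
    · rintro ⟨u, v, w⟩ ht
      have : ¬ (u ∈ Nat.factoredNumbers s ∧ v ∈ Nat.factoredNumbers s ∧ w ∈ Nat.factoredNumbers s) :=
        fun H => ht ⟨(⟨u, H.1⟩, ⟨v, H.2.1⟩, ⟨w, H.2.2⟩), rfl⟩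
      simp only [factoredWeight]
      split_ifs <;> first | (exfalso; tauto) | simp
  have hr : ∀ t : ℕ × ℕ × ℕ, kernelTransform h t.1 t.2.1 t.2.2 *
      (multipleSum (factoredWeight s) (t.1.lcm t.2.2) * multipleSum (factoredWeight s) (t.1.lcm t.2.1) *
          multipleSum (factoredWeight s) (t.2.1.lcm t.2.2)) = Z ^ 3 *
      (kernelTransform h t.1 t.2.1 t.2.2 * (factoredWeight s (t.1.lcm t.2.2) *
        factoredWeight s (t.1.lcm t.2.1) * factoredWeight s (t.2.1.lcm t.2.2))) := by
    rintro ⟨a, b, c⟩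
    simp only
    by_cases H : a = 0 ∨ b = 0 ∨ c = 0
    · simp [kernelTransform_eq_zero h H]
    push Not at H
    rw [multipleSum_factoredWeight hs (Nat.lcm_ne_zero H.1 H.2.2),
      multipleSum_factoredWeight hs (Nat.lcm_ne_zero H.1 H.2.1),
      multipleSum_factoredWeight hs (Nat.lcm_ne_zero H.2.1 H.2.2)]
    ring
  rw [hl] at hmain
  simp only [hr] at hmain
  rw [tsum_mul_left] at hmain
  rw [Finset.prod_mul_distrib, hmain, ← mul_assoc, hZ, ← Finset.prod_pow, ← Finset.prod_mul_distrib]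
  rw [Finset.prod_eq_one, one_mul]
  intro p hp
  rw [← mul_pow, mul_inv_cancel₀ (one_sub_inv_pos (hs p hp)).ne', one_pow]

/-- The leading constant. -/
noncomputable def mainConstant (h : ℕ) : ℝ :=
  ∑' t : ℕ × ℕ × ℕ, kernelTransform h t.1 t.2.1 t.2.2 * (lcmProd t : ℝ)⁻¹

theorem hasProd_mainConstant {h : ℕ} (hh : 0 < h) :
    HasProd (fun p : Nat.Primes => (1 - ((p : ℕ) : ℝ)⁻¹) ^ 3 * localFactor h p) (mainConstant h) := by
  obtain ⟨M, hM0, hM⟩ := exists_abs_kernelTransform_le hh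
  rw [HasProd, SummationFilter.unconditional_filter]
  have hprod : ∀ S : Finset Nat.Primes, ∏ p ∈ S, ((1 - ((p : ℕ) : ℝ)⁻¹) ^ 3 * localFactor h p) =
      ∑' t : ℕ × ℕ × ℕ, kernelTransform h t.1 t.2.1 t.2.2 *
        (factoredWeight (S.image fun p : Nat.Primes => (p : ℕ)) (t.1.lcm t.2.2) *
        factoredWeight (S.image fun p : Nat.Primes => (p : ℕ)) (t.1.lcm t.2.1) *
        factoredWeight (S.image fun p : Nat.Primes => (p : ℕ)) (t.2.1.lcm t.2.2)) := fun S => by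
    rw [← prod_localFactor_eq_tsum hh (fun p hp => ?_), Finset.prod_image (g := fun p : Nat.Primes => (p : ℕ))
      Nat.Primes.coe_nat_injective.injOn]
    · obtain ⟨q, -, rfl⟩ := Finset.mem_image.1 hp
      exact q.2
  simp only [hprod]
  refine tendsto_tsum_of_dominated_convergence (bound := fun t => M * (lcmProd t : ℝ)⁻¹)
    (summable_inv_lcmProd.mul_left M) (fun t => ?_) (Filter.Eventually.of_forall fun S t => ?_)
  · obtain ⟨a, b, c⟩ := t
    simp only
    by_cases H : a = 0 ∨ b = 0 ∨ c = 0
    · simp [kernelTransform_eq_zero h H]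
    push Not at H
    have hev : ∀ d : ℕ, d ≠ 0 → ∀ᶠ S : Finset Nat.Primes in Filter.atTop,
        factoredWeight (S.image fun p : Nat.Primes => (p : ℕ)) d = (d : ℝ)⁻¹ := by
      intro d hd
      filter_upwards [Filter.eventually_ge_atTop (d.primeFactors.subtype Nat.Prime)] with S hS
      unfold factoredWeight
      rw [if_pos]
      rw [Nat.mem_factoredNumbers']
      intro p hp hpd
      refine Finset.mem_image.2 ⟨⟨p, hp⟩, hS ?_, rfl⟩
      rw [Finset.mem_subtype]
      exact Nat.mem_primeFactors.2 ⟨hp, hpd, hd⟩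
    refine tendsto_const_nhds.congr' ?_
    filter_upwards [hev _ (Nat.lcm_ne_zero H.1 H.2.2), hev _ (Nat.lcm_ne_zero H.1 H.2.1),
      hev _ (Nat.lcm_ne_zero H.2.1 H.2.2)] with S h1 h2 h3
    rw [h1, h2, h3, lcmProd]
    push_cast
    rw [mul_inv, mul_inv]
  · rw [Real.norm_eq_abs, abs_mul, abs_of_nonneg (a := _ * _ * _)
      (by have := factoredWeight_nonneg; exact mul_nonneg (mul_nonneg (this _ _) (this _ _)) (this _ _))]
    simp only [lcmProd]
    push_cast
    rw [mul_inv, mul_inv]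
    have h0 := factoredWeight_nonneg
    have h1 := factoredWeight_le
    gcongr
    · exact mul_nonneg (mul_nonneg (h0 _ _) (h0 _ _)) (h0 _ _)
    · exact hM _ _ _
    · exact h0 _ _
    · exact h0 _ _
    · exact h1 _ _
    · exact h1 _ _
    · exact h1 _ _

lemma localFactor_eq_tsum (h p : ℕ) :
    localFactor h p = ∑' ν : ℕ × ℕ × ℕ, lcmWeight h (p ^ ν.1, p ^ ν.2.1, p ^ ν.2.2) := by
  simp [localFactor, lcmWeight]

lemma localFactor_pos {h p : ℕ} (hh : 0 < h) (hp : p.Prime) : 0 < localFactor h p := by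
  rw [localFactor_eq_tsum]
  refine (summable_lcmWeight_prime_pow hh hp).tsum_pos (fun _ => lcmWeight_nonneg _ _) (0, 0, 0) ?_
  simp [lcmWeight_one]

/-- The kernel on powers of a prime `p ∤ 2h` is the indicator of at most one exponent being
nonzero. -/
lemma gcdKernel_prime_pow {h p : ℕ} (hph : ¬ p ∣ 2 * h) (i j k : ℕ) :
    gcdKernel h ((p ^ i).gcd (p ^ j)) ((p ^ j).gcd (p ^ k)) ((p ^ i).gcd (p ^ k)) =
      (if j = 0 then 1 else 0) * (if k = 0 then 1 else 0) +
      (if i = 0 then 1 else 0) * (if k = 0 then 1 else 0) +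
      (if i = 0 then 1 else 0) * (if j = 0 then 1 else 0) -
      2 * ((if i = 0 then 1 else 0) * (if j = 0 then 1 else 0) * (if k = 0 then 1 else 0)) := by
  have hph' : ¬ p ∣ h := fun H => hph (H.mul_left 2)
  have hdvd : ∀ m n, m ≠ 0 → n ≠ 0 → p ∣ (p ^ m).gcd (p ^ n) := fun m n hm hn =>
    Nat.dvd_gcd (dvd_pow_self p hm) (dvd_pow_self p hn)
  have hnot : ∀ m n, m ≠ 0 → n ≠ 0 → ¬ (p ^ m).gcd (p ^ n) ∣ h := fun m n hm hn H =>
    hph' ((hdvd m n hm hn).trans H)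
  have hnot2 : ∀ m n, m ≠ 0 → n ≠ 0 → ¬ (p ^ m).gcd (p ^ n) ∣ 2 * h := fun m n hm hn H =>
    hph ((hdvd m n hm hn).trans H)
  unfold gcdKernel
  by_cases hi : i = 0 <;> by_cases hj : j = 0 <;> by_cases hk : k = 0
  · subst hi hj hk; norm_num
  · subst hi hj; simp [hk]
  · subst hi hk; simp [hj]
  · rw [if_neg fun H => hnot j k hj hk H.2.1]; simp [hi, hj, hk]
  · subst hj hk; simp [hi]
  · rw [if_neg fun H => hnot2 i k hi hk H.2.2]; simp [hi, hj, hk]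
  · rw [if_neg fun H => hnot i j hi hj H.1]; simp [hi, hj, hk]
  · rw [if_neg fun H => hnot i j hi hj H.1]; simp [hi, hj, hk]

lemma localFactor_of_not_dvd {h p : ℕ} (hp : p.Prime) (hph : ¬ p ∣ 2 * h) :
    localFactor h p = (1 + 2 / (p : ℝ)) / (1 - 1 / (p : ℝ)) := by
  have hp1 : (1 : ℝ) < p := by exact_mod_cast hp.one_lt
  have hG := hasSum_geometric_of_lt_one (r := (p : ℝ)⁻¹) (by positivity) (inv_lt_one_of_one_lt₀ hp1)
  have hG0 : (0 : ℕ → ℝ) ≤ fun n => (p : ℝ)⁻¹ ^ n := fun n => by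
    simp only [Pi.zero_apply]; positivity
  have hZ : HasSum (fun n : ℕ => if n = 0 then (1 : ℝ) else 0) 1 := hasSum_ite_eq 0 1
  have hZ0 : (0 : ℕ → ℝ) ≤ fun n => if n = 0 then (1 : ℝ) else 0 := fun n => by
    simp only [Pi.zero_apply]; split_ifs <;> simp
  have hT := (((hasSum_mul_mul hG hZ hZ hG0 hZ0 hZ0).add (hasSum_mul_mul hZ hG hZ hZ0 hG0 hZ0)).add
    (hasSum_mul_mul hZ hZ hG hZ0 hZ0 hG0)).sub ((hasSum_mul_mul hZ hZ hZ hZ0 hZ0 hZ0).mul_left 2)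
  have hpow : ∀ n, p ^ n ≠ 0 := fun n => pow_ne_zero _ hp.ne_zero
  rw [localFactor_eq_tsum]
  refine (hasSum_of_forall_eq hT fun ν => ?_).tsum_eq.trans ?_
  · obtain ⟨i, j, k⟩ := ν
    rw [lcmWeight_eq h (hpow _) (hpow _) (hpow _), gcdKernel_prime_pow hph]
    push_cast
    simp only [← inv_pow]
    by_cases hi : i = 0 <;> by_cases hj : j = 0 <;> by_cases hk : k = 0 <;> simp [hi, hj, hk]
  · have := (one_sub_inv_pos hp).ne'
    rw [one_div, div_eq_mul_inv 2]
    generalize (p : ℝ)⁻¹ = q at this ⊢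
    field_simp
    ring

lemma Delta_pos {h : ℕ} (hh : 0 < h) : 0 < Delta h := by
  refine Finset.prod_pos fun p hp => ?_
  have hp := Nat.prime_of_mem_primeFactors hp
  have h1 := one_sub_inv_pos hp
  have h2 := localFactor_pos hh hp
  rw [one_div]
  positivity

theorem Delta_mul_tprod {h : ℕ} (hh : 0 < h) :
    Delta h * (∏' p : Nat.Primes, (1 - 1 / ((p : ℕ) : ℝ)) ^ 2 * (1 + 2 / ((p : ℕ) : ℝ))) =
      mainConstant h := by
  set δ : ℕ → ℝ := fun p => (1 - 1 / (p : ℝ)) * (1 + 2 / (p : ℝ))⁻¹ * localFactor h p with hδ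
  have hδ0 : ∀ p : ℕ, p.Prime → δ p ≠ 0 := fun p hp => by
    have h1 := one_sub_inv_pos hp
    have h2 := localFactor_pos hh hp
    simp only [hδ]
    rw [one_div]
    positivity
  have hfin : HasProd (fun p : Nat.Primes => (δ p)⁻¹)
      (∏ p ∈ (2 * h).primeFactors.subtype Nat.Prime, (δ p)⁻¹) := by
    refine hasProd_prod_of_ne_finset_one fun p hp => ?_
    have hph : ¬ (p : ℕ) ∣ 2 * h := fun H => hp <| Finset.mem_subtype.2 <|
      Nat.mem_primeFactors.2 ⟨p.2, H, by positivity⟩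
    have h1 := (one_sub_inv_pos p.2).ne'
    simp only [hδ]
    rw [localFactor_of_not_dvd p.2 hph]
    rw [← one_div] at h1
    have h2 : (1 + 2 / ((p : ℕ) : ℝ)) ≠ 0 := by positivity
    field_simp
  have hval : ∏ p ∈ (2 * h).primeFactors.subtype Nat.Prime, (δ p)⁻¹ = (Delta h)⁻¹ := by
    rw [Finset.prod_inv_distrib]
    refine congrArg _ ?_
    exact Finset.prod_subtype_of_mem δ fun p hp => Nat.prime_of_mem_primeFactors hp
  rw [hval] at hfin
  have hE := (hasProd_mainConstant hh).mul hfin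
  have hfun : (fun p : Nat.Primes => (1 - ((p : ℕ) : ℝ)⁻¹) ^ 3 * localFactor h p * (δ p)⁻¹) =
      fun p : Nat.Primes => (1 - 1 / ((p : ℕ) : ℝ)) ^ 2 * (1 + 2 / ((p : ℕ) : ℝ)) := by
    funext p
    have h1 := (one_sub_inv_pos p.2).ne'
    have h3 := (localFactor_pos hh p.2).ne'
    have h2 : (1 + 2 / ((p : ℕ) : ℝ)) ≠ 0 := by positivity
    rw [mul_inv_eq_iff_eq_mul₀ (hδ0 p p.2)]
    simp only [hδ, ← one_div]
    rw [← one_div] at h1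
    field_simp
  rw [hfun] at hE
  rw [hE.tprod_eq]
  have := (Delta_pos hh).ne'
  field_simp

/-- The weight `1 / u` on `1 ≤ u ≤ N`. -/
noncomputable def truncatedWeight (N u : ℕ) : ℝ := if u ∈ Finset.Icc 1 N then (u : ℝ)⁻¹ else 0

lemma truncatedWeight_nonneg (N u : ℕ) : 0 ≤ truncatedWeight N u := by
  unfold truncatedWeight; split_ifs <;> positivity

lemma multipleSum_truncatedWeight (N : ℕ) {d : ℕ} (hd : d ≠ 0) :
    multipleSum (truncatedWeight N) d = (d : ℝ)⁻¹ * (harmonic (N / d) : ℝ) := by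
  unfold multipleSum
  have hinj : Function.Injective (d * ·) := fun x y hxy =>
    Nat.eq_of_mul_eq_mul_left (Nat.pos_of_ne_zero hd) hxy
  rw [← hinj.tsum_eq]
  · simp only [dvd_mul_right, if_true]
    rw [tsum_eq_sum (s := Finset.Icc 1 (N / d)), harmonic_eq_sum_Icc]
    · push_cast
      rw [Finset.mul_sum]
      refine Finset.sum_congr rfl fun k hk => ?_
      rw [Finset.mem_Icc] at hk
      unfold truncatedWeight
      rw [if_pos, Nat.cast_mul, mul_inv]
      rw [Finset.mem_Icc]
      refine ⟨Nat.mul_pos (Nat.pos_of_ne_zero hd) hk.1, ?_⟩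
      rw [mul_comm]
      exact (Nat.le_div_iff_mul_le (Nat.pos_of_ne_zero hd)).1 hk.2
    · intro k hk
      unfold truncatedWeight
      rw [if_neg]
      intro H
      rw [Finset.mem_Icc] at H
      refine hk (Finset.mem_Icc.2 ⟨Nat.pos_of_ne_zero fun h0 => ?_, ?_⟩)
      · simp [h0] at H
      · rw [Nat.le_div_iff_mul_le (Nat.pos_of_ne_zero hd), mul_comm]
        exact H.2
  · intro u hu
    rw [Function.mem_support] at hu
    obtain ⟨k, rfl⟩ : d ∣ u := by by_contra h; simp [h] at hu
    exact ⟨k, rfl⟩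

lemma harmonic_floor_div_le {x : ℝ} (hx : 1 ≤ x) {d : ℕ} (hd : d ≠ 0) :
    (harmonic (⌊x⌋₊ / d) : ℝ) ≤ 1 + Real.log x := by
  have hd1 : (1 : ℝ) ≤ d := by exact_mod_cast Nat.one_le_iff_ne_zero.2 hd
  have hlx := Real.log_nonneg hx
  rw [← Nat.floor_div_natCast]
  rcases le_or_gt 1 (x / d) with h1 | h1
  · refine (harmonic_floor_le_one_add_log _ h1).trans ?_
    gcongr
    exact div_le_self (by linarith) hd1
  · rw [Nat.floor_eq_zero.2 h1, harmonic_zero]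
    push_cast
    linarith

lemma abs_harmonic_floor_div_sub_log_le {x : ℝ} (hx : 1 ≤ x) {d : ℕ} (hd : d ≠ 0) :
    |(harmonic (⌊x⌋₊ / d) : ℝ) - Real.log x| ≤ 1 + Real.log d := by
  have hd1 : (1 : ℝ) ≤ d := by exact_mod_cast Nat.one_le_iff_ne_zero.2 hd
  have hx0 : (0 : ℝ) < x := by linarith
  have hd0 : (0 : ℝ) < d := by linarith
  have hlx := Real.log_nonneg hx
  have hld := Real.log_nonneg hd1
  have hub := harmonic_floor_div_le hx hd
  rw [← Nat.floor_div_natCast] at hub ⊢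
  have hlb := log_le_harmonic_floor (x / d) (by positivity)
  rw [Real.log_div hx0.ne' hd0.ne'] at hlb
  rw [abs_le]
  constructor <;> linarith

lemma abs_mul_mul_sub_pow_three_le {a b c l A B C : ℝ} (hl : 0 ≤ l) (ha : |a - l| ≤ A)
    (hb : |b - l| ≤ B) (hc : |c - l| ≤ C) (ha0 : 0 ≤ a) (hb0 : 0 ≤ b) (ha1 : a ≤ 1 + l)
    (hb1 : b ≤ 1 + l) : |a * b * c - l ^ 3| ≤ (1 + l) ^ 2 * (A + B + C) := by
  have h : a * b * c - l ^ 3 = a * b * (c - l) + a * l * (b - l) + l * l * (a - l) := by ring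
  have hA := (abs_nonneg _).trans ha
  have hB := (abs_nonneg _).trans hb
  have hC := (abs_nonneg _).trans hc
  calc |a * b * c - l ^ 3| ≤ |a * b * (c - l)| + |a * l * (b - l)| + |l * l * (a - l)| := by
        rw [h]; exact abs_add_three _ _ _
    _ = a * b * |c - l| + a * l * |b - l| + l * l * |a - l| := by
        simp only [abs_mul, abs_of_nonneg ha0, abs_of_nonneg hb0, abs_of_nonneg hl]
    _ ≤ (1 + l) * (1 + l) * C + (1 + l) * (1 + l) * B + (1 + l) * (1 + l) * A := by
        gcongr <;> linarith
    _ = _ := by ring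

lemma sum_lcmWeight_eq_tsum (h N : ℕ) :
    ∑ u ∈ Finset.Icc 1 N, ∑ v ∈ Finset.Icc 1 N, ∑ w ∈ Finset.Icc 1 N, lcmWeight h (u, v, w) =
      ∑' t : ℕ × ℕ × ℕ, gcdKernel h (t.1.gcd t.2.1) (t.2.1.gcd t.2.2) (t.1.gcd t.2.2) *
        (truncatedWeight N t.1 * truncatedWeight N t.2.1 * truncatedWeight N t.2.2) := by
  rw [tsum_eq_sum (s := Finset.Icc 1 N ×ˢ Finset.Icc 1 N ×ˢ Finset.Icc 1 N)]
  · simp only [Finset.sum_product]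
    refine Finset.sum_congr rfl fun u hu => Finset.sum_congr rfl fun v hv =>
      Finset.sum_congr rfl fun w hw => ?_
    have h0 : ∀ n ∈ Finset.Icc 1 N, n ≠ 0 := fun n hn => by
      rw [Finset.mem_Icc] at hn; omega
    simp only [truncatedWeight, if_pos hu, if_pos hv, if_pos hw]
    rw [lcmWeight_eq h (h0 u hu) (h0 v hv) (h0 w hw)]
  · rintro ⟨u, v, w⟩ ht
    simp only [Finset.mem_product, truncatedWeight] at ht ⊢
    split_ifs <;> first | (exfalso; tauto) | simp

theorem abs_sum_lcmWeight_sub_le {h : ℕ} (hh : 0 < h) :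
    ∃ C : ℝ, 0 < C ∧ ∀ x : ℝ, 1 ≤ x →
      |(∑ u ∈ Finset.Icc 1 ⌊x⌋₊, ∑ v ∈ Finset.Icc 1 ⌊x⌋₊, ∑ w ∈ Finset.Icc 1 ⌊x⌋₊,
          lcmWeight h (u, v, w)) - mainConstant h * Real.log x ^ 3| ≤ C * (1 + Real.log x) ^ 2 := by
  obtain ⟨M, hM0, hM⟩ := exists_abs_kernelTransform_le hh
  set T := ∑' t : ℕ × ℕ × ℕ, (3 + Real.log (lcmProd t)) / (lcmProd t : ℝ) with hT
  have hT0 : 0 ≤ T := tsum_nonneg fun t => by positivity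
  refine ⟨M * T + 1, by positivity, fun x hx => ?_⟩
  have hl := Real.log_nonneg hx
  set l := Real.log x
  set ω := truncatedWeight ⌊x⌋₊ with hω
  have hW : ∀ d, d ≠ 0 → multipleSum ω d = (d : ℝ)⁻¹ * (harmonic (⌊x⌋₊ / d) : ℝ) := fun d hd =>
    multipleSum_truncatedWeight _ hd
  have hsum : Summable ω := summable_of_ne_finset_zero (s := Finset.Icc 1 ⌊x⌋₊) fun u hu => if_neg hu
  rw [sum_lcmWeight_eq_tsum, tsum_gcdKernel_mul_eq hh (truncatedWeight_nonneg _)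
    (by simp [truncatedWeight]) hsum (K := 1 + l) fun d hd => by
      rw [hW d hd, div_eq_inv_mul]
      exact mul_le_mul_of_nonneg_left (harmonic_floor_div_le hx hd) (by positivity)]
  set G : ℕ × ℕ × ℕ → ℝ := fun s => kernelTransform h s.1 s.2.1 s.2.2 *
    (multipleSum ω (s.1.lcm s.2.2) * multipleSum ω (s.1.lcm s.2.1) *
      multipleSum ω (s.2.1.lcm s.2.2)) with hG
  set H : ℕ × ℕ × ℕ → ℝ := fun s => kernelTransform h s.1 s.2.1 s.2.2 * (lcmProd s : ℝ)⁻¹ with hH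
  have hHs : Summable H := by
    refine Summable.of_norm_bounded (summable_inv_lcmProd.mul_left M) fun s => ?_
    rw [Real.norm_eq_abs, hH, abs_mul, abs_of_nonneg (a := ((lcmProd s : ℕ) : ℝ)⁻¹) (by positivity)]
    exact mul_le_mul_of_nonneg_right (hM _ _ _) (by positivity)
  have hbound : ∀ s, |G s - H s * l ^ 3| ≤
      M * (1 + l) ^ 2 * ((3 + Real.log (lcmProd s)) / (lcmProd s : ℝ)) := by
    rintro ⟨a, b, c⟩
    by_cases h0 : a = 0 ∨ b = 0 ∨ c = 0
    · simp only [hG, hH, kernelTransform_eq_zero h h0, zero_mul, sub_zero, abs_zero]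
      positivity
    push Not at h0
    have h1 := Nat.lcm_ne_zero h0.1 h0.2.2
    have h2 := Nat.lcm_ne_zero h0.1 h0.2.1
    have h3 := Nat.lcm_ne_zero h0.2.1 h0.2.2
    have h1' : ((a.lcm c : ℕ) : ℝ) ≠ 0 := by exact_mod_cast h1
    have h2' : ((a.lcm b : ℕ) : ℝ) ≠ 0 := by exact_mod_cast h2
    have h3' : ((b.lcm c : ℕ) : ℝ) ≠ 0 := by exact_mod_cast h3
    have hharm : ∀ n : ℕ, (0 : ℝ) ≤ (harmonic n : ℝ) := fun n => by
      rw [harmonic]; push_cast; exact Finset.sum_nonneg fun i _ => by positivity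
    have key := abs_mul_mul_sub_pow_three_le hl (abs_harmonic_floor_div_sub_log_le hx h1)
      (abs_harmonic_floor_div_sub_log_le hx h2) (abs_harmonic_floor_div_sub_log_le hx h3)
      (hharm _) (hharm _) (harmonic_floor_div_le hx h1) (harmonic_floor_div_le hx h2)
    have hlog : Real.log (lcmProd (a, b, c)) =
        Real.log (a.lcm c) + Real.log (a.lcm b) + Real.log (b.lcm c) := by
      simp only [lcmProd]
      push_cast
      rw [Real.log_mul (mul_ne_zero h1' h2') h3', Real.log_mul h1' h2']
    have hGH : G (a, b, c) - H (a, b, c) * l ^ 3 = kernelTransform h a b c *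
        ((lcmProd (a, b, c) : ℝ)⁻¹ * ((harmonic (⌊x⌋₊ / a.lcm c) : ℝ) *
          (harmonic (⌊x⌋₊ / a.lcm b) : ℝ) * (harmonic (⌊x⌋₊ / b.lcm c) : ℝ) - l ^ 3)) := by
      simp only [hG, hH, hW _ h1, hW _ h2, hW _ h3, lcmProd]
      push_cast
      rw [mul_inv, mul_inv]
      ring
    rw [hGH, abs_mul, abs_mul, abs_of_nonneg (a := ((lcmProd (a, b, c) : ℕ) : ℝ)⁻¹) (by positivity),
      div_eq_inv_mul, hlog]
    calc _ ≤ M * ((lcmProd (a, b, c) : ℝ)⁻¹ * ((1 + l) ^ 2 * (1 + Real.log (a.lcm c) +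
          (1 + Real.log (a.lcm b)) + (1 + Real.log (b.lcm c))))) := by
          gcongr
          exact hM _ _ _
      _ = _ := by ring
  have hBs := summable_log_lcmProd.mul_left (M * (1 + l) ^ 2)
  have hDs : Summable fun s => G s - H s * l ^ 3 := Summable.of_norm_bounded hBs hbound
  have hGs : Summable G := by
    exact hasSum_of_forall_eq (hDs.add (hHs.mul_right (l ^ 3))).hasSum
      (fun s => (sub_add_cancel _ _).symm) |>.summable
  have hdiff : ∑' s, G s - mainConstant h * l ^ 3 = ∑' s, (G s - H s * l ^ 3) := by
    rw [hGs.tsum_sub (hHs.mul_right _), tsum_mul_right, mainConstant]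
  rw [hdiff]
  rw [← Real.norm_eq_abs]
  calc _ ≤ ∑' s, M * (1 + l) ^ 2 * ((3 + Real.log (lcmProd s)) / (lcmProd s : ℝ)) :=
        tsum_of_norm_bounded hBs.hasSum hbound
    _ = M * T * (1 + l) ^ 2 := by rw [tsum_mul_left]; ring
    _ ≤ (M * T + 1) * (1 + l) ^ 2 := by
        gcongr
        linarith

theorem stmt17 (h : ℕ) (hh : 0 < h) :
    Delta h ≠ 0 ∧
    (∀ p ∈ (2 * h).primeFactors, Summable (fun ν : ℕ × ℕ × ℕ =>
      gInd h (p ^ ν.1) (p ^ ν.2.1) (p ^ ν.2.2) /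
        (Nat.lcm (Nat.lcm (p ^ ν.1) (p ^ ν.2.1)) (p ^ ν.2.2) : ℝ))) ∧
    ∃ C : ℝ, 0 < C ∧ ∃ x₀ : ℝ, ∀ x ≥ x₀,
      |(∑ u ∈ Finset.Icc 1 ⌊x⌋₊, ∑ v ∈ Finset.Icc 1 ⌊x⌋₊, ∑ w ∈ Finset.Icc 1 ⌊x⌋₊,
          gInd h u v w / (Nat.lcm (Nat.lcm u v) w : ℝ))
        - Delta h * (∏' p : Nat.Primes, (1 - 1 / ((p : ℕ) : ℝ)) ^ 2 * (1 + 2 / ((p : ℕ) : ℝ)))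
            * (Real.log x) ^ 3|
      ≤ C * (Real.log x) ^ 2 := by
  refine ⟨(Delta_pos hh).ne', fun p hp =>
    summable_lcmWeight_prime_pow hh (Nat.prime_of_mem_primeFactors hp), ?_⟩
  obtain ⟨C, hC0, hC⟩ := abs_sum_lcmWeight_sub_le hh
  refine ⟨4 * C, by positivity, Real.exp 1, fun x hx => ?_⟩
  have hx1 : 1 ≤ x := (Real.one_le_exp zero_le_one).trans hx
  have hl : 1 ≤ Real.log x := (Real.le_log_iff_exp_le (by linarith)).2 hx
  rw [Delta_mul_tprod hh]
  refine (hC x hx1).trans ?_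
  have h4 : (1 + Real.log x) ^ 2 ≤ 4 * Real.log x ^ 2 := by nlinarith
  calc C * (1 + Real.log x) ^ 2 ≤ C * (4 * Real.log x ^ 2) := by gcongr
    _ = 4 * C * Real.log x ^ 2 := by ring
end

section
/- Let h be a positive integer, let p be an odd prime dividing h, and let r ≥ 1 be the exact power of p dividing h (p^r | h and p^{r+1} ∤ h). Let g(u, v, w) = 1 if the system of congruences n ≡ −h (mod u), n ≡ 0 (mod v), n ≡ h (mod w) has an integer solution, and g(u, v, w) = 0 otherwise. Then the series s_p = ∑_{ν₁, ν₂, ν₃ ≥ 0} g(p^{ν₁}, p^{ν₂}, p^{ν₃})/lcm(p^{ν₁}, p^{ν₂}, p^{ν₃}) converges and satisfies (1 − 1/p)³ · s_p = 1 + 4/p + 1/p² − (3r+4)/p^{r+1} − 4/p^{r+2} + (3r+2)/p^{r+3}. -/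
open Real

theorem sum_range_max_three (f : ℕ → ℝ) (n : ℕ) :
    ∑ a ∈ Finset.range n, ∑ b ∈ Finset.range n, ∑ c ∈ Finset.range n, f (max (max a b) c)
      = ∑ m ∈ Finset.range n, (3 * (m : ℝ) ^ 2 + 3 * m + 1) * f m := by
  induction n with
  | zero => simp
  | succ n ih =>
    have h₁ : ∀ a ∈ Finset.range n, ∀ b ∈ Finset.range n, f (max (max a b) n) = f n := by
      intro a ha b hb
      rw [Finset.mem_range] at ha hb
      congr 1; omega
    have h₂ : ∀ a ∈ Finset.range n, ∀ c ∈ Finset.range n, f (max (max a n) c) = f n := by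
      intro a ha c hc
      rw [Finset.mem_range] at ha hc
      congr 1; omega
    have h₃ : ∀ b ∈ Finset.range n, ∀ c ∈ Finset.range n, f (max (max n b) c) = f n := by
      intro b hb c hc
      rw [Finset.mem_range] at hb hc
      congr 1; omega
    have h₄ : ∀ a ∈ Finset.range n, f (max n a) = f n := by
      intro a ha
      rw [Finset.mem_range] at ha
      congr 1; omega
    have h₅ : ∀ a ∈ Finset.range n, f (max (max a n) n) = f n := by
      intro a ha
      rw [Finset.mem_range] at ha
      congr 1; omega
    have h₆ : ∀ a ∈ Finset.range n, f (max (max n a) n) = f n := by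
      intro a ha
      rw [Finset.mem_range] at ha
      congr 1; omega
    simp only [Finset.sum_range_succ, Finset.sum_add_distrib, max_self]
    rw [ih, Finset.sum_congr rfl fun a ha => Finset.sum_congr rfl (h₁ a ha),
      Finset.sum_congr rfl fun a ha => Finset.sum_congr rfl (h₂ a ha),
      Finset.sum_congr rfl fun a ha => Finset.sum_congr rfl (h₃ a ha),
      Finset.sum_congr rfl h₄, Finset.sum_congr rfl h₅, Finset.sum_congr rfl h₆]
    simp only [Finset.sum_const, Finset.card_range, nsmul_eq_mul]
    ring

theorem one_sub_cube_mul_sum_range (x : ℝ) (r : ℕ) :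
    (1 - x) ^ 3 * (∑ m ∈ Finset.range (r + 1), (3 * (m : ℝ) ^ 2 + 3 * m + 1) * x ^ m)
        + 3 * ((r : ℝ) + 1) ^ 2 * x ^ (r + 1) * (1 - x) ^ 2
      = 1 + 4 * x + x ^ 2 - (3 * r + 4) * x ^ (r + 1) - 4 * x ^ (r + 2)
        + (3 * r + 2) * x ^ (r + 3) := by
  induction r with
  | zero => simp; ring
  | succ r ih =>
    rw [Finset.sum_range_succ, mul_add]
    push_cast
    linear_combination ih

theorem gInd_prime_pow {h p r : ℕ} (hp : p.Prime) (hodd : p ≠ 2) (hdvd : p ^ r ∣ h)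
    (hndvd : ¬ p ^ (r + 1) ∣ h) (a b c : ℕ) :
    gInd h (p ^ a) (p ^ b) (p ^ c)
      = if (a ≤ r ∨ b ≤ r) ∧ (b ≤ r ∨ c ≤ r) ∧ (a ≤ r ∨ c ≤ r) then 1 else 0 := by
  unfold gInd
  congr 1
  have small : ∀ k, k ≤ r → ((p ^ k : ℕ) : ℤ) ∣ (h : ℤ) := fun k hk =>
    Int.natCast_dvd_natCast.2 ((pow_dvd_pow p hk).trans hdvd)
  have large : ∀ k, ¬ k ≤ r → ((p ^ (r + 1) : ℕ) : ℤ) ∣ ((p ^ k : ℕ) : ℤ) := fun k hk =>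
    Int.natCast_dvd_natCast.2 (pow_dvd_pow p (by omega))
  have hnot : ¬ ((p ^ (r + 1) : ℕ) : ℤ) ∣ (h : ℤ) := fun H =>
    hndvd (Int.natCast_dvd_natCast.1 H)
  have hnot2 : ¬ ((p ^ (r + 1) : ℕ) : ℤ) ∣ 2 * (h : ℤ) := fun H => by
    have H' : p ^ (r + 1) ∣ 2 * h := by exact_mod_cast H
    refine hndvd (Nat.Coprime.dvd_of_dvd_mul_left ?_ H')
    exact Nat.Coprime.pow_left _ ((Nat.coprime_primes hp Nat.prime_two).2 hodd)
  simp only [Int.modEq_iff_dvd, eq_iff_iff]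
  constructor
  · rintro ⟨n, ha, hb, hc⟩
    refine ⟨?_, ?_, ?_⟩ <;> by_contra! H
    · apply hnot
      rw [show (h : ℤ) = (0 - n) - (-h - n) by ring]
      exact dvd_sub ((large b (by omega)).trans hb) ((large a (by omega)).trans ha)
    · apply hnot
      rw [show (h : ℤ) = (h - n) - (0 - n) by ring]
      exact dvd_sub ((large c (by omega)).trans hc) ((large b (by omega)).trans hb)
    · apply hnot2
      rw [show 2 * (h : ℤ) = (h - n) - (-h - n) by ring]
      exact dvd_sub ((large c (by omega)).trans hc) ((large a (by omega)).trans ha)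
  · rintro ⟨hab, hbc, hac⟩
    by_cases ha : a ≤ r
    · by_cases hb : b ≤ r
      · refine ⟨h, ?_, ?_, by simp⟩
        · rw [show -(h : ℤ) - h = -2 * h by ring]
          exact (small a ha).mul_left (-2)
        · simpa using small b hb
      · refine ⟨0, by simpa using small a ha, by simp, ?_⟩
        simpa using small c (by omega)
    · refine ⟨-h, by simp, by simpa using small b (by omega), ?_⟩
      rw [show (h : ℤ) - -h = 2 * h by ring]
      exact (small c (by omega)).mul_left 2

theorem lcm_pow_three (p a b c : ℕ) :
    Nat.lcm (Nat.lcm (p ^ a) (p ^ b)) (p ^ c) = p ^ max (max a b) c := by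
  have key : ∀ i j, Nat.lcm (p ^ i) (p ^ j) = p ^ max i j := by
    intro i j
    rcases le_total i j with hij | hij
    · rw [max_eq_right hij]
      exact Nat.lcm_eq_right (pow_dvd_pow p hij)
    · rw [max_eq_left hij]
      exact Nat.lcm_eq_left (pow_dvd_pow p hij)
  rw [key, key]

theorem hasSum_ite_le_one (r : ℕ) : HasSum (fun b : ℕ => if b ≤ r then (1 : ℝ) else 0) (r + 1) := by
  have hs : ∑ b ∈ Finset.range (r + 1), (if b ≤ r then (1 : ℝ) else 0) = r + 1 := by
    rw [Finset.sum_congr rfl (g := fun _ => (1 : ℝ))]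
    · simp
    · intro b hb
      rw [Finset.mem_range] at hb
      exact if_pos (by omega)
  rw [← hs]
  refine hasSum_sum_of_ne_finset_zero fun b hb => ?_
  rw [Finset.mem_range] at hb
  exact if_neg (by omega)

theorem hasSum_ite_le_zero_pow {x : ℝ} (hx₀ : 0 ≤ x) (hx₁ : x < 1) (r : ℕ) :
    HasSum (fun a : ℕ => if a ≤ r then 0 else x ^ a) (x ^ (r + 1) * (1 - x)⁻¹) := by
  rw [← hasSum_nat_add_iff' (r + 1), Finset.sum_eq_zero, sub_zero]
  · have hshift : (fun n : ℕ => if n + (r + 1) ≤ r then 0 else x ^ (n + (r + 1)))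
        = fun n => x ^ (r + 1) * x ^ n := by
      ext n
      rw [if_neg (by omega), pow_add, mul_comm]
    rw [hshift]
    exact (hasSum_geometric_of_lt_one hx₀ hx₁).mul_left (x ^ (r + 1))
  · intro a ha
    rw [Finset.mem_range] at ha
    exact if_pos (by omega)

theorem HasSum.mul_mul_of_nonneg {f g k : ℕ → ℝ} {s t u : ℝ} (hf : HasSum f s) (hg : HasSum g t)
    (hk : HasSum k u) (hf₀ : 0 ≤ f) (hg₀ : 0 ≤ g) (hk₀ : 0 ≤ k) :
    HasSum (fun ν : ℕ × ℕ × ℕ => f ν.1 * (g ν.2.1 * k ν.2.2)) (s * (t * u)) := by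
  have hgk := hg.mul hk (hg.summable.mul_of_nonneg hk.summable hg₀ hk₀)
  exact hf.mul hgk
    (hf.summable.mul_of_nonneg hgk.summable hf₀ fun ν => mul_nonneg (hg₀ _) (hk₀ _))

theorem hasSum_pow_max_three {x : ℝ} (hx₀ : 0 ≤ x) (hx₁ : x < 1) (r : ℕ) :
    HasSum (fun ν : ℕ × ℕ × ℕ =>
        if (ν.1 ≤ r ∨ ν.2.1 ≤ r) ∧ (ν.2.1 ≤ r ∨ ν.2.2 ≤ r) ∧ (ν.1 ≤ r ∨ ν.2.2 ≤ r)
          then x ^ max (max ν.1 ν.2.1) ν.2.2 else 0)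
      (∑ m ∈ Finset.range (r + 1), (3 * (m : ℝ) ^ 2 + 3 * m + 1) * x ^ m
        + 3 * ((r : ℝ) + 1) ^ 2 * (x ^ (r + 1) * (1 - x)⁻¹)) := by
  have one := hasSum_ite_le_one r
  have tail := hasSum_ite_le_zero_pow hx₀ hx₁ r
  have one₀ : 0 ≤ fun b : ℕ => if b ≤ r then (1 : ℝ) else 0 := fun b => by
    dsimp; split_ifs <;> norm_num
  have tail₀ : 0 ≤ fun a : ℕ => if a ≤ r then 0 else x ^ a := fun a => by
    dsimp; split_ifs <;> positivity
  have cube : HasSum (fun ν : ℕ × ℕ × ℕ =>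
      if ν.1 ≤ r ∧ ν.2.1 ≤ r ∧ ν.2.2 ≤ r then x ^ max (max ν.1 ν.2.1) ν.2.2 else 0)
      (∑ m ∈ Finset.range (r + 1), (3 * (m : ℝ) ^ 2 + 3 * m + 1) * x ^ m) := by
    have hs : ∑ m ∈ Finset.range (r + 1), (3 * (m : ℝ) ^ 2 + 3 * m + 1) * x ^ m
        = ∑ ν ∈ Finset.range (r + 1) ×ˢ Finset.range (r + 1) ×ˢ Finset.range (r + 1),
          if ν.1 ≤ r ∧ ν.2.1 ≤ r ∧ ν.2.2 ≤ r then x ^ max (max ν.1 ν.2.1) ν.2.2 else 0 := by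
      rw [← sum_range_max_three, Finset.sum_product]
      refine Finset.sum_congr rfl fun a ha => ?_
      rw [Finset.sum_product]
      refine Finset.sum_congr rfl fun b hb => Finset.sum_congr rfl fun c hc => ?_
      rw [Finset.mem_range] at ha hb hc
      exact (if_pos (by dsimp only; omega)).symm
    rw [hs]
    refine hasSum_sum_of_ne_finset_zero fun ν hν => if_neg ?_
    simp only [Finset.mem_product, Finset.mem_range] at hν
    omega
  convert ((cube.add (tail.mul_mul_of_nonneg one one tail₀ one₀ one₀)).add
    (one.mul_mul_of_nonneg tail one one₀ tail₀ one₀)).add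
    (one.mul_mul_of_nonneg one tail one₀ one₀ tail₀) using 1
  · ext ⟨a, b, c⟩
    dsimp only
    by_cases ha : a ≤ r <;> by_cases hb : b ≤ r <;> by_cases hc : c ≤ r <;>
      simp only [ha, hb, hc, if_true, if_false, and_true, and_false, or_true, or_false,
        mul_zero, zero_mul, mul_one, one_mul, add_zero, zero_add, and_self, or_self]
    · congr 1; omega
    · congr 1; omega
    · congr 1; omega
  · ring

theorem stmt18 (h p r : ℕ) (hh : 0 < h) (hp : p.Prime) (hodd : p ≠ 2)
    (hr : 1 ≤ r) (hdvd : p ^ r ∣ h) (hndvd : ¬ p ^ (r + 1) ∣ h) :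
    Summable (fun ν : ℕ × ℕ × ℕ =>
      gInd h (p ^ ν.1) (p ^ ν.2.1) (p ^ ν.2.2) /
        (Nat.lcm (Nat.lcm (p ^ ν.1) (p ^ ν.2.1)) (p ^ ν.2.2) : ℝ)) ∧
    (1 - 1 / (p : ℝ)) ^ 3 *
      (∑' ν : ℕ × ℕ × ℕ,
        gInd h (p ^ ν.1) (p ^ ν.2.1) (p ^ ν.2.2) /
          (Nat.lcm (Nat.lcm (p ^ ν.1) (p ^ ν.2.1)) (p ^ ν.2.2) : ℝ))
      = 1 + 4 / (p : ℝ) + 1 / (p : ℝ) ^ 2 - (3 * r + 4) / (p : ℝ) ^ (r + 1)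
        - 4 / (p : ℝ) ^ (r + 2) + (3 * r + 2) / (p : ℝ) ^ (r + 3) := by
  have hp₁ : (1 : ℝ) < p := by exact_mod_cast hp.one_lt
  have hp₀ : (p : ℝ) ≠ 0 := by positivity
  have hx₀ : 0 ≤ (p : ℝ)⁻¹ := by positivity
  have hx₁ : (p : ℝ)⁻¹ < 1 := inv_lt_one_of_one_lt₀ hp₁
  have hsum : HasSum (fun ν : ℕ × ℕ × ℕ =>
      gInd h (p ^ ν.1) (p ^ ν.2.1) (p ^ ν.2.2) /
        (Nat.lcm (Nat.lcm (p ^ ν.1) (p ^ ν.2.1)) (p ^ ν.2.2) : ℝ))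
      (∑ m ∈ Finset.range (r + 1), (3 * (m : ℝ) ^ 2 + 3 * m + 1) * (p : ℝ)⁻¹ ^ m
        + 3 * ((r : ℝ) + 1) ^ 2 * ((p : ℝ)⁻¹ ^ (r + 1) * (1 - (p : ℝ)⁻¹)⁻¹)) := by
    refine (congrArg (HasSum · _) (funext fun ν => ?_)).mpr (hasSum_pow_max_three hx₀ hx₁ r)
    rw [gInd_prime_pow hp hodd hdvd hndvd, lcm_pow_three]
    push_cast
    split_ifs <;> simp
  refine ⟨hsum.summable, ?_⟩
  rw [hsum.tsum_eq]
  have hne : 1 - (p : ℝ)⁻¹ ≠ 0 := (sub_pos.2 hx₁).ne'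
  have main := one_sub_cube_mul_sum_range (p : ℝ)⁻¹ r
  simp only [div_eq_mul_inv, one_mul, ← inv_pow]
  rw [← main, mul_add]
  congr 1
  field_simp
end

section
/- Let h be a positive integer and let r ≥ 0 be the exact power of 2 dividing h (2^r | h and 2^{r+1} ∤ h). Let g(u, v, w) = 1 if the system of congruences n ≡ −h (mod u), n ≡ 0 (mod v), n ≡ h (mod w) has an integer solution, and g(u, v, w) = 0 otherwise. Then the series s_2 = ∑_{ν₁, ν₂, ν₃ ≥ 0} g(2^{ν₁}, 2^{ν₂}, 2^{ν₃})/lcm(2^{ν₁}, 2^{ν₂}, 2^{ν₃}) converges and equals 26 − (41 + 15r)/2^{r+1}. -/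
open Real

theorem two_pow_exists_iff (h r : ℕ) (hdvd : 2 ^ r ∣ h) (hndvd : ¬ 2 ^ (r + 1) ∣ h) (a b c : ℕ) :
    (∃ n : ℤ, n ≡ -(h : ℤ) [ZMOD ((2 ^ a : ℕ) : ℤ)] ∧ n ≡ 0 [ZMOD ((2 ^ b : ℕ) : ℤ)] ∧
      n ≡ (h : ℤ) [ZMOD ((2 ^ c : ℕ) : ℤ)]) ↔
    min a b ≤ r ∧ min b c ≤ r ∧ min a c ≤ r + 1 := by
  have low : ∀ k, k ≤ r → (2 : ℤ) ^ k ∣ h := fun k hk => by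
    exact_mod_cast (pow_dvd_pow 2 hk).trans hdvd
  have low' : ∀ k, k ≤ r + 1 → (2 : ℤ) ^ k ∣ h + h := fun k hk => by
    rw [← two_mul]
    refine (pow_dvd_pow 2 hk).trans ?_
    rw [pow_succ']
    exact mul_dvd_mul_left 2 (low r le_rfl)
  have high : ∀ k, (2 : ℤ) ^ k ∣ h → k ≤ r := fun k hk => by
    by_contra hlt
    exact hndvd ((pow_dvd_pow 2 (by omega)).trans (by exact_mod_cast hk : 2 ^ k ∣ h))
  have high' : ∀ k, (2 : ℤ) ^ k ∣ h + h → k ≤ r + 1 := fun k hk => by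
    rcases k with _ | k
    · omega
    · rw [← two_mul, pow_succ'] at hk
      have := high k (Int.dvd_of_mul_dvd_mul_left two_ne_zero hk)
      omega
  simp only [Int.modEq_iff_dvd]
  push_cast
  constructor
  · rintro ⟨n, h₁, h₂, h₃⟩
    refine ⟨high _ ?_, high _ ?_, high' _ ?_⟩
    · have := dvd_sub ((pow_dvd_pow 2 (min_le_right a b)).trans h₂)
        ((pow_dvd_pow 2 (min_le_left a b)).trans h₁)
      rwa [show (0 - n) - (-(h : ℤ) - n) = h by ring] at this
    · have := dvd_sub ((pow_dvd_pow 2 (min_le_right b c)).trans h₃)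
        ((pow_dvd_pow 2 (min_le_left b c)).trans h₂)
      simpa using this
    · have := dvd_sub ((pow_dvd_pow 2 (min_le_right a c)).trans h₃)
        ((pow_dvd_pow 2 (min_le_left a c)).trans h₁)
      rwa [show ((h : ℤ) - n) - (-h - n) = h + h by ring] at this
  · rintro ⟨h₁, h₂, h₃⟩
    by_cases hA : b ≤ a ∧ c ≤ a
    · refine ⟨-h, by simp, ?_, ?_⟩
      · simpa using low b (by omega)
      · simpa using low' c (by omega)
    by_cases hB : a ≤ b ∧ c ≤ b
    · refine ⟨0, ?_, by simp, ?_⟩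
      · simpa using low a (by omega)
      · simpa using low c (by omega)
    · refine ⟨h, ?_, ?_, by simp⟩
      · have := (low' a (by omega)).neg_right
        rwa [show -((h : ℤ) + h) = -h - h by ring] at this
      · simpa using low b (by omega)

theorem Nat.lcm_pow_pow (p a b : ℕ) : Nat.lcm (p ^ a) (p ^ b) = p ^ max a b := by
  rcases le_total a b with hab | hab
  · rw [max_eq_right hab, Nat.lcm_eq_right (pow_dvd_pow p hab)]
  · rw [max_eq_left hab, Nat.lcm_eq_left (pow_dvd_pow p hab)]

theorem gInd_div_lcm_two_pow (h r : ℕ) (hdvd : 2 ^ r ∣ h) (hndvd : ¬ 2 ^ (r + 1) ∣ h)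
    (a b c : ℕ) :
    gInd h (2 ^ a) (2 ^ b) (2 ^ c) / (Nat.lcm (Nat.lcm (2 ^ a) (2 ^ b)) (2 ^ c) : ℝ) =
      (if b < min a r + 1 ∧ c < min a (r + 1) + 1 then (1 / 2 : ℝ) ^ a else 0) +
      (if a < min b (r + 1) ∧ c < min b r + 1 then (1 / 2 : ℝ) ^ b else 0) +
      (if a < min c (r + 2) ∧ b < min c (r + 1) then (1 / 2 : ℝ) ^ c else 0) := by
  rw [gInd, Nat.lcm_pow_pow, Nat.lcm_pow_pow]
  simp only [two_pow_exists_iff h r hdvd hndvd]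
  push_cast
  by_cases hA : b ≤ a ∧ c ≤ a
  · rw [show max (max a b) c = a by omega,
      if_neg (show ¬ (a < min b (r + 1) ∧ c < min b r + 1) by omega),
      if_neg (show ¬ (a < min c (r + 2) ∧ b < min c (r + 1)) by omega)]
    have e : (min a b ≤ r ∧ min b c ≤ r ∧ min a c ≤ r + 1) ↔
      (b < min a r + 1 ∧ c < min a (r + 1) + 1) := by omega
    simp only [e]
    split_ifs <;> simp
  rw [if_neg (show ¬ (b < min a r + 1 ∧ c < min a (r + 1) + 1) by omega)]
  by_cases hB : a ≤ b ∧ c ≤ b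
  · rw [show max (max a b) c = b by omega,
      if_neg (show ¬ (a < min c (r + 2) ∧ b < min c (r + 1)) by omega)]
    have e : (min a b ≤ r ∧ min b c ≤ r ∧ min a c ≤ r + 1) ↔
      (a < min b (r + 1) ∧ c < min b r + 1) := by omega
    simp only [e]
    split_ifs <;> simp
  · rw [show max (max a b) c = c by omega,
      if_neg (show ¬ (a < min b (r + 1) ∧ c < min b r + 1) by omega)]
    have e : (min a b ≤ r ∧ min b c ≤ r ∧ min a c ≤ r + 1) ↔
      (a < min c (r + 2) ∧ b < min c (r + 1)) := by omega
    simp only [e]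
    split_ifs <;> simp

/-- Summing a nonnegative function of the first coordinate over triples whose other two
coordinates are bounded in terms of the first. -/
theorem hasSum_ite_lt_and_lt {g : ℕ → ℝ} (hg : ∀ n, 0 ≤ g n) (p q : ℕ → ℕ)
    (hs : Summable fun n => (p n * q n : ℝ) * g n) :
    HasSum (fun x : ℕ × ℕ × ℕ => if x.2.1 < p x.1 ∧ x.2.2 < q x.1 then g x.1 else 0)
      (∑' n, (p n * q n : ℝ) * g n) := by
  have inner : ∀ n, HasSum (fun y : ℕ × ℕ => if y.1 < p n ∧ y.2 < q n then g n else 0)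
      ((p n * q n : ℝ) * g n) := fun n => by
    have := hasSum_sum_of_ne_finset_zero
      (f := fun y : ℕ × ℕ => if y.1 < p n ∧ y.2 < q n then g n else 0)
      (s := Finset.range (p n) ×ˢ Finset.range (q n)) (L := .unconditional _)
      (fun y hy => if_neg (by simpa using hy))
    rw [Finset.sum_congr rfl (g := fun _ => g n) (fun y hy => if_pos (by simpa using hy))] at this
    simpa using this
  have summable : Summable
      (fun x : ℕ × ℕ × ℕ => if x.2.1 < p x.1 ∧ x.2.2 < q x.1 then g x.1 else 0) := by
    refine (summable_prod_of_nonneg fun x => ?_).2 ⟨fun n => (inner n).summable, ?_⟩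
    · dsimp only [Pi.zero_apply]
      split_ifs
      exacts [hg _, le_rfl]
    · exact hs.congr fun n => (inner n).tsum_eq.symm
  rw [← (summable.hasSum.prod_fiberwise inner).tsum_eq.symm]
  exact summable.hasSum

theorem sum_range_three_mul_sq_div_two_pow (r : ℕ) :
    ∑ m ∈ Finset.range (r + 1), (3 * (m : ℝ) ^ 2 + 3 * m + 1) * (1 / 2) ^ m =
      26 - (3 * (r : ℝ) ^ 2 + 15 * r + 25) * (1 / 2) ^ r := by
  induction r with
  | zero => norm_num
  | succ r ih =>
    rw [Finset.sum_range_succ, ih]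
    push_cast
    ring

theorem summable_mul_half_pow_of_le {w : ℕ → ℝ} {C : ℝ} (h₀ : ∀ n, 0 ≤ w n) (hC : ∀ n, w n ≤ C) :
    Summable fun n => w n * (1 / 2 : ℝ) ^ n :=
  Summable.of_nonneg_of_le (fun n => mul_nonneg (h₀ n) (by positivity))
    (fun n => mul_le_mul_of_nonneg_right (hC n) (by positivity))
    (summable_geometric_two.mul_left C)

theorem hasSum_argmax_weights (r : ℕ) :
    HasSum (fun n : ℕ =>
      (((min n r + 1 : ℕ) * (min n (r + 1) + 1 : ℕ) : ℝ) +
        ((min n (r + 1) : ℕ) * (min n r + 1 : ℕ) : ℝ) +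
        ((min n (r + 2) : ℕ) * (min n (r + 1) : ℕ) : ℝ)) * (1 / 2 : ℝ) ^ n)
      (26 - (41 + 15 * r) / 2 ^ (r + 1)) := by
  rw [← hasSum_nat_add_iff' (r + 2), Finset.sum_range_succ]
  have head : ∀ n ∈ Finset.range (r + 1),
      (((min n r + 1 : ℕ) * (min n (r + 1) + 1 : ℕ) : ℝ) +
        ((min n (r + 1) : ℕ) * (min n r + 1 : ℕ) : ℝ) +
        ((min n (r + 2) : ℕ) * (min n (r + 1) : ℕ) : ℝ)) * (1 / 2 : ℝ) ^ n =
      (3 * (n : ℝ) ^ 2 + 3 * n + 1) * (1 / 2) ^ n := fun n hn => by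
    have hn := Finset.mem_range.1 hn
    rw [min_eq_left (show n ≤ r by omega), min_eq_left (show n ≤ r + 1 by omega),
      min_eq_left (show n ≤ r + 2 by omega)]
    push_cast
    ring
  rw [Finset.sum_congr rfl head, sum_range_three_mul_sq_div_two_pow]
  have value : (26 - (41 + 15 * r) / 2 ^ (r + 1) -
      (26 - (3 * (r : ℝ) ^ 2 + 15 * r + 25) * (1 / 2) ^ r +
        (((min (r + 1) r + 1 : ℕ) * (min (r + 1) (r + 1) + 1 : ℕ) : ℝ) +
          ((min (r + 1) (r + 1) : ℕ) * (min (r + 1) r + 1 : ℕ) : ℝ) +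
          ((min (r + 1) (r + 2) : ℕ) * (min (r + 1) (r + 1) : ℕ) : ℝ)) * (1 / 2 : ℝ) ^ (r + 1))) =
      ((r : ℝ) + 1) * (3 * r + 5) * (1 / 2 : ℝ) ^ (r + 2) * 2 := by
    rw [min_eq_right (show r ≤ r + 1 by omega), min_self,
      min_eq_left (show r + 1 ≤ r + 2 by omega), div_eq_mul_inv, ← inv_pow]
    push_cast
    ring
  rw [value]
  refine (hasSum_geometric_two.mul_left
    (((r : ℝ) + 1) * (3 * r + 5) * (1 / 2 : ℝ) ^ (r + 2))).congr_fun fun n => ?_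
  rw [min_eq_right (show r ≤ n + (r + 2) by omega),
    min_eq_right (show r + 1 ≤ n + (r + 2) by omega),
    min_eq_right (show r + 2 ≤ n + (r + 2) by omega)]
  push_cast
  ring

theorem stmt19 (h r : ℕ) (hh : 0 < h) (hdvd : 2 ^ r ∣ h) (hndvd : ¬ 2 ^ (r + 1) ∣ h) :
    Summable (fun ν : ℕ × ℕ × ℕ =>
      gInd h (2 ^ ν.1) (2 ^ ν.2.1) (2 ^ ν.2.2) /
        (Nat.lcm (Nat.lcm (2 ^ ν.1) (2 ^ ν.2.1)) (2 ^ ν.2.2) : ℝ)) ∧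
    (∑' ν : ℕ × ℕ × ℕ,
        gInd h (2 ^ ν.1) (2 ^ ν.2.1) (2 ^ ν.2.2) /
          (Nat.lcm (Nat.lcm (2 ^ ν.1) (2 ^ ν.2.1)) (2 ^ ν.2.2) : ℝ))
      = 26 - (41 + 15 * r) / 2 ^ (r + 1) := by
  have sA := summable_mul_half_pow_of_le
    (w := fun n => ((min n r + 1 : ℕ) * (min n (r + 1) + 1 : ℕ) : ℝ))
    (C := ((r + 1 : ℕ) * (r + 1 + 1 : ℕ) : ℝ)) (fun n => by positivity)
    (fun n => by gcongr <;> omega)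
  have sB := summable_mul_half_pow_of_le
    (w := fun n => ((min n (r + 1) : ℕ) * (min n r + 1 : ℕ) : ℝ))
    (C := ((r + 1 : ℕ) * (r + 1 : ℕ) : ℝ)) (fun n => by positivity)
    (fun n => by gcongr <;> omega)
  have sC := summable_mul_half_pow_of_le
    (w := fun n => ((min n (r + 2) : ℕ) * (min n (r + 1) : ℕ) : ℝ))
    (C := ((r + 2 : ℕ) * (r + 1 : ℕ) : ℝ)) (fun n => by positivity)
    (fun n => by gcongr <;> omega)
  have hg : ∀ n : ℕ, (0 : ℝ) ≤ (1 / 2) ^ n := fun n => by positivity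
  have hA := hasSum_ite_lt_and_lt hg _ _ sA
  have hB := hasSum_ite_lt_and_lt hg _ _ sB
  have hC := hasSum_ite_lt_and_lt hg _ _ sC
  let eB : ℕ × ℕ × ℕ ≃ ℕ × ℕ × ℕ :=
    ⟨fun x => (x.2.1, x.1, x.2.2), fun x => (x.2.1, x.1, x.2.2), fun _ => rfl, fun _ => rfl⟩
  let eC : ℕ × ℕ × ℕ ≃ ℕ × ℕ × ℕ :=
    ⟨fun x => (x.2.2, x.1, x.2.1), fun x => (x.2.1, x.2.2, x.1), fun _ => rfl, fun _ => rfl⟩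
  have key := (hA.add (eB.hasSum_iff.2 hB)).add (eC.hasSum_iff.2 hC)
  have total := ((sA.hasSum.add sB.hasSum).add sC.hasSum).unique
    ((hasSum_argmax_weights r).congr_fun fun n => by ring)
  rw [total] at key
  have main := key.congr_fun fun x : ℕ × ℕ × ℕ =>
    gInd_div_lcm_two_pow h r hdvd hndvd x.1 x.2.1 x.2.2
  exact ⟨main.summable, main.tsum_eq⟩
end
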